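/- Maximum bisection of random regular graphs: for every ε > 0 there exists an integer γ₀ such that for every integer γ ≥ γ₀, if R_n(γ) is a uniformly random simple γ-regular graph on n vertices, then P( |MCUT(R_n(γ))/n − (γ/4 + P_*·√(γ/4))| ≤ ε·√γ ) → 1 as n → ∞ along even n > γ. (That is, w.h.p. MCUT(R_n(γ))/n = γ/4 + P_*√(γ/4) + o_γ(√γ).) -/

import Mathlib

open MeasureTheory Filter Finset

/-- The real value (±1) of a Boolean spin. -/
noncomputable def spin (b : Bool) : ℝ := if b then 1 else -1

/-- The Sherrington–Kirkpatrick Hamiltonian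
`H^SK_n(σ) = -(2n)^{-1/2} Σ_{i,j} J_{ij} σ_i σ_j`. -/
noncomputable def HSK (n : ℕ) (J : Fin n × Fin n → ℝ) (σ : Fin n → Bool) : ℝ :=
  -(Real.sqrt (2 * n))⁻¹ * ∑ p : Fin n × Fin n, J p * spin (σ p.1) * spin (σ p.2)

/-- The law of the i.i.d. standard Gaussian couplings `(J_{ij})`. -/
noncomputable def skMeasure (n : ℕ) : Measure ((Fin n × Fin n) → ℝ) :=
  Measure.pi fun _ => ProbabilityTheory.gaussianReal 0 1

open Classical in
/-- The cut size of the partition `(S, Sᶜ)` in the graph `G`. -/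
noncomputable def cutSize {n : ℕ} (G : SimpleGraph (Fin n)) (S : Finset (Fin n)) : ℕ :=
  ∑ i ∈ S, ∑ j ∈ Sᶜ, if G.Adj i j then 1 else 0

/-- `S` induces a bisection: the sizes of the two parts differ by at most one. -/
def IsBisection {n : ℕ} (S : Finset (Fin n)) : Prop :=
  (n : ℤ) - 1 ≤ 2 * S.card ∧ (2 * S.card : ℤ) ≤ n + 1

/-- Maximum bisection size. -/
noncomputable def MCUT {n : ℕ} (G : SimpleGraph (Fin n)) : ℕ :=
  sSup {k : ℕ | ∃ S : Finset (Fin n), IsBisection S ∧ cutSize G S = k}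

/-- Probability that a uniformly random element of the (finite) set `A`
lies in the set `B`. -/
noncomputable def probUniform {α : Type*} (A B : Set α) : ℝ :=
  ((A ∩ B).ncard : ℝ) / (A.ncard : ℝ)

open MeasureTheory Filter Finset

section Gibbs
variable {ι : Type*}

/-- Partition function over the finite set `B`. -/
noncomputable def Zf (B : Finset ι) (β : ℝ) (H : ι → ℝ) : ℝ := ∑ σ ∈ B, Real.exp (β * H σ)

/-- Gibbs average. -/
noncomputable def av (B : Finset ι) (β : ℝ) (H : ι → ℝ) (δ : ι → ℝ) : ℝ :=
  (∑ σ ∈ B, Real.exp (β * H σ) * δ σ) / Zf B β H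

lemma Zf_pos {B : Finset ι} (hB : B.Nonempty) (β : ℝ) (H : ι → ℝ) : 0 < Zf B β H :=
  Finset.sum_pos (fun _ _ => Real.exp_pos _) hB

lemma av_abs_le {B : Finset ι} (hB : B.Nonempty) (β : ℝ) (H δ : ι → ℝ) {m : ℝ}
    (h : ∀ σ ∈ B, |δ σ| ≤ m) : |av B β H δ| ≤ m := by
  have hZ := Zf_pos hB β H
  unfold av
  rw [abs_div, abs_of_pos hZ, div_le_iff₀ hZ]
  calc |∑ σ ∈ B, Real.exp (β * H σ) * δ σ| ≤ ∑ σ ∈ B, |Real.exp (β * H σ) * δ σ| :=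
        Finset.abs_sum_le_sum_abs _ _
    _ ≤ ∑ σ ∈ B, m * Real.exp (β * H σ) := by
        refine Finset.sum_le_sum fun σ hσ => ?_
        rw [abs_mul, abs_of_pos (Real.exp_pos _), mul_comm]
        exact mul_le_mul_of_nonneg_right (h σ hσ) (Real.exp_pos _).le
    _ = m * Zf B β H := by rw [Zf, Finset.mul_sum]

lemma av_const {B : Finset ι} (hB : B.Nonempty) (β : ℝ) (H : ι → ℝ) (c : ℝ) :
    av B β H (fun _ => c) = c := by
  have hZ := (Zf_pos hB β H).ne'
  unfold av
  rw [← Finset.sum_mul, ← Zf]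
  field_simp

lemma av_sum {κ : Type*} (s : Finset κ) (B : Finset ι) (β : ℝ) (H : ι → ℝ) (δ : κ → ι → ℝ) :
    av B β H (fun σ => ∑ k ∈ s, δ k σ) = ∑ k ∈ s, av B β H (δ k) := by
  unfold av
  rw [← Finset.sum_div]
  congr 1
  rw [Finset.sum_comm]
  exact Finset.sum_congr rfl fun σ _ => Finset.mul_sum _ _ _

lemma av_smul (B : Finset ι) (β : ℝ) (H : ι → ℝ) (c : ℝ) (δ : ι → ℝ) :
    av B β H (fun σ => c * δ σ) = c * av B β H δ := by
  unfold av
  rw [← mul_div_assoc, Finset.mul_sum]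
  congr 1
  exact Finset.sum_congr rfl fun σ _ => by ring

lemma av_add (B : Finset ι) (β : ℝ) (H : ι → ℝ) (δ ε : ι → ℝ) :
    av B β H (fun σ => δ σ + ε σ) = av B β H δ + av B β H ε := by
  unfold av
  rw [← add_div, ← Finset.sum_add_distrib]
  congr 1
  exact Finset.sum_congr rfl fun σ _ => by ring

lemma av_sub (B : Finset ι) (β : ℝ) (H : ι → ℝ) (δ ε : ι → ℝ) :
    av B β H (fun σ => δ σ - ε σ) = av B β H δ - av B β H ε := by
  unfold av
  rw [← sub_div, ← Finset.sum_sub_distrib]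
  congr 1
  exact Finset.sum_congr rfl fun σ _ => by ring

lemma av_congr {B : Finset ι} (β : ℝ) (H : ι → ℝ) {δ ε : ι → ℝ} (h : ∀ σ ∈ B, δ σ = ε σ) :
    av B β H δ = av B β H ε := by
  unfold av
  congr 1
  exact Finset.sum_congr rfl fun σ hσ => by rw [h σ hσ]

lemma hasDerivAt_Zf (B : Finset ι) (β : ℝ) {H : ℝ → ι → ℝ} {H' : ι → ℝ} {t : ℝ}
    (h : ∀ σ ∈ B, HasDerivAt (fun u => H u σ) (H' σ) t) :
    HasDerivAt (fun u => Zf B β (H u)) (β * ∑ σ ∈ B, Real.exp (β * H t σ) * H' σ) t := by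
  unfold Zf
  rw [Finset.mul_sum]
  refine HasDerivAt.fun_sum fun σ hσ => ?_
  exact (((h σ hσ).const_mul β).exp).congr_deriv (by ring)

lemma hasDerivAt_logZ {B : Finset ι} (hB : B.Nonempty) (β : ℝ) {H : ℝ → ι → ℝ} {H' : ι → ℝ}
    {t : ℝ} (h : ∀ σ ∈ B, HasDerivAt (fun u => H u σ) (H' σ) t) :
    HasDerivAt (fun u => Real.log (Zf B β (H u))) (β * av B β (H t) H') t := by
  have := (hasDerivAt_Zf B β h).log (Zf_pos hB β (H t)).ne'
  convert this using 1
  unfold av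
  ring

lemma hasDerivAt_av {B : Finset ι} (hB : B.Nonempty) (β : ℝ) {H : ℝ → ι → ℝ} {H' : ι → ℝ}
    {t : ℝ} (h : ∀ σ ∈ B, HasDerivAt (fun u => H u σ) (H' σ) t) (φ : ι → ℝ) :
    HasDerivAt (fun u => av B β (H u) φ)
      (β * (av B β (H t) (fun σ => H' σ * φ σ) - av B β (H t) H' * av B β (H t) φ)) t := by
  have hZ := (Zf_pos hB β (H t)).ne'
  have h1 : HasDerivAt (fun u => ∑ σ ∈ B, Real.exp (β * H u σ) * φ σ)
      (β * ∑ σ ∈ B, Real.exp (β * H t σ) * (H' σ * φ σ)) t := by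
    rw [Finset.mul_sum]
    refine HasDerivAt.fun_sum fun σ hσ => ?_
    exact ((((h σ hσ).const_mul β).exp).mul_const (φ σ)).congr_deriv (by ring)
  refine (h1.div (hasDerivAt_Zf B β h) hZ).congr_deriv ?_
  unfold av
  field_simp

lemma logZ_lip {B : Finset ι} (hB : B.Nonempty) {β : ℝ} (hβ : 0 ≤ β) {H H' : ι → ℝ} {m : ℝ}
    (h : ∀ σ ∈ B, |H' σ - H σ| ≤ m) :
    |Real.log (Zf B β H') - Real.log (Zf B β H)| ≤ β * m := by
  have key : ∀ H H' : ι → ℝ, (∀ σ ∈ B, |H' σ - H σ| ≤ m) →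
      Real.log (Zf B β H') - Real.log (Zf B β H) ≤ β * m := by
    intro H H' h
    have h1 : Zf B β H' ≤ Real.exp (β * m) * Zf B β H := by
      unfold Zf
      rw [Finset.mul_sum]
      refine Finset.sum_le_sum fun σ hσ => ?_
      rw [← Real.exp_add]
      apply Real.exp_le_exp.2
      nlinarith [(abs_le.1 (h σ hσ)).2]
    have h2 := Real.log_le_log (Zf_pos hB β H') h1
    rw [Real.log_mul (Real.exp_pos _).ne' (Zf_pos hB β H).ne', Real.log_exp] at h2
    linarith
  rw [abs_le]
  constructor
  · have := key H' H (fun σ hσ => by rw [abs_sub_comm]; exact h σ hσ)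
    linarith
  · exact key H H' h

lemma le_logZ {B : Finset ι} {β : ℝ} (H : ι → ℝ) {σ : ι} (hσ : σ ∈ B) :
    β * H σ ≤ Real.log (Zf B β H) := by
  rw [Real.le_log_iff_exp_le (Zf_pos ⟨σ, hσ⟩ β H)]
  exact Finset.single_le_sum (f := fun σ => Real.exp (β * H σ)) (fun _ _ => (Real.exp_pos _).le) hσ

lemma logZ_le {B : Finset ι} (hB : B.Nonempty) {β : ℝ} (hβ : 0 ≤ β) (H : ι → ℝ) {m : ℝ}
    (h : ∀ σ ∈ B, H σ ≤ m) : Real.log (Zf B β H) ≤ Real.log (B.card) + β * m := by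
  have hc : (0:ℝ) < B.card := by exact_mod_cast hB.card_pos
  have h1 : Zf B β H ≤ B.card * Real.exp (β * m) := by
    unfold Zf
    rw [← nsmul_eq_mul]
    refine Finset.sum_le_card_nsmul _ _ _ fun σ hσ => ?_
    exact Real.exp_le_exp.2 (mul_le_mul_of_nonneg_left (h σ hσ) hβ)
  have h2 := Real.log_le_log (Zf_pos hB β H) h1
  rwa [Real.log_mul hc.ne' (Real.exp_pos _).ne', Real.log_exp] at h2

/-- Second order expansion of the Gibbs average. -/
lemma av_taylor {B : Finset ι} (hB : B.Nonempty) (β : ℝ) (H δ : ι → ℝ) {m a : ℝ}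
    (ha : 0 ≤ a) (h : ∀ σ ∈ B, |δ σ| ≤ m) :
    |av B β (fun σ => H σ + a * δ σ) δ - av B β H δ
      - a * (β * (av B β H (fun σ => δ σ * δ σ) - av B β H δ * av B β H δ))|
      ≤ 6 * β ^ 2 * m ^ 3 * a ^ 2 := by
  set P : ℝ → ι → ℝ := fun u σ => H σ + u * δ σ with hP
  have hd : ∀ t, ∀ σ ∈ B, HasDerivAt (fun u => P u σ) (δ σ) t := by
    intro t σ _
    simpa [hP] using ((hasDerivAt_id t).mul_const (δ σ)).const_add (H σ)
  obtain ⟨σ0, hσ0⟩ := hB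
  have hB : B.Nonempty := ⟨σ0, hσ0⟩
  have hm : 0 ≤ m := (abs_nonneg _).trans (h σ0 hσ0)
  set p : ℝ → ℝ := fun u => av B β (P u) δ
  set p1 : ℝ → ℝ := fun u => β * (av B β (P u) (fun σ => δ σ * δ σ) - av B β (P u) δ * av B β (P u) δ)
  have hp : ∀ t, HasDerivAt p (p1 t) t := fun t => hasDerivAt_av hB β (hd t) δ
  set p2 : ℝ → ℝ := fun t => β * (β * (av B β (P t) (fun σ => δ σ * (δ σ * δ σ)) -
      av B β (P t) δ * av B β (P t) (fun σ => δ σ * δ σ)) -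
      (p1 t * av B β (P t) δ + av B β (P t) δ * p1 t)) with hp2
  have hp1 : ∀ t, HasDerivAt p1 (p2 t) t := fun t =>
    ((hasDerivAt_av hB β (hd t) (fun σ => δ σ * δ σ)).sub ((hp t).mul (hp t))).const_mul β
  have e1 : ∀ t, |av B β (P t) δ| ≤ m := fun t => av_abs_le hB β _ _ h
  have e2 : ∀ t, |av B β (P t) (fun σ => δ σ * δ σ)| ≤ m ^ 2 := fun t => av_abs_le hB β _ _ (by
    intro σ hσ; rw [abs_mul, sq]
    exact mul_le_mul (h σ hσ) (h σ hσ) (abs_nonneg _) hm)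
  have e3 : ∀ t, |av B β (P t) (fun σ => δ σ * (δ σ * δ σ))| ≤ m ^ 3 := fun t =>
    av_abs_le hB β _ _ (by
    intro σ hσ; rw [abs_mul, abs_mul, show m ^ 3 = m * (m * m) by ring]
    have := h σ hσ
    gcongr)
  have hb : ∀ t, |p2 t| ≤ 6 * β ^ 2 * m ^ 3 := by
    intro t
    have : p2 t = β ^ 2 * (av B β (P t) (fun σ => δ σ * (δ σ * δ σ))
      - 3 * (av B β (P t) δ * av B β (P t) (fun σ => δ σ * δ σ))
      + 2 * (av B β (P t) δ * (av B β (P t) δ * av B β (P t) δ))) := by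
      simp only [hp2, p1]; ring
    rw [this, abs_mul, abs_of_nonneg (sq_nonneg β)]
    have a1 : |av B β (P t) δ * av B β (P t) (fun σ => δ σ * δ σ)| ≤ m ^ 3 := by
      rw [abs_mul, show m ^ 3 = m * m ^ 2 by ring]
      exact mul_le_mul (e1 t) (e2 t) (abs_nonneg _) hm
    have a2 : |av B β (P t) δ * (av B β (P t) δ * av B β (P t) δ)| ≤ m ^ 3 := by
      rw [abs_mul, abs_mul, show m ^ 3 = m * (m * m) by ring]
      have := e1 t
      gcongr
    have a3 := e3 t
    have : |av B β (P t) (fun σ => δ σ * (δ σ * δ σ))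
      - 3 * (av B β (P t) δ * av B β (P t) (fun σ => δ σ * δ σ))
      + 2 * (av B β (P t) δ * (av B β (P t) δ * av B β (P t) δ))| ≤ 6 * m ^ 3 := by
      rw [abs_le] at *
      constructor <;> linarith [a1.1, a1.2, a2.1, a2.2, a3.1, a3.2]
    nlinarith [sq_nonneg β]
  set C := 6 * β ^ 2 * m ^ 3
  have hC : 0 ≤ C := (abs_nonneg _).trans (hb 0)
  have q1 : ∀ u ∈ Set.Icc 0 a, |p1 u - p1 0| ≤ C * a := by
    intro u hu
    have := (convex_univ (𝕜 := ℝ) (E := ℝ)).norm_image_sub_le_of_norm_hasDerivWithin_le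
      (f := p1) (f' := p2) (C := C) (fun x _ => (hp1 x).hasDerivWithinAt) (fun x _ => hb x)
      (Set.mem_univ 0) (Set.mem_univ u)
    rw [Real.norm_eq_abs, Real.norm_eq_abs, sub_zero, abs_of_nonneg hu.1] at this
    exact this.trans (mul_le_mul_of_nonneg_left hu.2 hC)
  have q2 := (convex_Icc (0:ℝ) a).norm_image_sub_le_of_norm_hasDerivWithin_le
      (f := fun u => p u - u * p1 0) (f' := fun u => p1 u - p1 0) (C := C * a)
      (fun x _ => ((hp x).sub (by simpa using (hasDerivAt_id x).mul_const (p1 0))).hasDerivWithinAt)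
      (fun x hx => q1 x hx) (Set.left_mem_Icc.2 ha) (Set.right_mem_Icc.2 ha)
  rw [Real.norm_eq_abs, Real.norm_eq_abs, sub_zero, abs_of_nonneg ha] at q2
  have hP0 : P 0 = H := by funext σ; simp [hP]
  have : p a - a * p1 0 - (p 0 - 0 * p1 0) = av B β (P a) δ - av B β H δ
      - a * (β * (av B β H (fun σ => δ σ * δ σ) - av B β H δ * av B β H δ)) := by
    simp only [p, p1, hP0]; ring
  rw [this] at q2
  calc _ ≤ C * a * a := q2
    _ = C * a ^ 2 := by ring

end Gibbs

set_option linter.all false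
open MeasureTheory Filter Finset

section Graphs
variable {n : ℕ}

open Classical in
/-- Adjacency matrix with real entries. -/
noncomputable def adj (G : SimpleGraph (Fin n)) (x y : Fin n) : ℝ := if G.Adj x y then 1 else 0

open Classical in
/-- The finite set of regular graphs. -/
noncomputable def regs (n γ : ℕ) : Finset (SimpleGraph (Fin n)) :=
  Finset.univ.filter fun G => ∀ v, (G.neighborSet v).ncard = γ

lemma adj_symm (G : SimpleGraph (Fin n)) (x y : Fin n) : adj G x y = adj G y x := by
  unfold adj; rw [G.adj_comm]

lemma adj_nonneg (G : SimpleGraph (Fin n)) (x y : Fin n) : 0 ≤ adj G x y := by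
  unfold adj; split_ifs <;> norm_num

lemma adj_le_one (G : SimpleGraph (Fin n)) (x y : Fin n) : adj G x y ≤ 1 := by
  unfold adj; split_ifs <;> norm_num

lemma sum_adj (G : SimpleGraph (Fin n)) (x : Fin n) :
    ∑ y, adj G x y = ((G.neighborSet x).ncard : ℝ) := by
  classical
  unfold adj
  rw [Finset.sum_boole, Set.ncard_eq_toFinset_card']
  congr 2
  ext y
  simp

lemma mem_regs {γ : ℕ} {G : SimpleGraph (Fin n)} :
    G ∈ regs n γ ↔ ∀ x, ∑ y, adj G x y = γ := by
  simp only [regs, Finset.mem_filter, Finset.mem_univ, true_and, sum_adj, Nat.cast_inj]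

lemma sum_adj' {γ : ℕ} {G : SimpleGraph (Fin n)} (hG : G ∈ regs n γ) (y : Fin n) :
    ∑ x, adj G x y = γ := by
  rw [← mem_regs.1 hG y]
  exact Finset.sum_congr rfl fun x _ => adj_symm G x y

lemma adj_inj {G G' : SimpleGraph (Fin n)} (h : ∀ x y, adj G x y = adj G' x y) : G = G' := by
  ext x y
  have := h x y
  unfold adj at this
  by_cases h1 : G.Adj x y <;> by_cases h2 : G'.Adj x y <;> simp_all

/-- A switch is applicable. -/
def App (G : SimpleGraph (Fin n)) (a b c d : Fin n) : Prop :=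
  G.Adj a b ∧ G.Adj c d ∧ ¬ G.Adj a c ∧ ¬ G.Adj b d ∧ a ≠ c ∧ b ≠ d

/-- The switched graph. -/
def sw (G : SimpleGraph (Fin n)) (a b c d : Fin n) : SimpleGraph (Fin n) where
  Adj x y := x ≠ y ∧ ((G.Adj x y ∧ ¬ ((x = a ∧ y = b) ∨ (x = b ∧ y = a)) ∧
      ¬ ((x = c ∧ y = d) ∨ (x = d ∧ y = c))) ∨ ((x = a ∧ y = c) ∨ (x = c ∧ y = a)) ∨
      ((x = b ∧ y = d) ∨ (x = d ∧ y = b)))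
  symm := ⟨fun x y h => by
    have e : ∀ p q : Fin n, ((x = p ∧ y = q) ∨ (x = q ∧ y = p)) ↔
        ((y = p ∧ x = q) ∨ (y = q ∧ x = p)) := fun p q => by
      rw [or_comm, and_comm, and_comm (a := x = p)]
    rwa [e, e, e, e, G.adj_comm, ne_comm] at h⟩
  loopless := ⟨fun x h => h.1 rfl⟩

/-- Symmetric unit matrix. -/
def SS (a b x y : Fin n) : ℝ :=
  (if x = a then 1 else 0) * (if y = b then 1 else 0) +
    (if x = b then 1 else 0) * (if y = a then 1 else 0)

lemma SS_eq {a b : Fin n} (h : a ≠ b) (x y : Fin n) :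
    SS a b x y = if (x = a ∧ y = b) ∨ (x = b ∧ y = a) then 1 else 0 := by
  unfold SS
  by_cases h1 : x = a <;> by_cases h2 : y = b <;> by_cases h3 : x = b <;> by_cases h4 : y = a <;>
    simp_all

lemma App.ne {G : SimpleGraph (Fin n)} {a b c d : Fin n} (h : App G a b c d) :
    a ≠ b ∧ c ≠ d ∧ a ≠ d ∧ b ≠ c := by
  obtain ⟨h1, h2, h3, h4, h5, h6⟩ := h
  refine ⟨h1.ne, h2.ne, ?_, ?_⟩
  · rintro rfl; exact h3 h2.symm
  · rintro rfl; exact h3 h1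

lemma adj_sw {G : SimpleGraph (Fin n)} {a b c d : Fin n} (h : App G a b c d) (x y : Fin n) :
    adj (sw G a b c d) x y = adj G x y - SS a b x y - SS c d x y + SS a c x y + SS b d x y := by
  obtain ⟨n1, n2, n3, n4⟩ := h.ne
  obtain ⟨h1, h2, h3, h4, h5, h6⟩ := h
  rw [SS_eq n1, SS_eq n2, SS_eq h5, SS_eq h6]
  have h1' := h1.symm
  have h2' := h2.symm
  have h3' : ¬ G.Adj c a := fun h => h3 h.symm
  have h4' : ¬ G.Adj d b := fun h => h4 h.symm
  unfold adj
  by_cases e1 : (x = a ∧ y = b) ∨ (x = b ∧ y = a)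
  · rcases e1 with ⟨rfl, rfl⟩ | ⟨rfl, rfl⟩ <;> simp [sw, h1, h1', n1, n2, n3, n4, h5, h6, n1.symm, n2.symm, n3.symm, n4.symm, h5.symm, h6.symm]
  by_cases e2 : (x = c ∧ y = d) ∨ (x = d ∧ y = c)
  · rcases e2 with ⟨rfl, rfl⟩ | ⟨rfl, rfl⟩ <;> simp [sw, h2, h2', n1, n2, n3, n4, h5, h6, n1.symm, n2.symm, n3.symm, n4.symm, h5.symm, h6.symm]
  by_cases e3 : (x = a ∧ y = c) ∨ (x = c ∧ y = a)
  · rcases e3 with ⟨rfl, rfl⟩ | ⟨rfl, rfl⟩ <;> simp [sw, h3, h3', n1, n2, n3, n4, h5, h6, n1.symm, n2.symm, n3.symm, n4.symm, h5.symm, h6.symm]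
  by_cases e4 : (x = b ∧ y = d) ∨ (x = d ∧ y = b)
  · rcases e4 with ⟨rfl, rfl⟩ | ⟨rfl, rfl⟩ <;> simp [sw, h4, h4', n1, n2, n3, n4, h5, h6, n1.symm, n2.symm, n3.symm, n4.symm, h5.symm, h6.symm]
  have : (sw G a b c d).Adj x y ↔ G.Adj x y := by
    simp only [sw, e1, e2, e3, e4]
    simp only [not_false_eq_true, and_true, or_false, and_iff_right_iff_imp]
    exact fun h => h.ne
  rw [if_neg e1, if_neg e2, if_neg e3, if_neg e4]
  by_cases hh : G.Adj x y
  · rw [if_pos hh, if_pos (this.2 hh)]; ring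
  · rw [if_neg hh, if_neg (fun h => hh (this.1 h))]; ring

/-- Bilinear form. -/
noncomputable def EE (G : SimpleGraph (Fin n)) (f g : Fin n → ℝ) : ℝ :=
  ∑ x, ∑ y, adj G x y * f x * g y

lemma sum_SS (a b : Fin n) (f g : Fin n → ℝ) :
    ∑ x, ∑ y, SS a b x y * f x * g y = f a * g b + f b * g a := by
  have h1 : ∀ p q : Fin n, ∑ x, ∑ y, ((if x = p then (1:ℝ) else 0) * (if y = q then 1 else 0)) * f x * g y
      = f p * g q := by
    intro p q
    simp [Finset.sum_ite_eq', ite_mul]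
  rw [← h1 a b, ← h1 b a, ← Finset.sum_add_distrib]
  refine Finset.sum_congr rfl fun x _ => ?_
  rw [← Finset.sum_add_distrib]
  refine Finset.sum_congr rfl fun y _ => ?_
  unfold SS; ring

lemma EE_sw {G : SimpleGraph (Fin n)} {a b c d : Fin n} (h : App G a b c d) (f : Fin n → ℝ) :
    EE (sw G a b c d) f f - EE G f f = 2 * ((f a - f d) * (f c - f b)) := by
  have : EE (sw G a b c d) f f = EE G f f - ∑ x, ∑ y, SS a b x y * f x * f y
      - ∑ x, ∑ y, SS c d x y * f x * f y + ∑ x, ∑ y, SS a c x y * f x * f y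
      + ∑ x, ∑ y, SS b d x y * f x * f y := by
    unfold EE
    simp only [← Finset.sum_sub_distrib, ← Finset.sum_add_distrib]
    refine Finset.sum_congr rfl fun x _ => Finset.sum_congr rfl fun y _ => ?_
    rw [adj_sw h]; ring
  rw [this]
  simp only [sum_SS]
  ring

lemma row_SS (a b x : Fin n) :
    ∑ y, SS a b x y = (if x = a then 1 else 0) + (if x = b then 1 else 0) := by
  unfold SS
  rw [Finset.sum_add_distrib, ← Finset.mul_sum, ← Finset.mul_sum]
  simp

lemma sw_mem {γ : ℕ} {G : SimpleGraph (Fin n)} {a b c d : Fin n} (h : App G a b c d)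
    (hG : G ∈ regs n γ) : sw G a b c d ∈ regs n γ := by
  rw [mem_regs] at *
  intro x
  rw [← hG x]
  simp only [adj_sw h, Finset.sum_add_distrib, Finset.sum_sub_distrib, row_SS]
  ring

lemma App_sw {G : SimpleGraph (Fin n)} {a b c d : Fin n} (h : App G a b c d) :
    App (sw G a b c d) a c b d := by
  obtain ⟨n1, n2, n3, n4⟩ := h.ne
  obtain ⟨h1, h2, h3, h4, h5, h6⟩ := h
  refine ⟨?_, ?_, ?_, ?_, n1, n2⟩ <;> simp [sw, n1, n2, n3, n4, h5, h6, n1.symm, n2.symm, n3.symm, n4.symm, h5.symm, h6.symm]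

lemma sw_sw {G : SimpleGraph (Fin n)} {a b c d : Fin n} (h : App G a b c d) :
    sw (sw G a b c d) a c b d = G := by
  refine adj_inj fun x y => ?_
  rw [adj_sw (App_sw h), adj_sw h]
  ring

/-- Quadruples of vertices. -/
abbrev Quad (n : ℕ) := Fin n × Fin n × Fin n × Fin n

open Classical in
/-- Applicable switches. -/
noncomputable def apps (G : SimpleGraph (Fin n)) : Finset (Quad n) :=
  Finset.univ.filter fun q => App G q.1 q.2.1 q.2.2.1 q.2.2.2

/-- Switch with bundled quadruple. -/
def swq (G : SimpleGraph (Fin n)) (q : Quad n) : SimpleGraph (Fin n) := sw G q.1 q.2.1 q.2.2.1 q.2.2.2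

lemma mem_apps {G : SimpleGraph (Fin n)} {q : Quad n} :
    q ∈ apps G ↔ App G q.1 q.2.1 q.2.2.1 q.2.2.2 := by simp [apps]

lemma reversible (γ : ℕ) (Φ : SimpleGraph (Fin n) → SimpleGraph (Fin n) → ℝ) :
    ∑ G ∈ regs n γ, ∑ q ∈ apps G, Φ G (swq G q) = ∑ G ∈ regs n γ, ∑ q ∈ apps G, Φ (swq G q) G := by
  rw [Finset.sum_sigma', Finset.sum_sigma']
  refine Finset.sum_nbij' (fun p => ⟨swq p.1 p.2, (p.2.1, p.2.2.2.1, p.2.2.1, p.2.2.2.2)⟩)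
    (fun p => ⟨swq p.1 p.2, (p.2.1, p.2.2.2.1, p.2.2.1, p.2.2.2.2)⟩) ?_ ?_ ?_ ?_ ?_
  · rintro ⟨G, q⟩ h
    rw [Finset.mem_sigma] at *
    exact ⟨sw_mem (mem_apps.1 h.2) h.1, mem_apps.2 (App_sw (mem_apps.1 h.2))⟩
  · rintro ⟨G, q⟩ h
    rw [Finset.mem_sigma] at *
    exact ⟨sw_mem (mem_apps.1 h.2) h.1, mem_apps.2 (App_sw (mem_apps.1 h.2))⟩
  · rintro ⟨G, q⟩ h
    rw [Finset.mem_sigma] at h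
    have := sw_sw (mem_apps.1 h.2)
    simp only [swq]
    rw [this]
  · rintro ⟨G, q⟩ h
    rw [Finset.mem_sigma] at h
    have := sw_sw (mem_apps.1 h.2)
    simp only [swq]
    rw [this]
  · rintro ⟨G, q⟩ h
    rw [Finset.mem_sigma] at h
    have := sw_sw (mem_apps.1 h.2)
    simp only [swq]
    rw [this]

/-- Stein type identity. -/
lemma stein_graph (γ : ℕ) (L u : SimpleGraph (Fin n) → ℝ) :
    ∑ G ∈ regs n γ, ∑ q ∈ apps G, (L (swq G q) - L G) * u G =
      -(1/2) * ∑ G ∈ regs n γ, ∑ q ∈ apps G, (L (swq G q) - L G) * (u (swq G q) - u G) := by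
  have h := reversible (n := n) γ (fun G G' => (L G' - L G) * (u G + u G'))
  have h2 : ∑ G ∈ regs n γ, ∑ q ∈ apps G, (L G - L (swq G q)) * (u (swq G q) + u G) =
     - ∑ G ∈ regs n γ, ∑ q ∈ apps G, (L (swq G q) - L G) * (u G + u (swq G q)) := by
    rw [← Finset.sum_neg_distrib]
    refine Finset.sum_congr rfl fun G _ => ?_
    rw [← Finset.sum_neg_distrib]
    exact Finset.sum_congr rfl fun q _ => by ring
  have h3 : ∑ G ∈ regs n γ, ∑ q ∈ apps G, (L (swq G q) - L G) * (u G + u (swq G q)) = 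
     ∑ G ∈ regs n γ, ∑ q ∈ apps G, (L (swq G q) - L G) * (u (swq G q) - u G) + 
     2 * ∑ G ∈ regs n γ, ∑ q ∈ apps G, (L (swq G q) - L G) * u G := by
    rw [Finset.mul_sum, ← Finset.sum_add_distrib]
    refine Finset.sum_congr rfl fun G _ => ?_
    rw [Finset.mul_sum, ← Finset.sum_add_distrib]
    exact Finset.sum_congr rfl fun q _ => by ring
  beta_reduce at h
  linarith

end Graphs

set_option linter.all false
open MeasureTheory Filter Finset

section Darts
variable {n γ : ℕ}

/-- Weight of a pair of darts. -/
noncomputable def ww (G : SimpleGraph (Fin n)) (q : Quad n) : ℝ :=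
  adj G q.1 q.2.1 * adj G q.2.2.1 q.2.2.2

/-- Monomial sums over pairs of darts. -/
noncomputable def MM (G : SimpleGraph (Fin n)) (f1 g1 f2 g2 : Fin n → ℝ) : ℝ :=
  ∑ q : Quad n, ww G q * (f1 q.1 * g1 q.2.1 * (f2 q.2.2.1 * g2 q.2.2.2))

lemma MM_eq (G : SimpleGraph (Fin n)) (f1 g1 f2 g2 : Fin n → ℝ) :
    MM G f1 g1 f2 g2 = EE G f1 g1 * EE G f2 g2 := by
  unfold MM EE ww
  simp only [Fintype.sum_prod_type]
  rw [Finset.sum_mul]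
  refine Finset.sum_congr rfl fun a _ => ?_
  rw [Finset.sum_mul]
  refine Finset.sum_congr rfl fun b _ => ?_
  rw [Finset.mul_sum]
  refine Finset.sum_congr rfl fun c _ => ?_
  rw [Finset.mul_sum]
  refine Finset.sum_congr rfl fun d _ => ?_
  ring

lemma EE_one_right {G : SimpleGraph (Fin n)} (hG : G ∈ regs n γ) (f : Fin n → ℝ) :
    EE G f (fun _ => 1) = γ * ∑ x, f x := by
  unfold EE
  rw [Finset.mul_sum]
  refine Finset.sum_congr rfl fun x _ => ?_
  rw [← mem_regs.1 hG x, Finset.sum_mul]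
  exact Finset.sum_congr rfl fun y _ => by ring

lemma EE_symm (G : SimpleGraph (Fin n)) (f g : Fin n → ℝ) : EE G f g = EE G g f := by
  unfold EE
  rw [Finset.sum_comm]
  refine Finset.sum_congr rfl fun x _ => Finset.sum_congr rfl fun y _ => ?_
  rw [adj_symm]; ring

lemma EE_one_left {G : SimpleGraph (Fin n)} (hG : G ∈ regs n γ) (f : Fin n → ℝ) :
    EE G (fun _ => 1) f = γ * ∑ x, f x := by
  rw [EE_symm, EE_one_right hG]

lemma EE_one_one {G : SimpleGraph (Fin n)} (hG : G ∈ regs n γ) :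
    EE G (fun _ => 1) (fun _ => 1) = γ * n := by
  rw [EE_one_right hG]; simp

/-- Centered quadratic form. -/
noncomputable def QQ (γ : ℕ) (G : SimpleGraph (Fin n)) (f : Fin n → ℝ) : ℝ :=
  EE G f f - (γ : ℝ) / n * (∑ x, f x) ^ 2

/-- Increment of `EE G f f` under a switch. -/
def dL (f : Fin n → ℝ) (q : Quad n) : ℝ := 2 * ((f q.1 - f q.2.2.2) * (f q.2.2.1 - f q.2.1))

lemma dL_eq {G : SimpleGraph (Fin n)} {q : Quad n} (hq : q ∈ apps G) (f : Fin n → ℝ) :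
    EE (swq G q) f f - EE G f f = dL f q := EE_sw (mem_apps.1 hq) f

lemma dL_abs {f : Fin n → ℝ} (hf : ∀ x, |f x| ≤ 1) (q : Quad n) : |dL f q| ≤ 8 := by
  unfold dL
  rw [abs_mul, abs_mul, abs_two]
  have h : ∀ x y, |f x - f y| ≤ 2 := fun x y => by
    have := abs_sub (f x) (f y)
    linarith [hf x, hf y]
  have := mul_le_mul (h q.1 q.2.2.2) (h q.2.2.1 q.2.1) (abs_nonneg _) (by norm_num)
  linarith

lemma DS1 (hn : 0 < n) {G : SimpleGraph (Fin n)} (hG : G ∈ regs n γ) (f : Fin n → ℝ) :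
    ∑ q : Quad n, ww G q * dL f q = -(4 * γ * n) * QQ γ G f := by
  have h : ∑ q : Quad n, ww G q * dL f q = 2 * (MM G f (fun _ => 1) f (fun _ => 1)
      - MM G f f (fun _ => 1) (fun _ => 1) - MM G (fun _ => 1) (fun _ => 1) f f
      + MM G (fun _ => 1) f (fun _ => 1) f) := by
    unfold MM
    simp only [← Finset.sum_add_distrib, ← Finset.sum_sub_distrib, Finset.mul_sum]
    refine Finset.sum_congr rfl fun q _ => ?_
    unfold dL; ring
  have hn' : (n:ℝ) ≠ 0 := by exact_mod_cast hn.ne'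
  rw [h]
  simp only [MM_eq, EE_one_one hG, EE_one_left hG, EE_one_right hG, QQ]
  field_simp
  ring

lemma DS2 {G : SimpleGraph (Fin n)} (hG : G ∈ regs n γ) {s t : Fin n → ℝ}
    (hs : ∑ x, s x = 0) (ht : ∑ x, t x = 0) :
    ∑ q : Quad n, ww G q * (dL s q * dL t q) =
      4 * (2 * γ ^ 2 * (∑ x, s x * t x) ^ 2 + 2 * (γ * n) * EE G (fun x => s x * t x) (fun x => s x * t x)
        + 2 * EE G s t ^ 2 + 2 * (EE G s s * EE G t t)) := by
  set P : Fin n → ℝ := fun x => s x * t x with hP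
  set o : Fin n → ℝ := fun _ => 1 with ho
  have h : ∑ q : Quad n, ww G q * (dL s q * dL t q) = 4 * (
      MM G P o P o + MM G P P o o - MM G P t s o - MM G P s t o
      + MM G o o P P + MM G o P o P - MM G o t s P - MM G o s t P
      - MM G s o P t - MM G s P o t + MM G s t s t + MM G s s t t
      - MM G t o P s - MM G t P o s + MM G t t s s + MM G t s t s) := by
    unfold MM
    simp only [← Finset.sum_add_distrib, ← Finset.sum_sub_distrib, Finset.mul_sum]
    refine Finset.sum_congr rfl fun q _ => ?_
    simp only [dL, hP, ho]; ring
  rw [h]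
  have e1 : EE G s o = 0 := by rw [ho, EE_one_right hG, hs, mul_zero]
  have e2 : EE G o s = 0 := by rw [ho, EE_one_left hG, hs, mul_zero]
  have e3 : EE G t o = 0 := by rw [ho, EE_one_right hG, ht, mul_zero]
  have e4 : EE G o t = 0 := by rw [ho, EE_one_left hG, ht, mul_zero]
  have e5 : EE G o o = γ * n := EE_one_one hG
  have e6 : EE G P o = γ * ∑ x, P x := EE_one_right hG P
  have e7 : EE G o P = γ * ∑ x, P x := EE_one_left hG P
  have e8 : EE G t s = EE G s t := EE_symm _ _ _
  simp only [MM_eq, e1, e2, e3, e4, e5, e6, e7, e8]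
  ring

lemma sum_ww {G : SimpleGraph (Fin n)} (hG : G ∈ regs n γ) : ∑ q : Quad n, ww G q = (γ * n) ^ 2 := by
  have : ∑ q : Quad n, ww G q = MM G (fun _ => 1) (fun _ => 1) (fun _ => 1) (fun _ => 1) := by
    unfold MM; simp
  rw [this, MM_eq, EE_one_one hG, sq]

lemma ww_app {G : SimpleGraph (Fin n)} {q : Quad n} (hq : q ∈ apps G) : ww G q = 1 := by
  have := mem_apps.1 hq
  simp [ww, adj, this.1, this.2.1]

lemma ww_nonneg (G : SimpleGraph (Fin n)) (q : Quad n) : 0 ≤ ww G q :=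
  mul_nonneg (adj_nonneg _ _ _) (adj_nonneg _ _ _)

lemma card_apps {G : SimpleGraph (Fin n)} (hG : G ∈ regs n γ) :
    ((apps G).card : ℝ) ≤ (γ * n) ^ 2 := by
  rw [← sum_ww hG]
  calc ((apps G).card : ℝ) = ∑ q ∈ apps G, ww G q := by
        rw [Finset.sum_congr rfl fun q hq => ww_app hq]; simp
    _ ≤ _ := Finset.sum_le_univ_sum_of_nonneg fun q => ww_nonneg G q

lemma bad_sum {G : SimpleGraph (Fin n)} (hG : G ∈ regs n γ) :
    ∑ q : Quad n, (if q ∈ apps G then 0 else ww G q) ≤ 4 * n * (γ:ℝ) ^ 3 := by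
  have h1 : ∀ q : Quad n, (if q ∈ apps G then 0 else ww G q) ≤
      adj G q.1 q.2.1 * adj G q.2.2.1 q.2.2.2 * adj G q.1 q.2.2.1 +
      adj G q.1 q.2.1 * adj G q.2.2.1 q.2.2.2 * adj G q.2.1 q.2.2.2 +
      adj G q.1 q.2.1 * adj G q.2.2.1 q.2.2.2 * (if q.1 = q.2.2.1 then 1 else 0) +
      adj G q.1 q.2.1 * adj G q.2.2.1 q.2.2.2 * (if q.2.1 = q.2.2.2 then 1 else 0) := by
    rintro ⟨a, b, c, d⟩
    have n1 := adj_nonneg G a b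
    have n2 := adj_nonneg G c d
    have n3 := adj_nonneg G a c
    have n4 := adj_nonneg G b d
    have i5 : (0:ℝ) ≤ (if a = c then 1 else 0) := by split_ifs <;> norm_num
    have i6 : (0:ℝ) ≤ (if b = d then 1 else 0) := by split_ifs <;> norm_num
    have w0 : 0 ≤ adj G a b * adj G c d := mul_nonneg n1 n2
    have t1 := mul_nonneg w0 n3
    have t2 := mul_nonneg w0 n4
    have t3 := mul_nonneg w0 i5
    have t4 := mul_nonneg w0 i6
    by_cases hq : ((a, b, c, d) : Quad n) ∈ apps G
    · rw [if_pos hq]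
      dsimp only
      linarith
    · rw [if_neg hq]
      dsimp only [ww]
      by_cases e1 : G.Adj a b
      swap
      · have : adj G a b = 0 := by simp [adj, e1]
        simp [this]
      by_cases e2 : G.Adj c d
      swap
      · have : adj G c d = 0 := by simp [adj, e2]
        simp [this]
      by_cases e3 : G.Adj a c
      · have : adj G a c = 1 := by simp [adj, e3]
        rw [this] at t1 ⊢
        linarith
      by_cases e4 : G.Adj b d
      · have : adj G b d = 1 := by simp [adj, e4]
        rw [this] at t2 ⊢
        linarith
      by_cases e5 : a = c
      · rw [if_pos e5] at t3 ⊢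
        linarith
      by_cases e6 : b = d
      · rw [if_pos e6] at t4 ⊢
        linarith
      exact absurd (mem_apps.2 (by unfold App; tauto)) hq
  refine (Finset.sum_le_sum fun q _ => h1 q).trans ?_
  rw [Finset.sum_add_distrib, Finset.sum_add_distrib, Finset.sum_add_distrib]
  have r := mem_regs.1 hG
  have r' := sum_adj' hG
  have s1 : ∑ q : Quad n, adj G q.1 q.2.1 * adj G q.2.2.1 q.2.2.2 * adj G q.1 q.2.2.1 = n * (γ:ℝ) ^ 3 := by
    simp only [Fintype.sum_prod_type]
    have : ∀ a b c : Fin n, ∑ d, adj G a b * adj G c d * adj G a c = γ * adj G a b * adj G a c := by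
      intro a b c
      rw [← Finset.sum_mul, ← Finset.mul_sum, r]; ring
    simp only [this, ← Finset.mul_sum, r]
    simp only [← Finset.sum_mul, ← Finset.mul_sum, r]
    simp; ring
  have s2 : ∑ q : Quad n, adj G q.1 q.2.1 * adj G q.2.2.1 q.2.2.2 * adj G q.2.1 q.2.2.2 = n * (γ:ℝ) ^ 3 := by
    simp only [Fintype.sum_prod_type]
    have : ∀ a b : Fin n, ∑ c, ∑ d, adj G a b * adj G c d * adj G b d = γ ^ 2 * adj G a b := by
      intro a b
      rw [Finset.sum_comm]
      have : ∀ d : Fin n, ∑ c, adj G a b * adj G c d * adj G b d = adj G a b * γ * adj G b d := by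
        intro d
        rw [← Finset.sum_mul, ← Finset.mul_sum, r']
      simp only [this, ← Finset.mul_sum, r]; ring
    simp only [this, ← Finset.mul_sum, r]
    simp; ring
  have s3 : ∑ q : Quad n, adj G q.1 q.2.1 * adj G q.2.2.1 q.2.2.2 * (if q.1 = q.2.2.1 then 1 else 0) = n * (γ:ℝ) ^ 2 := by
    simp only [Fintype.sum_prod_type]
    have : ∀ a b c : Fin n, ∑ d, adj G a b * adj G c d * (if a = c then 1 else 0) = γ * adj G a b * (if a = c then 1 else 0) := by
      intro a b c
      rw [← Finset.sum_mul, ← Finset.mul_sum, r]; ring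
    simp only [this, ← Finset.mul_sum]
    simp only [Finset.sum_ite_eq, Finset.mem_univ, if_true, mul_one, ← Finset.mul_sum, r]
    simp; ring
  have s4 : ∑ q : Quad n, adj G q.1 q.2.1 * adj G q.2.2.1 q.2.2.2 * (if q.2.1 = q.2.2.2 then 1 else 0) = n * (γ:ℝ) ^ 2 := by
    simp only [Fintype.sum_prod_type]
    have : ∀ a b c : Fin n, ∑ d, adj G a b * adj G c d * (if b = d then 1 else 0) = adj G a b * adj G c b := by
      intro a b c
      simp
    simp only [this, ← Finset.mul_sum, r', ← Finset.sum_mul, r]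
    simp; ring
  rw [s1, s2, s3, s4]
  have : (γ:ℝ) ^ 2 ≤ (γ:ℝ) ^ 3 := by
    rcases Nat.eq_zero_or_pos γ with h | h
    · subst h; norm_num
    · exact pow_le_pow_right₀ (by exact_mod_cast h) (by norm_num)
  nlinarith [Nat.cast_nonneg (α := ℝ) n]

lemma app_vs_all {G : SimpleGraph (Fin n)} (hG : G ∈ regs n γ) (φ : Quad n → ℝ) {m : ℝ}
    (hm : ∀ q, |φ q| ≤ m) :
    |∑ q : Quad n, ww G q * φ q - ∑ q ∈ apps G, φ q| ≤ 4 * n * (γ:ℝ) ^ 3 * m := by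
  have h1 : ∑ q : Quad n, ww G q * φ q - ∑ q ∈ apps G, φ q =
      ∑ q : Quad n, (if q ∈ apps G then 0 else ww G q) * φ q := by
    rw [← Finset.sum_filter_add_sum_filter_not Finset.univ (fun q => q ∈ apps G) (fun q => ww G q * φ q),
      ← Finset.sum_filter_add_sum_filter_not Finset.univ (fun q => q ∈ apps G)
        (fun q => (if q ∈ apps G then 0 else ww G q) * φ q)]
    have e1 : ∑ q with q ∈ apps G, ww G q * φ q = ∑ q ∈ apps G, φ q := by
      rw [Finset.filter_univ_mem]
      exact Finset.sum_congr rfl fun q hq => by rw [ww_app hq, one_mul]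
    have e2 : ∑ q with q ∈ apps G, (if q ∈ apps G then 0 else ww G q) * φ q = 0 := by
      apply Finset.sum_eq_zero
      intro q hq
      rw [if_pos (Finset.mem_filter.1 hq).2, zero_mul]
    have e3 : ∑ q with q ∉ apps G, (if q ∈ apps G then 0 else ww G q) * φ q =
        ∑ q with q ∉ apps G, ww G q * φ q := by
      refine Finset.sum_congr rfl fun q hq => ?_
      rw [if_neg (Finset.mem_filter.1 hq).2]
    rw [e1, e2, e3]; ring
  rw [h1]
  have hm0 : 0 ≤ m ∨ IsEmpty (Quad n) := by
    rcases isEmpty_or_nonempty (Quad n) with h | ⟨⟨q⟩⟩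
    · exact Or.inr h
    · exact Or.inl ((abs_nonneg _).trans (hm q))
  rcases hm0 with hm0 | he
  · calc _ ≤ ∑ q : Quad n, |(if q ∈ apps G then 0 else ww G q) * φ q| := Finset.abs_sum_le_sum_abs _ _
      _ ≤ ∑ q : Quad n, (if q ∈ apps G then 0 else ww G q) * m := by
        refine Finset.sum_le_sum fun q _ => ?_
        have : 0 ≤ (if q ∈ apps G then 0 else ww G q) := by
          split_ifs; exact le_rfl; exact ww_nonneg _ _
        rw [abs_mul, abs_of_nonneg this]
        exact mul_le_mul_of_nonneg_left (hm q) this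
      _ ≤ _ := by
        rw [← Finset.sum_mul]
        exact mul_le_mul_of_nonneg_right (bad_sum hG) hm0
  · have : n = 0 := by
      by_contra h
      have : Nonempty (Fin n) := ⟨⟨0, Nat.pos_of_ne_zero h⟩⟩
      exact not_isEmpty_of_nonempty (Quad n) he
    subst this
    simp

lemma app_linear (hn : 0 < n) {G : SimpleGraph (Fin n)} (hG : G ∈ regs n γ) {f : Fin n → ℝ}
    (hf : ∀ x, |f x| ≤ 1) :
    |4 * γ * n * QQ γ G f + ∑ q ∈ apps G, dL f q| ≤ 32 * n * (γ:ℝ) ^ 3 := by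
  have := app_vs_all hG (dL f) (dL_abs hf)
  rw [DS1 hn hG] at this
  rw [show 4 * γ * n * QQ γ G f + ∑ q ∈ apps G, dL f q = -(-(4 * γ * n) * QQ γ G f - ∑ q ∈ apps G, dL f q) by ring, abs_neg]
  linarith

lemma exp_diff (x y : ℝ) : (x - y) * (Real.exp x - Real.exp y) ≤ (x - y) ^ 2 * (Real.exp x + Real.exp y) := by
  have h1 : Real.exp y ≥ Real.exp x * (1 + (y - x)) := by
    have := Real.add_one_le_exp (y - x)
    have e : Real.exp y = Real.exp x * Real.exp (y - x) := by rw [← Real.exp_add]; ring_nf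
    rw [e]; exact mul_le_mul_of_nonneg_left (by linarith) (Real.exp_pos _).le
  have h2 : Real.exp x ≥ Real.exp y * (1 + (x - y)) := by
    have := Real.add_one_le_exp (x - y)
    have e : Real.exp x = Real.exp y * Real.exp (x - y) := by rw [← Real.exp_add]; ring_nf
    rw [e]; exact mul_le_mul_of_nonneg_left (by linarith) (Real.exp_pos _).le
  have p1 := Real.exp_pos x
  have p2 := Real.exp_pos y
  rcases le_total y x with h | h
  · nlinarith [mul_nonneg (sub_nonneg.2 h) (sub_nonneg.2 h1), mul_nonneg (sq_nonneg (x-y)) p2.le]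
  · nlinarith [mul_nonneg (sub_nonneg.2 h) (sub_nonneg.2 h2), mul_nonneg (sq_nonneg (x-y)) p1.le]

lemma QQ_sw {G : SimpleGraph (Fin n)} {q : Quad n} (hq : q ∈ apps G) (f : Fin n → ℝ) :
    QQ γ (swq G q) f - QQ γ G f = dL f q := by
  rw [← dL_eq hq f]; unfold QQ; ring

/-- Exponential moments of the centered quadratic form. -/
lemma mgf_bound (hn : 0 < n) (hγ : 0 < γ) {f : Fin n → ℝ} (hf : ∀ x, |f x| ≤ 1) {ς : ℝ}
    (hς : ς ^ 2 = 1) {θ : ℝ} (hθ : 0 ≤ θ) :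
    ∑ G ∈ regs n γ, Real.exp (θ * (ς * QQ γ G f)) ≤
      (regs n γ).card * Real.exp (8 * γ * n * θ ^ 2 + 8 * γ ^ 2 * θ) := by
  have hn' : (0:ℝ) < n := by exact_mod_cast hn
  have hγ' : (0:ℝ) < γ := by exact_mod_cast hγ
  have hςa : |ς| = 1 := by
    rw [← Real.sqrt_sq_eq_abs, hς, Real.sqrt_one]
  set m : ℝ → ℝ := fun θ => ∑ G ∈ regs n γ, Real.exp (θ * (ς * QQ γ G f)) with hm
  set m1 : ℝ → ℝ := fun θ => ∑ G ∈ regs n γ, Real.exp (θ * (ς * QQ γ G f)) * (ς * QQ γ G f) with hm1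
  have hd : ∀ θ, HasDerivAt m (m1 θ) θ := by
    intro θ
    refine HasDerivAt.fun_sum fun G _ => ?_
    simpa using ((hasDerivAt_id θ).mul_const (ς * QQ γ G f)).exp
  have key : ∀ θ, 0 ≤ θ → m1 θ ≤ (16 * γ * n * θ + 8 * γ ^ 2) * m θ := by
    intro θ hθ
    set u : SimpleGraph (Fin n) → ℝ := fun G => Real.exp (θ * (ς * QQ γ G f)) with hu
    have hst := stein_graph (n := n) γ (fun G => QQ γ G f) u
    have a1 : 4 * γ * n * m1 θ ≤ -(ς * ∑ G ∈ regs n γ, ∑ q ∈ apps G, (QQ γ (swq G q) f - QQ γ G f) * u G)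
        + 32 * n * γ ^ 3 * m θ := by
      rw [hm1, hm, Finset.mul_sum, Finset.mul_sum, Finset.mul_sum, ← Finset.sum_neg_distrib, ← Finset.sum_add_distrib]
      refine Finset.sum_le_sum fun G hG => ?_
      have e : ∑ q ∈ apps G, (QQ γ (swq G q) f - QQ γ G f) * u G = (∑ q ∈ apps G, dL f q) * u G := by
        rw [Finset.sum_mul]
        exact Finset.sum_congr rfl fun q hq => by rw [QQ_sw hq]
      rw [e]
      have hl := app_linear hn hG hf
      have hl2 : ς * (4 * γ * n * QQ γ G f + ∑ q ∈ apps G, dL f q) ≤ 32 * n * (γ:ℝ) ^ 3 := by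
        refine (le_abs_self _).trans ?_
        rw [abs_mul, hςa, one_mul]; exact hl
      have hu0 : 0 < u G := Real.exp_pos _
      have := mul_le_mul_of_nonneg_right hl2 hu0.le
      change 4 * γ * n * (u G * (ς * QQ γ G f)) ≤ _ + 32 * n * γ ^ 3 * u G
      linarith
    have a2 : ς * ∑ G ∈ regs n γ, ∑ q ∈ apps G, (QQ γ (swq G q) f - QQ γ G f) * (u (swq G q) - u G)
        ≤ 64 * θ * ∑ G ∈ regs n γ, ∑ q ∈ apps G, (u (swq G q) + u G) := by
      rw [Finset.mul_sum, Finset.mul_sum]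
      refine Finset.sum_le_sum fun G hG => ?_
      rw [Finset.mul_sum, Finset.mul_sum]
      refine Finset.sum_le_sum fun q hq => ?_
      have hu0 : 0 < u G := Real.exp_pos _
      have hu1 : 0 < u (swq G q) := Real.exp_pos _
      rcases hθ.eq_or_lt with h0 | h0
      · simp [hu, ← h0]
      have := exp_diff (θ * (ς * QQ γ (swq G q) f)) (θ * (ς * QQ γ G f))
      change _ * (u (swq G q) - u G) ≤ _ * (u (swq G q) + u G) at this
      rw [show θ * (ς * QQ γ (swq G q) f) - θ * (ς * QQ γ G f) = θ * (ς * dL f q) by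
        rw [← QQ_sw (γ := γ) hq f]; ring] at this
      rw [QQ_sw hq]
      have h3 : ς * (dL f q * (u (swq G q) - u G)) ≤ θ * dL f q ^ 2 * (u (swq G q) + u G) := by
        have e : (θ * (ς * dL f q)) ^ 2 = θ * (θ * dL f q ^ 2) := by
          rw [mul_pow, mul_pow, hς]; ring
        rw [e] at this
        have h4 : θ * (ς * (dL f q * (u (swq G q) - u G))) ≤ θ * (θ * dL f q ^ 2 * (u (swq G q) + u G)) := by
          linarith
        exact le_of_mul_le_mul_left h4 h0
      have h5 : dL f q ^ 2 ≤ 64 := by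
        have := dL_abs hf q
        rw [← sq_abs]; nlinarith [abs_nonneg (dL f q)]
      have h6 : θ * dL f q ^ 2 * (u (swq G q) + u G) ≤ 64 * θ * (u (swq G q) + u G) := by
        apply mul_le_mul_of_nonneg_right _ (by linarith)
        nlinarith
      linarith
    have a3 : ∑ G ∈ regs n γ, ∑ q ∈ apps G, (u (swq G q) + u G) ≤ 2 * (γ * n) ^ 2 * m θ := by
      have := reversible (n := n) γ (fun G G' => u G')
      beta_reduce at this
      simp only [Finset.sum_add_distrib]
      rw [this]
      have : ∑ G ∈ regs n γ, ∑ q ∈ apps G, u G ≤ (γ * n) ^ 2 * m θ := by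
        rw [hm, Finset.mul_sum]
        refine Finset.sum_le_sum fun G hG => ?_
        rw [Finset.sum_const, nsmul_eq_mul]
        exact mul_le_mul_of_nonneg_right (card_apps hG) (Real.exp_pos _).le
      linarith
    beta_reduce at hst
    rw [hst] at a1
    have a4 : 4 * γ * n * m1 θ ≤ 4 * γ * n * ((16 * γ * n * θ + 8 * γ ^ 2) * m θ) := by
      have := mul_le_mul_of_nonneg_left a3 (show (0:ℝ) ≤ 64 * θ by linarith)
      nlinarith
    exact le_of_mul_le_mul_left a4 (by positivity)
  -- Gronwall
  set e : ℝ → ℝ := fun θ => Real.exp (-(8 * γ * n * θ ^ 2 + 8 * γ ^ 2 * θ)) with he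
  have hed : ∀ θ, HasDerivAt e (e θ * -(16 * γ * n * θ + 8 * γ ^ 2)) θ := by
    intro θ
    have : HasDerivAt (fun θ : ℝ => -(8 * γ * n * θ ^ 2 + 8 * γ ^ 2 * θ)) (-(16 * γ * n * θ + 8 * γ ^ 2)) θ := by
      have h1 := ((hasDerivAt_id θ).pow 2).const_mul (8 * γ * n : ℝ)
      have h2 := (hasDerivAt_id θ).const_mul (8 * γ ^ 2 : ℝ)
      refine (h1.add h2).neg.congr_deriv ?_
      simp; ring
    exact this.exp
  have hanti : AntitoneOn (fun θ => m θ * e θ) (Set.Ici 0) := by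
    apply antitoneOn_of_deriv_nonpos (convex_Ici 0)
    · exact fun x _ => ((hd x).mul (hed x)).continuousAt.continuousWithinAt
    · exact fun x _ => ((hd x).mul (hed x)).differentiableAt.differentiableWithinAt
    · intro x hx
      rw [interior_Ici, Set.mem_Ioi] at hx
      have hx2 := ((hd x).mul (hed x)).deriv
      change deriv (m * e) x ≤ 0
      rw [hx2]
      have := mul_le_mul_of_nonneg_right (key x hx.le) (show 0 ≤ e x from (Real.exp_pos _).le)
      linarith
  have := hanti (Set.mem_Ici.2 le_rfl) (Set.mem_Ici.2 hθ) hθ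
  have m0 : m 0 * e 0 = (regs n γ).card := by simp [hm, he]
  beta_reduce at this
  rw [m0, he] at this
  beta_reduce at this
  rw [Real.exp_neg, ← div_eq_mul_inv, div_le_iff₀ (Real.exp_pos _)] at this
  exact this

end Darts

set_option linter.all false
open MeasureTheory Filter Finset

section Graph
variable {n γ : ℕ} {ι : Type*}

/-- Normalized graph Hamiltonian. -/
noncomputable def XX (γ : ℕ) (S : ι → Fin n → ℝ) (G : SimpleGraph (Fin n)) (σ : ι) : ℝ :=
  -(EE G (S σ) (S σ)) / (2 * Real.sqrt γ)

/-- Increment of the graph Hamiltonian under a switch. -/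
noncomputable def dX (γ : ℕ) (S : ι → Fin n → ℝ) (q : Quad n) (σ : ι) : ℝ :=
  -(dL (S σ) q) / (2 * Real.sqrt γ)

/-- Gibbs average of the squared (unnormalized) overlap. -/
noncomputable def OV (B : Finset ι) (β : ℝ) (H : ι → ℝ) (S : ι → Fin n → ℝ) : ℝ :=
  av B β H (fun σ => av B β H (fun τ => (∑ x, S σ x * S τ x) ^ 2))

lemma XX_sw {G : SimpleGraph (Fin n)} {q : Quad n} (hq : q ∈ apps G) (S : ι → Fin n → ℝ) (σ : ι) :
    XX γ S (swq G q) σ - XX γ S G σ = dX γ S q σ := by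
  unfold XX dX
  rw [← dL_eq hq (S σ)]; ring

lemma dX_abs (hγ : 0 < γ) {S : ι → Fin n → ℝ} {σ : ι} (hS : ∀ x, |S σ x| ≤ 1) (q : Quad n) :
    |dX γ S q σ| ≤ 4 / Real.sqrt γ := by
  unfold dX
  have h : (0:ℝ) < Real.sqrt γ := Real.sqrt_pos.2 (by exact_mod_cast hγ)
  rw [abs_div, abs_neg, abs_of_pos (show (0:ℝ) < 2 * Real.sqrt γ by positivity), div_le_div_iff₀ (by positivity) h]
  have := dL_abs hS q
  nlinarith

lemma av_mul_av (B : Finset ι) (β : ℝ) (H f g : ι → ℝ) :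
    av B β H f * av B β H g = av B β H (fun σ => av B β H (fun τ => f σ * g τ)) := by
  simp only [av_smul]
  rw [mul_comm, ← av_smul]
  congr 1; funext σ; ring

/-- Hypothesis on the signs. -/
def Bal (B : Finset ι) (S : ι → Fin n → ℝ) : Prop :=
  ∀ σ ∈ B, (∀ x, S σ x = 1 ∨ S σ x = -1) ∧ ∑ x, S σ x = 0

/-- A bound on all centered quadratic forms. -/
def QB (γ : ℕ) (G : SimpleGraph (Fin n)) (M : ℝ) : Prop :=
  ∀ f : Fin n → ℝ, (∀ x, f x = -1 ∨ f x = 0 ∨ f x = 1) → |QQ γ G f| ≤ M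

lemma EE_abs {G : SimpleGraph (Fin n)} (hG : G ∈ regs n γ) {f g : Fin n → ℝ}
    (hf : ∀ x, |f x| ≤ 1) (hg : ∀ x, |g x| ≤ 1) : |EE G f g| ≤ γ * n := by
  rw [← EE_one_one hG]
  unfold EE
  refine (Finset.abs_sum_le_sum_abs _ _).trans (Finset.sum_le_sum fun x _ => ?_)
  refine (Finset.abs_sum_le_sum_abs _ _).trans (Finset.sum_le_sum fun y _ => ?_)
  rw [abs_mul, abs_mul, abs_of_nonneg (adj_nonneg G x y)]
  have := adj_nonneg G x y
  have h1 : adj G x y * |f x| ≤ adj G x y * 1 := mul_le_mul_of_nonneg_left (hf x) this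
  exact mul_le_mul h1 (hg y) (abs_nonneg _) (by linarith)

lemma EE_polar (G : SimpleGraph (Fin n)) (s t : Fin n → ℝ) :
    EE G s t = EE G (fun x => (s x + t x) / 2) (fun x => (s x + t x) / 2)
      - EE G (fun x => (s x - t x) / 2) (fun x => (s x - t x) / 2) := by
  have h1 : EE G (fun x => (s x + t x) / 2) (fun x => (s x + t x) / 2)
      - EE G (fun x => (s x - t x) / 2) (fun x => (s x - t x) / 2) = (1/2) * EE G s t + (1/2) * EE G t s := by
    unfold EE
    simp only [Finset.mul_sum, ← Finset.sum_add_distrib, ← Finset.sum_sub_distrib]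
    refine Finset.sum_congr rfl fun x _ => Finset.sum_congr rfl fun y _ => ?_
    ring
  rw [h1, EE_symm G t s]; ring

lemma QQ_of_bal {G : SimpleGraph (Fin n)} {s : Fin n → ℝ} (hs : ∑ x, s x = 0) :
    QQ γ G s = EE G s s := by
  unfold QQ; rw [hs]; ring

lemma pm_abs {a : ℝ} (h : a = 1 ∨ a = -1) : |a| ≤ 1 := by
  rcases h with h | h <;> rw [h] <;> norm_num

/-- Correlation of two switch increments. -/
noncomputable def DD (γ : ℕ) (G : SimpleGraph (Fin n)) (S : ι → Fin n → ℝ) (σ τ : ι) : ℝ :=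
  ∑ q : Quad n, ww G q * (dX γ S q σ * dX γ S q τ)

lemma DD_est (hn : 0 < n) (hγ : 0 < γ) {G : SimpleGraph (Fin n)} (hG : G ∈ regs n γ)
    {B : Finset ι} {S : ι → Fin n → ℝ} (hS : Bal B S) {M : ℝ} (hM : QB γ G M)
    {σ τ : ι} (hσ : σ ∈ B) (hτ : τ ∈ B) :
    |DD γ G S σ τ - 4 * γ * (∑ x, S σ x * S τ x) ^ 2| ≤ 8 * n * M := by
  have hn' : (0:ℝ) < n := by exact_mod_cast hn
  have hγ' : (0:ℝ) < γ := by exact_mod_cast hγ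
  obtain ⟨s1, s0⟩ := hS σ hσ
  obtain ⟨t1, t0⟩ := hS τ hτ
  have h : (0:ℝ) < Real.sqrt γ := Real.sqrt_pos.2 hγ'
  have hsq : Real.sqrt γ * Real.sqrt γ = γ := Real.mul_self_sqrt hγ'.le
  set s := S σ with hs
  set t := S τ with ht
  have e1 : DD γ G S σ τ = (∑ q : Quad n, ww G q * (dL s q * dL t q)) / (4 * γ) := by
    unfold DD dX
    rw [Finset.sum_div]
    refine Finset.sum_congr rfl fun q _ => ?_
    rw [← hs, ← ht, div_mul_div_comm, show 2 * Real.sqrt γ * (2 * Real.sqrt γ) = 4 * γ by linear_combination 4 * hsq]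
    ring
  set P : Fin n → ℝ := fun x => s x * t x with hP
  have e2 : EE G P P = QQ γ G P + γ / n * (∑ x, s x * t x) ^ 2 := by
    unfold QQ; rw [hP]; ring
  rw [DS2 hG s0 t0] at e1
  have e3 : DD γ G S σ τ - 4 * γ * (∑ x, s x * t x) ^ 2 =
      2 * n * QQ γ G P + 2 * EE G s t ^ 2 / γ + 2 * (EE G s s * EE G t t) / γ := by
    rw [e1, e2]
    field_simp
    ring
  rw [e3]
  have bP : |QQ γ G P| ≤ M := hM P fun x => by
    rcases s1 x with h | h <;> rcases t1 x with h' | h' <;> simp [hP, h, h']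
  have bs : |EE G s s| ≤ M := by
    rw [← QQ_of_bal (γ := γ) s0]
    exact hM s fun x => by rcases s1 x with h | h <;> simp [h]
  have bt : |EE G t t| ≤ γ * n := EE_abs hG (fun x => pm_abs (t1 x)) (fun x => pm_abs (t1 x))
  have bst : |EE G s t| ≤ γ * n := EE_abs hG (fun x => pm_abs (s1 x)) (fun x => pm_abs (t1 x))
  have bst2 : |EE G s t| ≤ 2 * M := by
    rw [EE_polar, ← QQ_of_bal (γ := γ), ← QQ_of_bal (γ := γ)]
    · have u1 := hM (fun x => (s x + t x) / 2) fun x => by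
        rcases s1 x with h | h <;> rcases t1 x with h' | h' <;> simp [h, h']
      have u2 := hM (fun x => (s x - t x) / 2) fun x => by
        rcases s1 x with h | h <;> rcases t1 x with h' | h' <;> simp [h, h'] <;> norm_num
      have := abs_sub (QQ γ G (fun x => (s x + t x) / 2)) (QQ γ G (fun x => (s x - t x) / 2))
      linarith
    · rw [← Finset.sum_div, Finset.sum_sub_distrib, s0, t0]; simp
    · rw [← Finset.sum_div, Finset.sum_add_distrib, s0, t0]; simp
  have hM0 : 0 ≤ M := (abs_nonneg _).trans bs
  have c1 : |2 * n * QQ γ G P| ≤ 2 * n * M := by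
    rw [abs_mul, abs_of_pos (by positivity)]
    exact mul_le_mul_of_nonneg_left bP (by positivity)
  have c2 : |2 * EE G s t ^ 2 / γ| ≤ 4 * n * M := by
    rw [abs_of_nonneg (by positivity), div_le_iff₀ hγ', ← sq_abs]
    have := mul_le_mul bst bst2 (abs_nonneg _) (by positivity)
    nlinarith
  have c3 : |2 * (EE G s s * EE G t t) / γ| ≤ 2 * n * M := by
    rw [abs_div, abs_of_pos hγ', div_le_iff₀ hγ', abs_mul, abs_mul, abs_two]
    have := mul_le_mul bs bt (abs_nonneg _) hM0
    nlinarith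
  have := abs_add_three (2 * n * QQ γ G P) (2 * EE G s t ^ 2 / γ) (2 * (EE G s s * EE G t t) / γ)
  linarith

lemma var_dart (hn : 0 < n) (hγ : 0 < γ) {G : SimpleGraph (Fin n)} (hG : G ∈ regs n γ)
    {B : Finset ι} (hB : B.Nonempty) {S : ι → Fin n → ℝ} (hS : Bal B S) {M : ℝ} (hM : QB γ G M)
    (β : ℝ) (H : ι → ℝ) :
    |∑ q ∈ apps G, (av B β H (fun σ => dX γ S q σ * dX γ S q σ)
        - av B β H (dX γ S q) * av B β H (dX γ S q)) - 4 * γ * ((n:ℝ) ^ 2 - OV B β H S)|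
      ≤ 16 * n * M + 128 * n * γ ^ 2 := by
  have hn' : (0:ℝ) < n := by exact_mod_cast hn
  have hγ' : (0:ℝ) < γ := by exact_mod_cast hγ
  have h : (0:ℝ) < Real.sqrt γ := Real.sqrt_pos.2 hγ'
  have hsq : Real.sqrt γ * Real.sqrt γ = γ := Real.mul_self_sqrt hγ'.le
  set φ : Quad n → ℝ := fun q => av B β H (fun σ => dX γ S q σ * dX γ S q σ)
        - av B β H (dX γ S q) * av B β H (dX γ S q) with hφ
  have hd : ∀ q, ∀ σ ∈ B, |dX γ S q σ| ≤ 4 / Real.sqrt γ := fun q σ hσ =>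
    dX_abs hγ (fun x => pm_abs ((hS σ hσ).1 x)) q
  have hsq2 : 4 / Real.sqrt γ * (4 / Real.sqrt γ) = 16 / γ := by
    rw [div_mul_div_comm, hsq]; norm_num
  have bφ : ∀ q, |φ q| ≤ 32 / γ := by
    intro q
    have a1 : |av B β H (fun σ => dX γ S q σ * dX γ S q σ)| ≤ 16 / γ := by
      apply av_abs_le hB
      intro σ hσ
      rw [abs_mul, ← hsq2]
      exact mul_le_mul (hd q σ hσ) (hd q σ hσ) (abs_nonneg _) (by positivity)
    have a2 : |av B β H (dX γ S q) * av B β H (dX γ S q)| ≤ 16 / γ := by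
      have := av_abs_le hB β H (dX γ S q) (hd q)
      rw [abs_mul, ← hsq2]
      exact mul_le_mul this this (abs_nonneg _) (by positivity)
    have := abs_sub (av B β H (fun σ => dX γ S q σ * dX γ S q σ)) (av B β H (dX γ S q) * av B β H (dX γ S q))
    have e : 32 / (γ:ℝ) = 16 / γ + 16 / γ := by ring
    rw [e]; exact this.trans (add_le_add a1 a2)
  have b1 := app_vs_all hG φ bφ
  have e1 : ∑ q : Quad n, ww G q * φ q = av B β H (fun σ => DD γ G S σ σ)
      - av B β H (fun σ => av B β H (fun τ => DD γ G S σ τ)) := by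
    unfold DD
    simp only [av_sum, av_smul]
    rw [← Finset.sum_sub_distrib]
    refine Finset.sum_congr rfl fun q _ => ?_
    rw [hφ]
    have : (fun σ => dX γ S q σ * av B β H (dX γ S q)) = fun σ => av B β H (dX γ S q) * dX γ S q σ := by
      funext σ; ring
    rw [this, av_smul]
    ring
  have b2 : |av B β H (fun σ => DD γ G S σ σ) - 4 * γ * (n:ℝ) ^ 2| ≤ 8 * n * M := by
    rw [← av_const hB β H (4 * γ * (n:ℝ) ^ 2), ← av_sub]
    apply av_abs_le hB
    intro σ hσ
    have := DD_est hn hγ hG hS hM hσ hσ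
    have e : ∑ x, S σ x * S σ x = n := by
      rw [Finset.sum_congr rfl fun x _ => show S σ x * S σ x = 1 by
        rcases (hS σ hσ).1 x with h | h <;> rw [h] <;> norm_num]
      simp
    rwa [e] at this
  have b3 : |av B β H (fun σ => av B β H (fun τ => DD γ G S σ τ)) - 4 * γ * OV B β H S| ≤ 8 * n * M := by
    unfold OV
    rw [← av_smul, ← av_sub]
    apply av_abs_le hB
    intro σ hσ
    rw [← av_smul, ← av_sub]
    apply av_abs_le hB
    intro τ hτ
    exact DD_est hn hγ hG hS hM hσ hτ
  rw [e1] at b1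
  have e4 : 4 * n * (γ:ℝ) ^ 3 * (32 / γ) = 128 * n * γ ^ 2 := by field_simp; ring
  rw [e4] at b1
  rw [abs_le] at *
  constructor <;> linarith [b1.1, b1.2, b2.1, b2.2, b3.1, b3.2]

set_option maxHeartbeats 1000000 in
/-- Integration by parts for random regular graphs. -/
lemma graph_ibp (hn : 0 < n) (hγ : 0 < γ) {B : Finset ι} (hB : B.Nonempty)
    {S : ι → Fin n → ℝ} (hS : Bal B S) {M : SimpleGraph (Fin n) → ℝ}
    (hM : ∀ G ∈ regs n γ, QB γ G (M G)) {β a K Λ : ℝ} (hβ : 0 ≤ β) (ha : 0 ≤ a) (ha1 : a ≤ 1)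
    (y : ι → ℝ) (kk : (ι → ℝ) → ℝ) (hk0 : ∀ H, 0 ≤ kk H) (hkK : ∀ H, kk H ≤ K)
    (hkL : ∀ H H' : ι → ℝ, ∀ m : ℝ, (∀ σ ∈ B, |H' σ - H σ| ≤ m) → |kk H' - kk H| ≤ Λ * m)
    (HH : SimpleGraph (Fin n) → ι → ℝ) (hHH : ∀ G σ, HH G σ = a * XX γ S G σ + y σ) :
    |∑ G ∈ regs n γ, kk (HH G) * av B β (HH G) (XX γ S G)
        - a * β * ∑ G ∈ regs n γ, kk (HH G) * (((n:ℝ) ^ 2 - OV B β (HH G) S) / (2 * n))|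
      ≤ ∑ G ∈ regs n γ, kk (HH G) * (2 * β * M G / γ + 48 * β ^ 2 * n / Real.sqrt γ)
        + (regs n γ).card * (4 * γ ^ 2 * K + 16 * β * γ * K + 2 * Λ * n) := by
  have hn' : (0:ℝ) < n := by exact_mod_cast hn
  have hγ' : (0:ℝ) < γ := by exact_mod_cast hγ
  have h : (0:ℝ) < Real.sqrt γ := Real.sqrt_pos.2 hγ'
  have hsq : Real.sqrt γ * Real.sqrt γ = γ := Real.mul_self_sqrt hγ'.le
  have hd : ∀ q, ∀ σ ∈ B, |dX γ S q σ| ≤ 4 / Real.sqrt γ := fun q σ hσ =>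
    dX_abs hγ (fun x => pm_abs ((hS σ hσ).1 x)) q
  have hsq2 : 4 / Real.sqrt γ * (4 / Real.sqrt γ) = 16 / γ := by
    rw [div_mul_div_comm, hsq]; norm_num
  have hγ1 : (1:ℝ) ≤ Real.sqrt γ := by
    rw [Real.one_le_sqrt]; exact_mod_cast hγ
  have hK : 0 ≤ K := (hk0 (fun _ => 0)).trans (hkK _)
  have hΛ : 0 ≤ Λ := by
    have := hkL (fun _ => 0) (fun _ => 0) 1 (fun σ _ => by simp)
    simpa using this
  -- Step A
  have A : ∀ G ∈ regs n γ, |4 * γ * n * (kk (HH G) * av B β (HH G) (XX γ S G))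
      + ∑ q ∈ apps G, kk (HH G) * av B β (HH G) (dX γ S q)| ≤ 16 * n * γ ^ 3 * K := by
    intro G hG
    have e : 4 * γ * n * (kk (HH G) * av B β (HH G) (XX γ S G))
      + ∑ q ∈ apps G, kk (HH G) * av B β (HH G) (dX γ S q) =
      kk (HH G) * av B β (HH G) (fun σ => 4 * γ * n * XX γ S G σ + ∑ q ∈ apps G, dX γ S q σ) := by
      rw [av_add, av_smul, av_sum, ← Finset.mul_sum]
      ring
    have b : |av B β (HH G) (fun σ => 4 * γ * n * XX γ S G σ + ∑ q ∈ apps G, dX γ S q σ)| ≤ 16 * n * γ ^ 3 := by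
      apply av_abs_le hB
      intro σ hσ
      have := app_linear hn hG (fun x => pm_abs ((hS σ hσ).1 x))
      rw [QQ_of_bal (hS σ hσ).2] at this
      have e : 4 * γ * n * XX γ S G σ + ∑ q ∈ apps G, dX γ S q σ =
          -(4 * γ * n * EE G (S σ) (S σ) + ∑ q ∈ apps G, dL (S σ) q) / (2 * Real.sqrt γ) := by
        unfold XX dX
        rw [← Finset.sum_div, Finset.sum_neg_distrib]; ring
      rw [e, abs_div, abs_neg, abs_of_pos (show (0:ℝ) < 2 * Real.sqrt γ by positivity), div_le_iff₀ (by positivity)]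
      have : 32 * n * (γ:ℝ) ^ 3 * 1 ≤ 32 * n * (γ:ℝ) ^ 3 * Real.sqrt γ := mul_le_mul_of_nonneg_left hγ1 (by positivity)
      linarith
    rw [e, abs_mul, abs_of_nonneg (hk0 _), mul_comm]
    exact mul_le_mul b (hkK _) (hk0 _) (by positivity)
  -- Step B
  have Bs : ∑ G ∈ regs n γ, ∑ q ∈ apps G, kk (HH G) * av B β (HH G) (dX γ S q) =
      -(1/2) * ∑ G ∈ regs n γ, ∑ q ∈ apps G, (kk (HH (swq G q)) * av B β (HH (swq G q)) (dX γ S q)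
        - kk (HH G) * av B β (HH G) (dX γ S q)) := by
    have hst : ∀ σ ∈ B, _ := fun σ _ => stein_graph (n := n) γ (fun G => XX γ S G σ)
      (fun G => kk (HH G) * (Real.exp (β * HH G σ) / Zf B β (HH G)))
    have hs := Finset.sum_congr rfl hst
    beta_reduce at hs
    rw [← Finset.mul_sum] at hs
    have e1 : ∀ G' : SimpleGraph (Fin n), ∀ q, kk (HH G') * av B β (HH G') (dX γ S q) =
        ∑ σ ∈ B, dX γ S q σ * (kk (HH G') * (Real.exp (β * HH G' σ) / Zf B β (HH G'))) := by
      intro G q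
      unfold av
      rw [Finset.sum_div, Finset.mul_sum]
      exact Finset.sum_congr rfl fun σ _ => by ring
    have l : ∑ G ∈ regs n γ, ∑ q ∈ apps G, kk (HH G) * av B β (HH G) (dX γ S q) =
        ∑ σ ∈ B, ∑ G ∈ regs n γ, ∑ q ∈ apps G, (XX γ S (swq G q) σ - XX γ S G σ) *
          (kk (HH G) * (Real.exp (β * HH G σ) / Zf B β (HH G))) := by
      rw [Finset.sum_comm]
      refine Finset.sum_congr rfl fun G _ => ?_
      rw [Finset.sum_comm]
      refine Finset.sum_congr rfl fun q hq => ?_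
      rw [e1]
      exact Finset.sum_congr rfl fun σ _ => by rw [XX_sw hq]
    rw [l, hs]
    congr 1
    rw [Finset.sum_comm]
    refine Finset.sum_congr rfl fun G _ => ?_
    rw [Finset.sum_comm]
    refine Finset.sum_congr rfl fun q hq => ?_
    rw [e1, e1, ← Finset.sum_sub_distrib]
    exact Finset.sum_congr rfl fun σ _ => by rw [XX_sw hq]; ring
  -- Step C
  have C : ∀ G ∈ regs n γ, |∑ q ∈ apps G, (kk (HH (swq G q)) * av B β (HH (swq G q)) (dX γ S q)
        - kk (HH G) * av B β (HH G) (dX γ S q)) - kk (HH G) * (a * β * (4 * γ * ((n:ℝ) ^ 2 - OV B β (HH G) S)))| ≤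
      kk (HH G) * (β * (16 * n * M G + 128 * n * γ ^ 2)) +
        (γ * n) ^ 2 * (kk (HH G) * (384 * β ^ 2 / (γ * Real.sqrt γ)) + 16 * Λ / γ) := by
    intro G hG
    set v : Quad n → ℝ := fun q => av B β (HH G) (fun σ => dX γ S q σ * dX γ S q σ)
        - av B β (HH G) (dX γ S q) * av B β (HH G) (dX γ S q) with hv
    have c1 : ∀ q ∈ apps G, |kk (HH (swq G q)) * av B β (HH (swq G q)) (dX γ S q)
        - kk (HH G) * av B β (HH G) (dX γ S q) - kk (HH G) * (a * (β * v q))| ≤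
        kk (HH G) * (384 * β ^ 2 / (γ * Real.sqrt γ)) + 16 * Λ / γ := by
      intro q hq
      have eH : HH (swq G q) = fun σ => HH G σ + a * dX γ S q σ := by
        funext σ; rw [hHH, hHH, ← XX_sw hq]; ring
      have t1 := av_taylor hB β (HH G) (dX γ S q) ha (hd q)
      rw [← eH] at t1
      have t2 : |av B β (HH (swq G q)) (dX γ S q)| ≤ 4 / Real.sqrt γ := av_abs_le hB _ _ _ (hd q)
      have t3 : |kk (HH (swq G q)) - kk (HH G)| ≤ Λ * (4 / Real.sqrt γ) := by
        apply hkL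
        intro σ hσ
        rw [eH]
        beta_reduce
        rw [add_sub_cancel_left, abs_mul, abs_of_nonneg ha]
        have := mul_le_mul ha1 (hd q σ hσ) (abs_nonneg _) zero_le_one
        linarith
      have e : kk (HH (swq G q)) * av B β (HH (swq G q)) (dX γ S q)
        - kk (HH G) * av B β (HH G) (dX γ S q) - kk (HH G) * (a * (β * v q)) =
        kk (HH G) * (av B β (HH (swq G q)) (dX γ S q) - av B β (HH G) (dX γ S q) - a * (β * v q))
        + (kk (HH (swq G q)) - kk (HH G)) * av B β (HH (swq G q)) (dX γ S q) := by ring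
      rw [e]
      refine (abs_add_le _ _).trans (add_le_add ?_ ?_)
      · rw [abs_mul, abs_of_nonneg (hk0 _)]
        refine mul_le_mul_of_nonneg_left (t1.trans ?_) (hk0 _)
        have e3 : (4 / Real.sqrt γ) ^ 3 = 64 / (γ * Real.sqrt γ) := by
          rw [pow_succ, sq, hsq2, div_mul_div_comm]; norm_num
        rw [e3]
        have a2 : a ^ 2 ≤ 1 := by nlinarith
        have : 6 * β ^ 2 * (64 / (γ * Real.sqrt γ)) * a ^ 2 ≤ 6 * β ^ 2 * (64 / (γ * Real.sqrt γ)) * 1 :=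
          mul_le_mul_of_nonneg_left a2 (by positivity)
        refine this.trans (le_of_eq ?_)
        ring
      · rw [abs_mul]
        have := mul_le_mul t3 t2 (abs_nonneg _) (by positivity)
        refine this.trans (le_of_eq ?_)
        rw [mul_assoc, hsq2]; ring
    have c2 : |∑ q ∈ apps G, (kk (HH (swq G q)) * av B β (HH (swq G q)) (dX γ S q)
        - kk (HH G) * av B β (HH G) (dX γ S q)) - kk (HH G) * (a * (β * ∑ q ∈ apps G, v q))| ≤
        (γ * n) ^ 2 * (kk (HH G) * (384 * β ^ 2 / (γ * Real.sqrt γ)) + 16 * Λ / γ) := by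
      rw [Finset.mul_sum, Finset.mul_sum, Finset.mul_sum, ← Finset.sum_sub_distrib]
      refine (Finset.abs_sum_le_sum_abs _ _).trans ((Finset.sum_le_sum c1).trans ?_)
      rw [Finset.sum_const, nsmul_eq_mul]
      refine mul_le_mul_of_nonneg_right (card_apps hG) ?_
      have := hk0 (HH G)
      positivity
    have c3 := var_dart hn hγ hG hB hS (hM G hG) β (HH G)
    change |∑ q ∈ apps G, v q - _| ≤ _ at c3
    have c4 : |kk (HH G) * (a * (β * ∑ q ∈ apps G, v q)) - kk (HH G) * (a * β * (4 * γ * ((n:ℝ) ^ 2 - OV B β (HH G) S)))|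
        ≤ kk (HH G) * (β * (16 * n * M G + 128 * n * γ ^ 2)) := by
      rw [show kk (HH G) * (a * (β * ∑ q ∈ apps G, v q)) - kk (HH G) * (a * β * (4 * γ * ((n:ℝ) ^ 2 - OV B β (HH G) S)))
        = kk (HH G) * (a * (β * (∑ q ∈ apps G, v q - 4 * γ * ((n:ℝ) ^ 2 - OV B β (HH G) S)))) by ring,
        abs_mul, abs_mul, abs_mul, abs_of_nonneg (hk0 _), abs_of_nonneg ha, abs_of_nonneg hβ]
      refine mul_le_mul_of_nonneg_left ?_ (hk0 _)
      have u1 := mul_le_mul_of_nonneg_left c3 hβ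
      have u0 : 0 ≤ β * |∑ q ∈ apps G, v q - 4 * γ * ((n:ℝ) ^ 2 - OV B β (HH G) S)| := by positivity
      nlinarith
    have := abs_sub_le (∑ q ∈ apps G, (kk (HH (swq G q)) * av B β (HH (swq G q)) (dX γ S q)
        - kk (HH G) * av B β (HH G) (dX γ S q))) (kk (HH G) * (a * (β * ∑ q ∈ apps G, v q)))
        (kk (HH G) * (a * β * (4 * γ * ((n:ℝ) ^ 2 - OV B β (HH G) S))))
    linarith
  -- Assembly
  set T1 := ∑ G ∈ regs n γ, kk (HH G) * av B β (HH G) (XX γ S G) with hT1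
  set T2 := ∑ G ∈ regs n γ, ∑ q ∈ apps G, kk (HH G) * av B β (HH G) (dX γ S q) with hT2
  set T3 := ∑ G ∈ regs n γ, ∑ q ∈ apps G, (kk (HH (swq G q)) * av B β (HH (swq G q)) (dX γ S q)
        - kk (HH G) * av B β (HH G) (dX γ S q)) with hT3
  have SA : |4 * γ * n * T1 + T2| ≤ (regs n γ).card * (16 * n * γ ^ 3 * K) := by
    rw [hT1, hT2, Finset.mul_sum, ← Finset.sum_add_distrib]
    refine (Finset.abs_sum_le_sum_abs _ _).trans ((Finset.sum_le_sum A).trans ?_)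
    rw [Finset.sum_const, nsmul_eq_mul]
  have SC : |T3 - ∑ G ∈ regs n γ, kk (HH G) * (a * β * (4 * γ * ((n:ℝ) ^ 2 - OV B β (HH G) S)))| ≤
      ∑ G ∈ regs n γ, (kk (HH G) * (β * (16 * n * M G + 128 * n * γ ^ 2)) +
        (γ * n) ^ 2 * (kk (HH G) * (384 * β ^ 2 / (γ * Real.sqrt γ)) + 16 * Λ / γ)) := by
    rw [hT3, ← Finset.sum_sub_distrib]
    exact (Finset.abs_sum_le_sum_abs _ _).trans (Finset.sum_le_sum C)
  have e5 : ∑ G ∈ regs n γ, kk (HH G) * (a * β * (4 * γ * ((n:ℝ) ^ 2 - OV B β (HH G) S))) =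
      8 * γ * n * (a * β * ∑ G ∈ regs n γ, kk (HH G) * (((n:ℝ) ^ 2 - OV B β (HH G) S) / (2 * n))) := by
    rw [Finset.mul_sum, Finset.mul_sum]
    refine Finset.sum_congr rfl fun G _ => ?_
    field_simp
    ring
  have e6 : ∑ G ∈ regs n γ, (kk (HH G) * (β * (16 * n * M G + 128 * n * γ ^ 2)) +
        (γ * n) ^ 2 * (kk (HH G) * (384 * β ^ 2 / (γ * Real.sqrt γ)) + 16 * Λ / γ)) ≤
      8 * γ * n * (∑ G ∈ regs n γ, kk (HH G) * (2 * β * M G / γ + 48 * β ^ 2 * n / Real.sqrt γ)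
        + (regs n γ).card * (16 * β * γ * K + 2 * Λ * n)) := by
    have ec : ((regs n γ).card : ℝ) * (16 * β * γ * K + 2 * Λ * n) =
        ∑ G ∈ regs n γ, (16 * β * γ * K + 2 * Λ * n) := by rw [Finset.sum_const, nsmul_eq_mul]
    rw [ec, ← Finset.sum_add_distrib, Finset.mul_sum]
    refine Finset.sum_le_sum fun G _ => ?_
    have u : β * γ * kk (HH G) ≤ β * γ * K := mul_le_mul_of_nonneg_left (hkK _) (by positivity)
    have e : 8 * γ * n * (kk (HH G) * (2 * β * M G / γ + 48 * β ^ 2 * n / Real.sqrt γ) + (16 * β * γ * K + 2 * Λ * n)) -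
      (kk (HH G) * (β * (16 * n * M G + 128 * n * γ ^ 2)) +
        (γ * n) ^ 2 * (kk (HH G) * (384 * β ^ 2 / (γ * Real.sqrt γ)) + 16 * Λ / γ)) =
        128 * γ * n * (β * γ * K - β * γ * kk (HH G)) := by
      field_simp
      ring
    have : 0 ≤ 128 * γ * n * (β * γ * K - β * γ * kk (HH G)) := mul_nonneg (by positivity) (by linarith)
    linarith
  set T4 := ∑ G ∈ regs n γ, kk (HH G) * (((n:ℝ) ^ 2 - OV B β (HH G) S) / (2 * n)) with hT4
  set T5 := ∑ G ∈ regs n γ, kk (HH G) * (2 * β * M G / γ + 48 * β ^ 2 * n / Real.sqrt γ) with hT5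
  rw [e5] at SC
  have SC' := SC.trans e6
  have p : (0:ℝ) < 8 * γ * n := by positivity
  have fin : |8 * γ * n * (T1 - a * β * T4)| ≤ 8 * γ * n * (T5 + (regs n γ).card * (4 * γ ^ 2 * K + 16 * β * γ * K + 2 * Λ * n)) := by
    have e7 : 8 * γ * n * (T1 - a * β * T4) = 2 * (4 * γ * n * T1 + T2) + (T3 - 8 * γ * n * (a * β * T4)) := by
      rw [Bs]; ring
    have e8 : 8 * γ * n * (T5 + (regs n γ).card * (4 * γ ^ 2 * K + 16 * β * γ * K + 2 * Λ * n)) =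
        2 * ((regs n γ).card * (16 * n * γ ^ 3 * K)) + 8 * γ * n * (T5 + (regs n γ).card * (16 * β * γ * K + 2 * Λ * n)) := by
      ring
    rw [e7, e8]
    refine (abs_add_le _ _).trans (add_le_add ?_ SC')
    rw [abs_mul, abs_two]
    exact mul_le_mul_of_nonneg_left SA (by norm_num)
  rw [abs_mul, abs_of_pos p] at fin
  exact le_of_mul_le_mul_left fin p

end Graph

set_option linter.all false
open MeasureTheory Filter Finset

section Gauss

/-- Standard Gaussian. -/
noncomputable abbrev gs : Measure ℝ := ProbabilityTheory.gaussianReal 0 1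

lemma hasDerivAt_pdf (x : ℝ) : HasDerivAt (ProbabilityTheory.gaussianPDFReal 0 1)
    (-x * ProbabilityTheory.gaussianPDFReal 0 1 x) x := by
  have : ProbabilityTheory.gaussianPDFReal 0 1 = fun x => (Real.sqrt (2 * Real.pi * (1:NNReal)))⁻¹ * Real.exp (-(x - 0) ^ 2 / (2 * (1:NNReal))) := by
    funext x; rfl
  rw [this]
  beta_reduce
  have h1 : HasDerivAt (fun x : ℝ => -(x - 0) ^ 2 / (2 * ((1:NNReal):ℝ))) (-x) x := by
    have := (((hasDerivAt_id x).sub_const 0).pow 2).neg.div_const (2 * ((1:NNReal):ℝ))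
    refine this.congr_deriv ?_
    simp
    ring
  refine (h1.exp.const_mul _).congr_deriv ?_
  ring

lemma stein1 {f f' : ℝ → ℝ} {m m' : ℝ} (hf : ∀ x, HasDerivAt f (f' x) x) (hb : ∀ x, |f x| ≤ m)
    (hb' : ∀ x, |f' x| ≤ m') (hc' : Measurable f') :
    ∫ x, x * f x ∂gs = ∫ x, f' x ∂gs := by
  have hfc : Continuous f := continuous_iff_continuousAt.2 fun x => (hf x).continuousAt
  have hI : ∀ g : ℝ → ℝ, Integrable g gs → Integrable (fun x => g x * ProbabilityTheory.gaussianPDFReal 0 1 x) := by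
    intro g hg
    rw [gs, ProbabilityTheory.gaussianReal_of_var_ne_zero 0 (by norm_num), integrable_withDensity_iff_integrable_smul'] at hg
    · refine hg.congr (Eventually.of_forall fun x => ?_)
      simp [ProbabilityTheory.toReal_gaussianPDF, mul_comm]
    · exact ProbabilityTheory.measurable_gaussianPDF 0 1
    · exact Eventually.of_forall fun x => ProbabilityTheory.gaussianPDF_lt_top
  have i0 : Integrable (fun x : ℝ => x) gs := (ProbabilityTheory.memLp_id_gaussianReal' 1 (by simp)).integrable le_rfl
  have i1 : Integrable f gs := (integrable_const m).mono' hfc.aestronglyMeasurable (Eventually.of_forall hb)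
  have i2 : Integrable f' gs := (integrable_const m').mono' hc'.aestronglyMeasurable (Eventually.of_forall hb')
  have i3 : Integrable (fun x => x * f x) gs := by
    refine (i0.norm.mul_const m).mono' (continuous_id.mul hfc).aestronglyMeasurable (Eventually.of_forall fun x => ?_)
    rw [norm_mul]
    exact mul_le_mul_of_nonneg_left (hb x) (norm_nonneg _)
  have key := integral_mul_deriv_eq_deriv_mul_of_integrable (u := f) (u' := f')
    (v := ProbabilityTheory.gaussianPDFReal 0 1) (v' := fun x => -x * ProbabilityTheory.gaussianPDFReal 0 1 x)
    (fun x _ => hf x) (fun x _ => hasDerivAt_pdf x)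
    (by
      refine (hI _ i3).neg.congr (Eventually.of_forall fun x => ?_)
      simp; ring)
    (hI _ i2) (hI _ i1)
  rw [ProbabilityTheory.integral_gaussianReal_eq_integral_smul (by norm_num), ProbabilityTheory.integral_gaussianReal_eq_integral_smul (by norm_num)]
  have e1 : ∫ x, ProbabilityTheory.gaussianPDFReal 0 1 x • (x * f x) = -∫ x, f x * (-x * ProbabilityTheory.gaussianPDFReal 0 1 x) := by
    rw [← integral_neg]; congr 1; funext x; simp; ring
  have e2 : ∫ x, ProbabilityTheory.gaussianPDFReal 0 1 x • f' x = ∫ x, f' x * ProbabilityTheory.gaussianPDFReal 0 1 x := by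
    congr 1; funext x; simp; ring
  rw [e1, e2, key, neg_neg]

variable {κ : Type*} [Fintype κ] [DecidableEq κ]

/-- Gaussian vector. -/
noncomputable abbrev gv (κ : Type*) [Fintype κ] : Measure (κ → ℝ) := Measure.pi fun _ => gs

lemma mp_update (p : κ) : MeasurePreserving (fun z : ℝ × (κ → ℝ) => Function.update z.2 p z.1)
    (gs.prod (gv κ)) (gv κ) := by
  have hm : Measurable (fun z : ℝ × (κ → ℝ) => Function.update z.2 p z.1) := by
    rw [measurable_pi_iff]
    intro i
    by_cases h : i = p
    · subst h; simpa using measurable_fst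
    · simp only [Function.update_of_ne h]
      exact (measurable_pi_apply i).comp measurable_snd
  refine ⟨hm, ?_⟩
  symm
  refine Measure.pi_eq fun s hs => ?_
  rw [Measure.map_apply hm (MeasurableSet.univ_pi hs)]
  have e : (fun z : ℝ × (κ → ℝ) => Function.update z.2 p z.1) ⁻¹' (Set.univ.pi s) =
      s p ×ˢ (Set.univ.pi (Function.update s p Set.univ)) := by
    ext ⟨x, J⟩
    simp only [Set.mem_preimage, Set.mem_pi, Set.mem_univ, true_imp_iff, Set.mem_prod]
    constructor
    · intro h
      refine ⟨by simpa using h p, fun i => ?_⟩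
      by_cases hi : i = p
      · subst hi; simp
      · simpa [Function.update_of_ne hi] using h i
    · rintro ⟨h1, h2⟩ i
      by_cases hi : i = p
      · subst hi; simpa using h1
      · simpa [Function.update_of_ne hi] using h2 i
  rw [e, Measure.prod_prod, Measure.pi_pi, ← Finset.mul_prod_erase _ _ (Finset.mem_univ p),
    ← Finset.mul_prod_erase Finset.univ (fun i => gs (s i)) (Finset.mem_univ p)]
  simp only [Function.update_self, measure_univ, one_mul]
  congr 1
  refine Finset.prod_congr rfl fun i hi => ?_
  rw [Function.update_of_ne (Finset.ne_of_mem_erase hi)]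

lemma integrable_coord (p : κ) : Integrable (fun J : κ → ℝ => J p) (gv κ) := by
  have i0 : Integrable (fun x : ℝ => x) gs := (ProbabilityTheory.memLp_id_gaussianReal' 1 (by simp)).integrable le_rfl
  exact (measurePreserving_eval (fun _ : κ => gs) p).integrable_comp_of_integrable i0

lemma steinv (p : κ) {f f' : (κ → ℝ) → ℝ} {m m' : ℝ}
    (hf : ∀ J, HasDerivAt (fun t => f (Function.update J p t)) (f' J) (J p)) (hfc : Continuous f)
    (hb : ∀ J, |f J| ≤ m) (hb' : ∀ J, |f' J| ≤ m') (hc' : Continuous f') :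
    ∫ J, J p * f J ∂(gv κ) = ∫ J, f' J ∂(gv κ) := by
  have mp := mp_update p
  have hcu : ∀ J : κ → ℝ, Continuous fun x : ℝ => Function.update J p x := fun J =>
    continuous_const.update p continuous_id
  have i3 : Integrable (fun J : κ → ℝ => J p * f J) (gv κ) := by
    refine ((integrable_coord p).norm.mul_const m).mono' ((continuous_apply p).mul hfc).aestronglyMeasurable (Eventually.of_forall fun x => ?_)
    rw [norm_mul]
    exact mul_le_mul_of_nonneg_left (hb x) (norm_nonneg _)
  have i4 : Integrable f' (gv κ) := (integrable_const m').mono' hc'.aestronglyMeasurable (Eventually.of_forall hb')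
  have e : ∀ g : (κ → ℝ) → ℝ, Continuous g → Integrable g (gv κ) → ∫ J, g J ∂(gv κ) = ∫ J, ∫ x, g (Function.update J p x) ∂gs ∂(gv κ) := by
    intro g hg hgi
    rw [← mp.map_eq, integral_map mp.measurable.aemeasurable (by rw [mp.map_eq]; exact hg.aestronglyMeasurable), integral_prod_symm]
    · rw [mp.map_eq]
    · exact mp.integrable_comp_of_integrable hgi
  rw [e (fun J => J p * f J) ((continuous_apply p).mul hfc) i3, e _ hc' i4]
  congr 1
  funext J
  have := stein1 (f := fun x => f (Function.update J p x)) (f' := fun x => f' (Function.update J p x))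
    (m := m) (m' := m') (fun x => by simpa using hf (Function.update J p x)) (fun x => hb _) (fun x => hb' _)
    (hc'.comp (hcu J)).measurable
  rw [← this]
  simp

end Gauss

section SK
variable {n : ℕ} {ι : Type*}

lemma continuous_Zf {T : Type*} [TopologicalSpace T] (B : Finset ι) (β : ℝ) {H : T → ι → ℝ}
    (hH : ∀ σ ∈ B, Continuous fun t => H t σ) : Continuous fun t => Zf B β (H t) := by
  unfold Zf
  exact continuous_finset_sum _ fun σ hσ => Real.continuous_exp.comp (continuous_const.mul (hH σ hσ))

lemma continuous_av {T : Type*} [TopologicalSpace T] {B : Finset ι} (hB : B.Nonempty) (β : ℝ)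
    {H φ : T → ι → ℝ} (hH : ∀ σ ∈ B, Continuous fun t => H t σ) (hφ : ∀ σ ∈ B, Continuous fun t => φ t σ) :
    Continuous fun t => av B β (H t) (φ t) := by
  unfold av
  refine Continuous.div ?_ (continuous_Zf B β hH) fun t => (Zf_pos hB β _).ne'
  exact continuous_finset_sum _ fun σ hσ => (Real.continuous_exp.comp (continuous_const.mul (hH σ hσ))).mul (hφ σ hσ)

/-- Free energy density. -/
noncomputable def Fe (n : ℕ) (B : Finset ι) (β : ℝ) (H : ι → ℝ) : ℝ := Real.log (Zf B β H) / (β * n)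

lemma continuous_Fe {T : Type*} [TopologicalSpace T] {B : Finset ι} (hB : B.Nonempty) (β : ℝ)
    {H : T → ι → ℝ} (hH : ∀ σ ∈ B, Continuous fun t => H t σ) :
    Continuous fun t => Fe n B β (H t) := by
  unfold Fe
  exact ((continuous_Zf B β hH).log fun t => (Zf_pos hB β _).ne').div_const _

lemma hasDerivAt_Fe {B : Finset ι} (hB : B.Nonempty) {β : ℝ} (hβ : β ≠ 0) {H : ℝ → ι → ℝ} {H' : ι → ℝ}
    {t : ℝ} (h : ∀ σ ∈ B, HasDerivAt (fun u => H u σ) (H' σ) t) :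
    HasDerivAt (fun u => Fe n B β (H u)) (av B β (H t) H' / n) t := by
  refine ((hasDerivAt_logZ hB β h).div_const (β * n)).congr_deriv ?_
  rw [mul_div_mul_left _ _ hβ]

lemma Fe_lip {B : Finset ι} (hB : B.Nonempty) {β : ℝ} (hβ : 0 < β) {H H' : ι → ℝ} {m : ℝ}
    (h : ∀ σ ∈ B, |H' σ - H σ| ≤ m) : |Fe n B β H' - Fe n B β H| ≤ m / n := by
  have := logZ_lip hB hβ.le h
  unfold Fe
  rcases Nat.eq_zero_or_pos n with h0 | h0
  · subst h0; simp
  have hn' : (0:ℝ) < n := by exact_mod_cast h0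
  rw [← sub_div, abs_div, abs_of_pos (show 0 < β * n by positivity), div_le_div_iff₀ (by positivity) hn']
  nlinarith

/-- SK Hamiltonian for general sign vectors. -/
noncomputable def YY (S : ι → Fin n → ℝ) (J : Fin n × Fin n → ℝ) (σ : ι) : ℝ :=
  (Real.sqrt (2 * n))⁻¹ * ∑ p : Fin n × Fin n, J p * (S σ p.1 * S σ p.2)

lemma continuous_YY (S : ι → Fin n → ℝ) (σ : ι) : Continuous fun J => YY S J σ := by
  unfold YY
  exact continuous_const.mul (continuous_finset_sum _ fun p _ => (continuous_apply p).mul continuous_const)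

lemma YY_update (S : ι → Fin n → ℝ) (J : Fin n × Fin n → ℝ) (p : Fin n × Fin n) (t : ℝ) (σ : ι) :
    YY S (Function.update J p t) σ = YY S J σ + (Real.sqrt (2 * n))⁻¹ * ((t - J p) * (S σ p.1 * S σ p.2)) := by
  unfold YY
  rw [← mul_add]
  congr 1
  rw [← Finset.add_sum_erase _ _ (Finset.mem_univ p), ← Finset.add_sum_erase Finset.univ (fun p => J p * (S σ p.1 * S σ p.2)) (Finset.mem_univ p)]
  rw [Function.update_self]
  rw [Finset.sum_congr rfl fun q hq => by rw [Function.update_of_ne (Finset.ne_of_mem_erase hq)]]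
  ring

lemma sum_av_sq (B : Finset ι) (β : ℝ) (H : ι → ℝ) (S : ι → Fin n → ℝ) :
    ∑ p : Fin n × Fin n, av B β H (fun σ => S σ p.1 * S σ p.2) ^ 2 = OV B β H S := by
  unfold OV
  have : ∀ σ τ, (∑ x, S σ x * S τ x) ^ 2 = ∑ p : Fin n × Fin n, (S σ p.1 * S σ p.2) * (S τ p.1 * S τ p.2) := by
    intro σ τ
    rw [sq, Finset.sum_mul_sum, Fintype.sum_prod_type]
    exact Finset.sum_congr rfl fun x _ => Finset.sum_congr rfl fun y _ => by ring
  simp only [this, av_sum]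
  refine Finset.sum_congr rfl fun p _ => ?_
  rw [sq, av_mul_av]

lemma sk_ibp (hn : 0 < n) {B : Finset ι} (hB : B.Nonempty) {S : ι → Fin n → ℝ}
    (hS : ∀ σ ∈ B, ∀ x, S σ x = 1 ∨ S σ x = -1) {β c K K2 : ℝ} (hβ : 0 < β) (hc0 : 0 ≤ c) (hc1 : c ≤ 1)
    (y : ι → ℝ) {k k' : ℝ → ℝ} (hk : ∀ x, HasDerivAt k (k' x) x) (hk' : Continuous k')
    (hK : ∀ x, |k x| ≤ K) (hK2 : ∀ x, |k' x| ≤ K2)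
    (HH : (Fin n × Fin n → ℝ) → ι → ℝ) (hHH : ∀ J σ, HH J σ = c * YY S J σ + y σ) :
    |∫ J, k (Fe n B β (HH J)) * av B β (HH J) (YY S J) ∂(gv (Fin n × Fin n))
      - c * β * ∫ J, k (Fe n B β (HH J)) * (((n:ℝ) ^ 2 - OV B β (HH J) S) / (2 * n)) ∂(gv (Fin n × Fin n))|
      ≤ K2 / 2 := by
  have hn' : (0:ℝ) < n := by exact_mod_cast hn
  set w : ℝ := (Real.sqrt (2 * n))⁻¹ with hw
  have hw2 : w * w = 1 / (2 * n) := by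
    rw [hw, ← mul_inv, Real.mul_self_sqrt (by positivity), one_div]
  have hw0 : 0 ≤ w := by rw [hw]; positivity
  set e : Fin n × Fin n → ι → ℝ := fun p σ => S σ p.1 * S σ p.2 with he
  have he1 : ∀ p, ∀ σ ∈ B, |e p σ| ≤ 1 := by
    intro p σ hσ
    rcases hS σ hσ p.1 with h | h <;> rcases hS σ hσ p.2 with h' | h' <;> simp [he, h, h']
  have hee : ∀ p, ∀ σ ∈ B, e p σ * e p σ = 1 := by
    intro p σ hσ
    rcases hS σ hσ p.1 with h | h <;> rcases hS σ hσ p.2 with h' | h' <;> simp [he, h, h']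
  have hHc : ∀ σ ∈ B, Continuous fun J => HH J σ := by
    intro σ _
    simp only [hHH]
    exact (continuous_const.mul (continuous_YY S σ)).add continuous_const
  have hkc : Continuous k := continuous_iff_continuousAt.2 fun x => (hk x).continuousAt
  have cF : Continuous fun J => Fe n B β (HH J) := continuous_Fe hB β hHc
  have cA : ∀ φ : ι → ℝ, Continuous fun J => av B β (HH J) φ := fun φ =>
    continuous_av hB β hHc fun _ _ => continuous_const
  set f : Fin n × Fin n → (Fin n × Fin n → ℝ) → ℝ := fun p J => k (Fe n B β (HH J)) * av B β (HH J) (e p) with hf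
  set A : Fin n × Fin n → (Fin n × Fin n → ℝ) → ℝ := fun p J => av B β (HH J) (e p) with hA
  have hA1 : ∀ p J, |A p J| ≤ 1 := fun p J => av_abs_le hB _ _ _ (he1 p)
  set f' : Fin n × Fin n → (Fin n × Fin n → ℝ) → ℝ := fun p J =>
    k' (Fe n B β (HH J)) * (c * w / n) * A p J ^ 2 + k (Fe n B β (HH J)) * (c * w * β * (1 - A p J ^ 2)) with hf'
  have cf : ∀ p, Continuous (f p) := fun p => (hkc.comp cF).mul (cA _)
  have cf' : ∀ p, Continuous (f' p) := fun p => by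
    have := cA (e p)
    have h1 := hkc.comp cF
    have h2 := hk'.comp cF
    exact ((h2.mul continuous_const).mul (this.pow 2)).add
      (h1.mul (continuous_const.mul (continuous_const.sub (this.pow 2))))
  have hA2 : ∀ p J, 0 ≤ A p J ^ 2 ∧ A p J ^ 2 ≤ 1 := fun p J => ⟨sq_nonneg _, by
    rw [← sq_abs]; nlinarith [abs_nonneg (A p J), hA1 p J]⟩
  have hK0 : 0 ≤ K := (abs_nonneg _).trans (hK 0)
  have hK20 : 0 ≤ K2 := (abs_nonneg _).trans (hK2 0)
  have bf' : ∀ p J, |f' p J| ≤ K2 * (c * w / n) + K * (c * w * β) := by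
    intro p J
    obtain ⟨a1, a2⟩ := hA2 p J
    refine (abs_add_le _ _).trans (add_le_add ?_ ?_)
    · rw [abs_mul, abs_mul, abs_of_nonneg (show 0 ≤ c * w / n by positivity), abs_of_nonneg a1]
      have : |k' (Fe n B β (HH J))| * (c * w / n) ≤ K2 * (c * w / n) := mul_le_mul_of_nonneg_right (hK2 _) (by positivity)
      have u : 0 ≤ |k' (Fe n B β (HH J))| * (c * w / n) := by positivity
      nlinarith
    · rw [abs_mul, abs_mul, abs_of_nonneg (show 0 ≤ c * w * β by positivity), abs_of_nonneg (show 0 ≤ 1 - A p J ^ 2 by linarith)]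
      refine mul_le_mul (hK _) ?_ (by have : 0 ≤ 1 - A p J ^ 2 := by linarith
                                      positivity) hK0
      have u : 0 ≤ c * w * β := by positivity
      nlinarith
  have bf : ∀ p J, |f p J| ≤ K := by
    intro p J
    rw [hf]; beta_reduce
    rw [abs_mul]
    have := mul_le_mul (hK (Fe n B β (HH J))) (hA1 p J) (abs_nonneg _) hK0
    linarith
  have hder : ∀ p J, HasDerivAt (fun t => f p (Function.update J p t)) (f' p J) (J p) := by
    intro p J
    have hH : ∀ σ ∈ B, HasDerivAt (fun t => HH (Function.update J p t) σ) (c * w * e p σ) (J p) := by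
      intro σ _
      simp only [hHH, YY_update]
      have := ((((hasDerivAt_id (J p)).sub_const (J p)).mul_const (e p σ)).const_mul w).const_add (YY S J σ)
      refine ((this.const_mul c).add_const (y σ)).congr_deriv ?_
      ring
    have d1 := hasDerivAt_Fe (n := n) hB hβ.ne' hH
    have d2 := hasDerivAt_av hB β hH (e p)
    have d3 := ((hk _).comp (J p) d1).mul d2
    rw [Function.update_eq_self] at d3
    refine d3.congr_deriv ?_
    have e1 : av B β (HH J) (fun σ => c * w * e p σ * e p σ) = c * w := by
      rw [← av_const hB β (HH J) (c * w)]
      exact av_congr _ _ fun σ hσ => by rw [mul_assoc, hee p σ hσ, mul_one, av_const hB]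
    have e2 : av B β (HH J) (fun σ => c * w * e p σ) = c * w * A p J := by rw [av_smul]
    simp only [Function.comp, Function.update_eq_self]
    rw [e1, e2, hf']
    ring
  have hst : ∀ p, ∫ J, J p * f p J ∂(gv (Fin n × Fin n)) = ∫ J, f' p J ∂(gv (Fin n × Fin n)) := fun p =>
    steinv p (hder p) (cf p) (bf p) (bf' p) (cf' p)
  have i1 : ∀ p : Fin n × Fin n, Integrable (fun J => J p * f p J) (gv (Fin n × Fin n)) := by
    intro p
    refine ((integrable_coord p).norm.mul_const K).mono' ((continuous_apply p).mul (cf p)).aestronglyMeasurable (Eventually.of_forall fun x => ?_)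
    rw [norm_mul]
    exact mul_le_mul_of_nonneg_left (bf p x) (norm_nonneg _)
  have i2 : ∀ p, Integrable (f' p) (gv (Fin n × Fin n)) := fun p =>
    (integrable_const _).mono' (cf' p).aestronglyMeasurable (Eventually.of_forall (bf' p))
  have L1 : ∫ J, k (Fe n B β (HH J)) * av B β (HH J) (YY S J) ∂(gv (Fin n × Fin n)) =
      ∫ J, w * ∑ p, f' p J ∂(gv (Fin n × Fin n)) := by
    rw [integral_const_mul, integral_finset_sum _ fun p _ => i2 p, ← Finset.sum_congr rfl fun p _ => hst p,
      ← integral_finset_sum _ fun p _ => i1 p, ← integral_const_mul]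
    congr 1
    funext J
    unfold YY
    rw [av_smul, av_sum, ← hw]
    simp only [av_smul]
    rw [Finset.mul_sum, Finset.mul_sum, Finset.mul_sum]
    refine Finset.sum_congr rfl fun p _ => ?_
    rw [hf]; ring
  have hov : ∀ J, ∑ p, A p J ^ 2 = OV B β (HH J) S := fun J => sum_av_sq B β (HH J) S
  have cO : Continuous fun J => OV B β (HH J) S := by
    simp only [← hov]
    exact continuous_finset_sum _ fun p _ => (cA _).pow 2
  have bO : ∀ J, 0 ≤ OV B β (HH J) S ∧ OV B β (HH J) S ≤ n ^ 2 := by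
    intro J
    rw [← hov]
    refine ⟨Finset.sum_nonneg fun p _ => (hA2 p J).1, (Finset.sum_le_sum fun p _ => (hA2 p J).2).trans (le_of_eq ?_)⟩
    simp [sq]
  have L2 : ∀ J, w * ∑ p, f' p J = k' (Fe n B β (HH J)) * (c / (2 * n ^ 2)) * OV B β (HH J) S +
      c * β * (k (Fe n B β (HH J)) * (((n:ℝ) ^ 2 - OV B β (HH J) S) / (2 * n))) := by
    intro J
    rw [hf']; beta_reduce
    rw [Finset.sum_add_distrib, ← Finset.mul_sum, ← Finset.mul_sum, ← Finset.mul_sum, Finset.sum_sub_distrib, hov]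
    have : ∑ p : Fin n × Fin n, (1:ℝ) = n ^ 2 := by simp [sq]
    rw [this]
    have e1 : w * (k' (Fe n B β (HH J)) * (c * w / n) * OV B β (HH J) S + k (Fe n B β (HH J)) * (c * w * β * (n ^ 2 - OV B β (HH J) S)))
      = (w * w) * (k' (Fe n B β (HH J)) * (c / n) * OV B β (HH J) S + k (Fe n B β (HH J)) * (c * β * (n ^ 2 - OV B β (HH J) S))) := by ring
    rw [e1, hw2]
    field_simp
  have i3 : Integrable (fun J => k' (Fe n B β (HH J)) * (c / (2 * n ^ 2)) * OV B β (HH J) S) (gv (Fin n × Fin n)) ∧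
      ∀ J, |k' (Fe n B β (HH J)) * (c / (2 * n ^ 2)) * OV B β (HH J) S| ≤ K2 / 2 := by
    have b : ∀ J, |k' (Fe n B β (HH J)) * (c / (2 * n ^ 2)) * OV B β (HH J) S| ≤ K2 / 2 := by
      intro J
      obtain ⟨o1, o2⟩ := bO J
      rw [abs_mul, abs_mul, abs_of_nonneg (show 0 ≤ c / (2 * (n:ℝ) ^ 2) by positivity), abs_of_nonneg o1]
      have u : c / (2 * (n:ℝ) ^ 2) ≤ 1 / (2 * n ^ 2) := by gcongr
      calc _ ≤ K2 * (1 / (2 * (n:ℝ) ^ 2)) * n ^ 2 := by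
            gcongr
            exact hK2 _
        _ = K2 / 2 := by field_simp
    exact ⟨(integrable_const (K2 / 2)).mono' (((hk'.comp cF).mul continuous_const).mul cO).aestronglyMeasurable
      (Eventually.of_forall b), b⟩
  have i4 : Integrable (fun J => k (Fe n B β (HH J)) * (((n:ℝ) ^ 2 - OV B β (HH J) S) / (2 * n))) (gv (Fin n × Fin n)) := by
    refine (integrable_const (K * n)).mono' ((hkc.comp cF).mul ((continuous_const.sub cO).div_const _)).aestronglyMeasurable
      (Eventually.of_forall fun J => ?_)
    obtain ⟨o1, o2⟩ := bO J
    rw [norm_mul]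
    refine mul_le_mul (hK _) ?_ (norm_nonneg _) hK0
    rw [Real.norm_of_nonneg (div_nonneg (by linarith) (by positivity)), div_le_iff₀ (by positivity)]
    nlinarith
  rw [L1, integral_congr_ae (Eventually.of_forall L2), integral_add i3.1 (i4.const_mul _), integral_const_mul, add_sub_cancel_right]
  have hfin := norm_integral_le_of_norm_le_const (μ := gv (Fin n × Fin n)) (C := K2 / 2)
    (f := fun J => k' (Fe n B β (HH J)) * (c / (2 * n ^ 2)) * OV B β (HH J) S) (Eventually.of_forall i3.2)
  simpa using hfin

end SK

set_option linter.all false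
open MeasureTheory Filter Finset

section Cutoff

/-- Properties of the test function. -/
structure Cut (h k k' : ℝ → ℝ) (K2 : ℝ) : Prop where
  d1 : ∀ x, HasDerivAt h (k x) x
  d2 : ∀ x, HasDerivAt k (k' x) x
  c2 : Continuous k'
  k0 : ∀ x, 0 ≤ k x
  k1 : ∀ x, k x ≤ 1
  b2 : ∀ x, |k' x| ≤ K2
  hz : ∀ x, x ≤ 0 → h x = 0
  hp : ∀ x, 0 < x → 0 < h x
  mono : Monotone h
  hle : ∀ x, 0 ≤ x → h x ≤ x

lemma exists_cut : ∃ h k k' : ℝ → ℝ, ∃ K2, Cut h k k' K2 := by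
  have hk : ContDiff ℝ 1 Real.smoothTransition := Real.smoothTransition.contDiff
  have hkc : Continuous Real.smoothTransition := Real.smoothTransition.continuous
  have hd : ∀ x, HasDerivAt Real.smoothTransition (deriv Real.smoothTransition x) x := fun x =>
    (hk.differentiable (by norm_num) x).hasDerivAt
  have hdc : Continuous (deriv Real.smoothTransition) := hk.continuous_deriv le_rfl
  obtain ⟨K2, hK2⟩ := (isCompact_Icc (a := (0:ℝ)) (b := 1)).exists_bound_of_continuousOn hdc.continuousOn
  have hd1 : ∀ x, HasDerivAt (fun x => ∫ t in (0:ℝ)..x, Real.smoothTransition t) (Real.smoothTransition x) x :=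
    fun x => (hkc.integral_hasStrictDerivAt 0 x).hasDerivAt
  have hmono : Monotone (fun x => ∫ t in (0:ℝ)..x, Real.smoothTransition t) := by
    apply monotone_of_deriv_nonneg fun x => (hd1 x).differentiableAt
    intro x
    rw [(hd1 x).deriv]
    exact Real.smoothTransition.nonneg x
  have K20 : 0 ≤ K2 := (norm_nonneg _).trans (hK2 0 (by simp))
  refine ⟨fun x => ∫ t in (0:ℝ)..x, Real.smoothTransition t, Real.smoothTransition, deriv Real.smoothTransition, K2,
    ⟨hd1, hd, hdc, Real.smoothTransition.nonneg, Real.smoothTransition.le_one, ?_, ?_, ?_, hmono, ?_⟩⟩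
  · intro x
    rcases lt_or_ge x 0 with h | h
    · have : Real.smoothTransition =ᶠ[nhds x] fun _ => 0 := by
        filter_upwards [Iio_mem_nhds h] with y hy
        exact Real.smoothTransition.zero_of_nonpos (le_of_lt hy)
      rw [this.deriv_eq]; simpa using K20
    rcases lt_or_ge 1 x with h' | h'
    · have : Real.smoothTransition =ᶠ[nhds x] fun _ => 1 := by
        filter_upwards [Ioi_mem_nhds h'] with y hy
        exact Real.smoothTransition.one_of_one_le (le_of_lt hy)
      rw [this.deriv_eq]; simpa using K20
    · exact hK2 x ⟨h, h'⟩
  · intro x hx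
    beta_reduce
    rw [intervalIntegral.integral_symm, neg_eq_zero]
    apply intervalIntegral.integral_zero_ae
    refine Eventually.of_forall fun t ht => ?_
    rw [Set.uIoc_of_le hx] at ht
    exact Real.smoothTransition.zero_of_nonpos ht.2
  · intro x hx
    exact intervalIntegral.intervalIntegral_pos_of_pos_on (hkc.intervalIntegrable _ _)
      (fun t ht => Real.smoothTransition.pos_of_pos ht.1) hx
  · intro x hx
    have : ∫ t in (0:ℝ)..x, Real.smoothTransition t ≤ ∫ t in (0:ℝ)..x, (1:ℝ) := by
      apply intervalIntegral.integral_mono_on hx (hkc.intervalIntegrable _ _) (by simp)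
      intro t _
      exact Real.smoothTransition.le_one t
    simpa using this

namespace Cut
variable {h k k' : ℝ → ℝ} {K2 : ℝ}

lemma nonneg (hc : Cut h k k' K2) (x : ℝ) : 0 ≤ h x := by
  rcases le_total x 0 with h | h
  · rw [hc.hz x h]
  · rw [← hc.hz 0 le_rfl]; exact hc.mono h

lemma le_abs (hc : Cut h k k' K2) (x : ℝ) : h x ≤ |x| := by
  rcases le_total x 0 with h | h
  · rw [hc.hz x h]; positivity
  · rw [abs_of_nonneg h]; exact hc.hle x h

lemma cont (hc : Cut h k k' K2) : Continuous h := continuous_iff_continuousAt.2 fun x => (hc.d1 x).continuousAt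
lemma contk (hc : Cut h k k' K2) : Continuous k := continuous_iff_continuousAt.2 fun x => (hc.d2 x).continuousAt

lemma lip (hc : Cut h k k' K2) (x y : ℝ) : |k x - k y| ≤ K2 * |x - y| := by
  have := Convex.norm_image_sub_le_of_norm_hasDerivWithin_le (f := k) (f' := k') (C := K2) (s := Set.univ)
    (fun x _ => (hc.d2 x).hasDerivWithinAt) (fun x _ => hc.b2 x) convex_univ (Set.mem_univ y) (Set.mem_univ x)
  exact this

lemma K2_nonneg (hc : Cut h k k' K2) : 0 ≤ K2 := (abs_nonneg _).trans (hc.b2 0)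

end Cut
end Cutoff

section Interp
variable {n γ : ℕ} {ι : Type*}

lemma YY_abs {S : ι → Fin n → ℝ} {σ : ι} (hS : ∀ x, S σ x = 1 ∨ S σ x = -1) (J : Fin n × Fin n → ℝ) :
    |YY S J σ| ≤ (Real.sqrt (2 * n))⁻¹ * ∑ p, |J p| := by
  unfold YY
  rw [abs_mul, abs_of_nonneg (by positivity)]
  refine mul_le_mul_of_nonneg_left ((Finset.abs_sum_le_sum_abs _ _).trans (Finset.sum_le_sum fun p _ => ?_)) (by positivity)
  rw [abs_mul]
  rcases hS p.1 with h | h <;> rcases hS p.2 with h' | h' <;> simp [h, h']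

lemma integrable_sumabs : Integrable (fun J : Fin n × Fin n → ℝ => (Real.sqrt (2 * n))⁻¹ * ∑ p, |J p|) (gv (Fin n × Fin n)) :=
  (integrable_finset_sum _ fun p _ => (integrable_coord p).norm).const_mul _

/-- Interpolating Hamiltonian. -/
noncomputable def Hs (S : ι → Fin n → ℝ) (X : ι → ℝ) (s : ℝ) (J : Fin n × Fin n → ℝ) (σ : ι) : ℝ :=
  Real.sin s * X σ + Real.cos s * YY S J σ

lemma continuous_Hs (S : ι → Fin n → ℝ) (X : ι → ℝ) (s : ℝ) (σ : ι) : Continuous fun J => Hs S X s J σ := by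
  unfold Hs
  exact continuous_const.add (continuous_const.mul (continuous_YY S σ))

lemma hasDerivAt_Hs (S : ι → Fin n → ℝ) (X : ι → ℝ) (s : ℝ) (J : Fin n × Fin n → ℝ) (σ : ι) :
    HasDerivAt (fun s => Hs S X s J σ) (Real.cos s * X σ - Real.sin s * YY S J σ) s := by
  unfold Hs
  refine (((Real.hasDerivAt_sin s).mul_const _).add ((Real.hasDerivAt_cos s).mul_const _)).congr_deriv ?_
  ring

variable {h k k' : ℝ → ℝ} {K2 : ℝ}

/-- Integrand derivative. -/
noncomputable def dPhi (n : ℕ) (k : ℝ → ℝ) (B : Finset ι) (β : ℝ) (S : ι → Fin n → ℝ) (X : ι → ℝ) (ς c0 κ s : ℝ)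
    (J : Fin n × Fin n → ℝ) : ℝ :=
  k (ς * Fe n B β (Hs S X s J) - c0 - κ * s) *
    (ς * ((Real.cos s * av B β (Hs S X s J) X - Real.sin s * av B β (Hs S X s J) (YY S J)) / n) - κ)

lemma hasDerivAt_Phi (hn : 0 < n) (hc : Cut h k k' K2) {B : Finset ι} (hB : B.Nonempty) {S : ι → Fin n → ℝ}
    (hS : ∀ σ ∈ B, ∀ x, S σ x = 1 ∨ S σ x = -1) {β : ℝ} (hβ : 0 < β) {X : ι → ℝ} {mX : ℝ}
    (hX : ∀ σ ∈ B, |X σ| ≤ mX) {ς : ℝ} (hς : |ς| = 1) (c0 κ s : ℝ) :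
    Integrable (fun J => h (ς * Fe n B β (Hs S X s J) - c0 - κ * s)) (gv (Fin n × Fin n)) ∧
    Integrable (dPhi n k B β S X ς c0 κ s) (gv (Fin n × Fin n)) ∧
    HasDerivAt (fun s => ∫ J, h (ς * Fe n B β (Hs S X s J) - c0 - κ * s) ∂(gv (Fin n × Fin n)))
      (∫ J, dPhi n k B β S X ς c0 κ s J ∂(gv (Fin n × Fin n))) s := by
  have hn' : (0:ℝ) < n := by exact_mod_cast hn
  have cFe : ∀ s, Continuous fun J => Fe n B β (Hs S X s J) := fun s =>
    continuous_Fe hB β fun σ _ => continuous_Hs S X s σ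
  have cF : ∀ s, Continuous fun J => h (ς * Fe n B β (Hs S X s J) - c0 - κ * s) := fun s =>
    hc.cont.comp (((continuous_const.mul (cFe s)).sub continuous_const).sub continuous_const)
  have cD : ∀ s, Continuous (dPhi n k B β S X ς c0 κ s) := fun s => by
    unfold dPhi
    have a1 := continuous_av (B := B) hB β (H := fun J => Hs S X s J) (φ := fun J => X) (fun σ _ => continuous_Hs S X s σ) (fun σ _ => continuous_const)
    have a2 := continuous_av (B := B) hB β (H := fun J => Hs S X s J) (φ := fun J => YY S J) (fun σ _ => continuous_Hs S X s σ) (fun σ _ => continuous_YY S σ)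
    exact (hc.contk.comp (((continuous_const.mul (cFe s)).sub continuous_const).sub continuous_const)).mul
      ((continuous_const.mul (((continuous_const.mul a1).sub (continuous_const.mul a2)).div_const _)).sub continuous_const)
  set W : (Fin n × Fin n → ℝ) → ℝ := fun J => (Real.sqrt (2 * n))⁻¹ * ∑ p, |J p| with hW
  have iW : Integrable W (gv (Fin n × Fin n)) := integrable_sumabs
  have W0 : ∀ J, 0 ≤ W J := fun J => by rw [hW]; positivity
  have mX0 : 0 ≤ mX := by obtain ⟨σ, hσ⟩ := hB; exact (abs_nonneg _).trans (hX σ hσ)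
  have bD : ∀ s J, |dPhi n k B β S X ς c0 κ s J| ≤ (mX + W J) / n + |κ| := by
    intro s J
    unfold dPhi
    have a1 : |av B β (Hs S X s J) X| ≤ mX := av_abs_le hB _ _ _ hX
    have a2 : |av B β (Hs S X s J) (YY S J)| ≤ W J := av_abs_le hB _ _ _ fun σ hσ => YY_abs (hS σ hσ) J
    have kb : |k (ς * Fe n B β (Hs S X s J) - c0 - κ * s)| ≤ 1 := by
      rw [abs_of_nonneg (hc.k0 _)]; exact hc.k1 _
    have b1 : |Real.cos s * av B β (Hs S X s J) X - Real.sin s * av B β (Hs S X s J) (YY S J)| ≤ mX + W J := by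
      refine (abs_sub _ _).trans (add_le_add ?_ ?_)
      · rw [abs_mul]
        have := mul_le_mul (Real.abs_cos_le_one s) a1 (abs_nonneg _) zero_le_one
        linarith
      · rw [abs_mul]
        have := mul_le_mul (Real.abs_sin_le_one s) a2 (abs_nonneg _) zero_le_one
        linarith
    have b2 : |ς * ((Real.cos s * av B β (Hs S X s J) X - Real.sin s * av B β (Hs S X s J) (YY S J)) / n) - κ| ≤ (mX + W J) / n + |κ| := by
      refine (abs_sub _ _).trans (add_le_add ?_ le_rfl)
      rw [abs_mul, hς, one_mul, abs_div, abs_of_pos hn']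
      exact div_le_div_of_nonneg_right b1 hn'.le
    rw [abs_mul]
    have := mul_le_mul kb b2 (abs_nonneg _) zero_le_one
    linarith
  have ibd : Integrable (fun J => (mX + W J) / n + |κ|) (gv (Fin n × Fin n)) :=
    (((integrable_const mX).add iW).div_const _).add (integrable_const _)
  have iF : Integrable (fun J => h (ς * Fe n B β (Hs S X s J) - c0 - κ * s)) (gv (Fin n × Fin n)) := by
    have : Integrable (fun J => |Fe n B β (fun σ => Real.sin s * X σ)| + W J / n + |c0| + |κ * s|) (gv (Fin n × Fin n)) :=
      (((integrable_const _).add (iW.div_const _)).add (integrable_const _)).add (integrable_const _)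
    refine this.mono' (cF s).aestronglyMeasurable (Eventually.of_forall fun J => ?_)
    rw [Real.norm_of_nonneg (hc.nonneg _)]
    refine (hc.le_abs _).trans ?_
    have l := Fe_lip (n := n) hB hβ (H := fun σ => Real.sin s * X σ) (H' := Hs S X s J) (m := W J) (by
      intro σ hσ
      unfold Hs
      rw [add_sub_cancel_left, abs_mul]
      have := mul_le_mul (Real.abs_cos_le_one s) (YY_abs (hS σ hσ) J) (abs_nonneg _) zero_le_one
      linarith)
    have l2 : |Fe n B β (Hs S X s J)| ≤ |Fe n B β (fun σ => Real.sin s * X σ)| + W J / n := by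
      have := abs_sub_abs_le_abs_sub (Fe n B β (Hs S X s J)) (Fe n B β (fun σ => Real.sin s * X σ))
      linarith
    refine (abs_sub _ _).trans (add_le_add ((abs_sub _ _).trans (add_le_add ?_ le_rfl)) le_rfl)
    rw [abs_mul, hς, one_mul]; exact l2
  have iD : Integrable (dPhi n k B β S X ς c0 κ s) (gv (Fin n × Fin n)) :=
    ibd.mono' (cD s).aestronglyMeasurable (Eventually.of_forall (bD s))
  refine ⟨iF, iD, ?_⟩
  refine (hasDerivAt_integral_of_dominated_loc_of_deriv_le (F := fun s J => h (ς * Fe n B β (Hs S X s J) - c0 - κ * s))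
    (F' := fun s J => dPhi n k B β S X ς c0 κ s J) (s := Set.univ) (bound := fun J => (mX + W J) / n + |κ|) univ_mem
    (Eventually.of_forall fun s => (cF s).aestronglyMeasurable) iF (cD s).aestronglyMeasurable
    (Eventually.of_forall fun J s _ => bD s J) ibd (Eventually.of_forall fun J s _ => ?_)).2
  have d1 := hasDerivAt_Fe (n := n) hB hβ.ne' (H := fun s => Hs S X s J) (fun σ _ => hasDerivAt_Hs S X s J σ)
  have d2 : HasDerivAt (fun s => ς * Fe n B β (Hs S X s J) - c0 - κ * s)
      (ς * (av B β (Hs S X s J) (fun σ => Real.cos s * X σ - Real.sin s * YY S J σ) / n) - κ) s := by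
    refine (((d1.const_mul ς).sub_const c0).sub ((hasDerivAt_id s).const_mul κ)).congr_deriv ?_
    simp
  refine ((hc.d1 _).comp s d2).congr_deriv ?_
  rw [av_sub, av_smul, av_smul]
  rfl

end Interp

set_option linter.all false
open MeasureTheory Filter Finset

section Interp2
variable {n γ : ℕ} {ι : Type*} {h k k' : ℝ → ℝ} {K2 : ℝ}

lemma XX_abs (hγ : 0 < γ) {B : Finset ι} {S : ι → Fin n → ℝ} (hS : Bal B S) {G : SimpleGraph (Fin n)}
    (hG : G ∈ regs n γ) : ∀ σ ∈ B, |XX γ S G σ| ≤ γ * n := by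
  intro σ hσ
  have hγ1 : (1:ℝ) ≤ Real.sqrt γ := by
    rw [Real.one_le_sqrt]; exact_mod_cast hγ
  have := EE_abs hG (fun x => pm_abs ((hS σ hσ).1 x)) (fun x => pm_abs ((hS σ hσ).1 x))
  unfold XX
  rw [abs_div, abs_neg, abs_of_pos (show (0:ℝ) < 2 * Real.sqrt γ by positivity), div_le_iff₀ (by positivity)]
  have h2 : (0:ℝ) ≤ γ * n := by positivity
  nlinarith

lemma OV_abs {B : Finset ι} (hB : B.Nonempty) {S : ι → Fin n → ℝ}
    (hS1 : ∀ σ ∈ B, ∀ x, S σ x = 1 ∨ S σ x = -1) (β : ℝ) (H : ι → ℝ) : |OV B β H S| ≤ (n:ℝ) ^ 2 := by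
  unfold OV
  refine av_abs_le hB _ _ _ fun σ hσ => av_abs_le hB _ _ _ fun τ hτ => ?_
  rw [abs_pow]
  gcongr
  refine (Finset.abs_sum_le_sum_abs _ _).trans ?_
  have : ∀ x ∈ (Finset.univ : Finset (Fin n)), |S σ x * S τ x| ≤ 1 := by
    intro x _
    rcases hS1 σ hσ x with h | h <;> rcases hS1 τ hτ x with h' | h' <;> simp [h, h']
  refine (Finset.sum_le_sum this).trans (by simp)

lemma OV_aux {n' o : ℝ} (hn' : 0 < n') (b : |o| ≤ n' ^ 2) : |(n' ^ 2 - o) / (2 * n')| ≤ n' := by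
  rw [abs_div, abs_of_pos (show (0:ℝ) < 2 * n' by positivity), div_le_iff₀ (by positivity)]
  rw [show n' * (2 * n') = 2 * n' ^ 2 by ring]
  rw [abs_le] at b ⊢
  constructor <;> linarith [b.1, b.2, sq_nonneg n']

lemma continuous_OV {X : Type*} [TopologicalSpace X] {B : Finset ι} (hB : B.Nonempty) (β : ℝ)
    {S : ι → Fin n → ℝ} {H : X → ι → ℝ} (hH : ∀ σ ∈ B, Continuous fun J => H J σ) :
    Continuous fun J => OV B β (H J) S := by
  unfold OV
  exact continuous_av hB β (φ := fun J σ => av B β (H J) (fun τ => (∑ x, S σ x * S τ x) ^ 2)) hH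
    fun σ _ => continuous_av hB β (φ := fun _ τ => (∑ x, S σ x * S τ x) ^ 2) hH fun _ _ => continuous_const

set_option maxHeartbeats 1000000 in
lemma deriv_bound (hn : 0 < n) (hγ : 0 < γ) (hc : Cut h k k' K2) {B : Finset ι} (hB : B.Nonempty)
    {S : ι → Fin n → ℝ} (hS : Bal B S) {M : SimpleGraph (Fin n) → ℝ}
    (hM : ∀ G ∈ regs n γ, QB γ G (M G)) {β : ℝ} (hβ : 0 < β) {ς : ℝ} (hς : |ς| = 1) (c0 : ℝ) {L κ : ℝ}
    (hκ : κ = 2 * β * L / Real.sqrt γ + 48 * β ^ 2 / Real.sqrt γ) {s : ℝ} (hs0 : 0 ≤ s) (hs1 : s ≤ Real.pi / 2) :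
    ∑ G ∈ regs n γ, ∫ J, dPhi n k B β S (XX γ S G) ς c0 κ s J ∂(gv (Fin n × Fin n)) ≤
      2 * β / (γ * n) * ∑ G ∈ regs n γ, max (M G - L * n * Real.sqrt γ) 0
        + (regs n γ).card * ((4 * γ ^ 2 + 16 * β * γ + 3 * K2) / n) := by
  have hn' : (0:ℝ) < n := by exact_mod_cast hn
  have hγ' : (0:ℝ) < γ := by exact_mod_cast hγ
  have hsγ : (0:ℝ) < Real.sqrt γ := Real.sqrt_pos.2 hγ'
  have hsq : Real.sqrt γ * Real.sqrt γ = γ := Real.mul_self_sqrt hγ'.le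
  have sin0 : 0 ≤ Real.sin s := Real.sin_nonneg_of_nonneg_of_le_pi hs0 (by linarith [Real.pi_pos])
  have cos0 : 0 ≤ Real.cos s := Real.cos_nonneg_of_neg_pi_div_two_le_of_le (by linarith [Real.pi_pos]) hs1
  have sin1 := Real.sin_le_one s
  have cos1 := Real.cos_le_one s
  have hS1 : ∀ σ ∈ B, ∀ x, S σ x = 1 ∨ S σ x = -1 := fun σ hσ => (hS σ hσ).1
  have K20 := hc.K2_nonneg
  set μ := gv (Fin n × Fin n) with hμ
  set kk : (ι → ℝ) → ℝ := fun H => k (ς * Fe n B β H - c0 - κ * s) with hkk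
  have kk0 : ∀ H, 0 ≤ kk H := fun H => hc.k0 _
  have kk1 : ∀ H, kk H ≤ 1 := fun H => hc.k1 _
  have kkL : ∀ H H' : ι → ℝ, ∀ m : ℝ, (∀ σ ∈ B, |H' σ - H σ| ≤ m) → |kk H' - kk H| ≤ K2 / n * m := by
    intro H H' m hm
    have := hc.lip (ς * Fe n B β H' - c0 - κ * s) (ς * Fe n B β H - c0 - κ * s)
    refine this.trans ?_
    rw [show ς * Fe n B β H' - c0 - κ * s - (ς * Fe n B β H - c0 - κ * s) = ς * (Fe n B β H' - Fe n B β H) by ring,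
      abs_mul, hς, one_mul, div_mul_eq_mul_div, ← mul_div_assoc']
    exact mul_le_mul_of_nonneg_left (Fe_lip hB hβ hm) K20
  set HH : SimpleGraph (Fin n) → (Fin n × Fin n → ℝ) → ι → ℝ := fun G J => Hs S (XX γ S G) s J with hHH
  set ov : SimpleGraph (Fin n) → (Fin n × Fin n → ℝ) → ℝ := fun G J => ((n:ℝ) ^ 2 - OV B β (HH G J) S) / (2 * n) with hov
  have cHH : ∀ G, ∀ σ ∈ B, Continuous fun J => HH G J σ := fun G σ _ => continuous_Hs _ _ _ _
  have ckk : ∀ G, Continuous fun J => kk (HH G J) := fun G =>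
    hc.contk.comp (((continuous_const.mul (continuous_Fe hB β (cHH G))).sub continuous_const).sub continuous_const)
  have kka : ∀ H, |kk H| ≤ 1 := fun H => by rw [abs_of_nonneg (kk0 H)]; exact kk1 H
  have ikk : ∀ G, Integrable (fun J => kk (HH G J)) μ := fun G =>
    (integrable_const 1).mono' (ckk G).aestronglyMeasurable (Eventually.of_forall fun J => kka _)
  have iX : ∀ G ∈ regs n γ, Integrable (fun J => kk (HH G J) * av B β (HH G J) (XX γ S G)) μ := by
    intro G hG
    refine (integrable_const ((γ:ℝ) * n)).mono' ((ckk G).mul (continuous_av hB β (φ := fun _ => XX γ S G) (cHH G) fun _ _ => continuous_const)).aestronglyMeasurable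
      (Eventually.of_forall fun J => ?_)
    rw [norm_mul]
    have := mul_le_mul (kka (HH G J)) (av_abs_le hB β (HH G J) _ (XX_abs hγ hS hG)) (abs_nonneg _) zero_le_one
    rwa [one_mul] at this
  have iY : ∀ G, Integrable (fun J => kk (HH G J) * av B β (HH G J) (YY S J)) μ := by
    intro G
    refine (integrable_sumabs (n := n)).mono' ((ckk G).mul (continuous_av hB β (φ := fun J => YY S J) (cHH G) fun σ _ => continuous_YY S σ)).aestronglyMeasurable
      (Eventually.of_forall fun J => ?_)
    rw [norm_mul]
    have := mul_le_mul (kka (HH G J)) (av_abs_le hB β (HH G J) _ (fun σ hσ => YY_abs (hS1 σ hσ) J)) (abs_nonneg _) zero_le_one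
    rwa [one_mul] at this
  have cov : ∀ G, Continuous (ov G) := by
    intro G
    refine (continuous_const.sub ?_).div_const _
    exact continuous_OV hB β (cHH G)
  have bov : ∀ G J, |ov G J| ≤ n := by
    intro G J
    exact OV_aux hn' (OV_abs hB hS1 β (HH G J))
  have iO : ∀ G, Integrable (fun J => kk (HH G J) * ov G J) μ := by
    intro G
    refine (integrable_const (n:ℝ)).mono' ((ckk G).mul (cov G)).aestronglyMeasurable (Eventually.of_forall fun J => ?_)
    rw [norm_mul]
    have := mul_le_mul (kka (HH G J)) (bov G J) (abs_nonneg _) zero_le_one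
    rwa [one_mul] at this
  set I1 := ∑ G ∈ regs n γ, ∫ J, kk (HH G J) * av B β (HH G J) (XX γ S G) ∂μ with hI1
  set I2 := ∑ G ∈ regs n γ, ∫ J, kk (HH G J) * av B β (HH G J) (YY S J) ∂μ with hI2
  set I3 := ∑ G ∈ regs n γ, ∫ J, kk (HH G J) * ov G J ∂μ with hI3
  set P : SimpleGraph (Fin n) → ℝ := fun G => ∫ J, kk (HH G J) ∂μ with hP
  have P0 : ∀ G, 0 ≤ P G := fun G => integral_nonneg fun J => kk0 _
  have P1 : ∀ G, P G ≤ 1 := fun G => by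
    have := integral_mono (ikk G) (integrable_const (1:ℝ)) (fun J => kk1 (HH G J))
    simpa using this
  -- graph side
  have B1 : |I1 - Real.sin s * β * I3| ≤ ∑ G ∈ regs n γ, P G * (2 * β * M G / γ + 48 * β ^ 2 * n / Real.sqrt γ)
      + (regs n γ).card * (4 * γ ^ 2 + 16 * β * γ + 2 * K2) := by
    have e1 : I1 - Real.sin s * β * I3 = ∫ J, (∑ G ∈ regs n γ, kk (HH G J) * av B β (HH G J) (XX γ S G)
        - Real.sin s * β * ∑ G ∈ regs n γ, kk (HH G J) * ov G J) ∂μ := by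
      rw [integral_sub (integrable_finset_sum _ iX) ((integrable_finset_sum _ fun G _ => iO G).const_mul _),
        integral_const_mul, integral_finset_sum _ iX, integral_finset_sum _ fun G _ => iO G]
    have iR : Integrable (fun J => ∑ G ∈ regs n γ, kk (HH G J) * (2 * β * M G / γ + 48 * β ^ 2 * n / Real.sqrt γ)
      + (regs n γ).card * (4 * γ ^ 2 + 16 * β * γ + 2 * K2)) μ :=
      (integrable_finset_sum _ fun G _ => (ikk G).mul_const _).add (integrable_const _)
    have e2 : ∫ J, (∑ G ∈ regs n γ, kk (HH G J) * (2 * β * M G / γ + 48 * β ^ 2 * n / Real.sqrt γ)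
      + (regs n γ).card * (4 * γ ^ 2 + 16 * β * γ + 2 * K2)) ∂μ = ∑ G ∈ regs n γ, P G * (2 * β * M G / γ + 48 * β ^ 2 * n / Real.sqrt γ)
      + (regs n γ).card * (4 * γ ^ 2 + 16 * β * γ + 2 * K2) := by
      rw [integral_add (integrable_finset_sum _ fun G _ => (ikk G).mul_const _) (integrable_const _),
        integral_finset_sum _ fun G _ => (ikk G).mul_const _]
      simp only [integral_mul_const]
      simp
      rfl
    rw [e1, ← e2, ← Real.norm_eq_abs]
    refine norm_integral_le_of_norm_le iR (Eventually.of_forall fun J => ?_)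
    have := graph_ibp hn hγ hB hS hM (a := Real.sin s) (K := 1) hβ.le sin0 sin1 (fun σ => Real.cos s * YY S J σ) kk kk0 kk1 kkL
      (fun G => HH G J) (fun G σ => rfl)
    refine this.trans (le_of_eq ?_)
    congr 1
    congr 1
    field_simp
  -- SK side
  have B2 : |I2 - Real.cos s * β * I3| ≤ (regs n γ).card * (K2 / 2) := by
    have e1 : I2 - Real.cos s * β * I3 = ∑ G ∈ regs n γ, (∫ J, kk (HH G J) * av B β (HH G J) (YY S J) ∂μ
        - Real.cos s * β * ∫ J, kk (HH G J) * ov G J ∂μ) := by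
      rw [Finset.sum_sub_distrib, ← Finset.mul_sum]
    rw [e1]
    refine (Finset.abs_sum_le_sum_abs _ _).trans ?_
    rw [← nsmul_eq_mul, ← Finset.sum_const]
    refine Finset.sum_le_sum fun G _ => ?_
    refine sk_ibp hn hB hS1 hβ cos0 cos1 (fun σ => Real.sin s * XX γ S G σ) (k := fun x => k (ς * x - c0 - κ * s))
      (k' := fun x => k' (ς * x - c0 - κ * s) * ς) (K := 1) (K2 := K2) ?_ ?_ ?_ ?_ (HH G) (fun J σ => by rw [hHH]; unfold Hs; ring)
    · intro x
      have d2 : HasDerivAt (fun x => ς * x - c0 - κ * s) ς x := by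
        refine ((((hasDerivAt_id x).const_mul ς).sub_const c0).sub_const (κ * s)).congr_deriv ?_
        simp
      exact (hc.d2 _).comp x d2
    · exact (hc.c2.comp (((continuous_const.mul continuous_id).sub continuous_const).sub continuous_const)).mul continuous_const
    · intro x
      rw [abs_of_nonneg (hc.k0 _)]; exact hc.k1 _
    · intro x
      rw [abs_mul, hς, mul_one]; exact hc.b2 _
  -- assembly
  have eD : ∑ G ∈ regs n γ, ∫ J, dPhi n k B β S (XX γ S G) ς c0 κ s J ∂μ =
      ς * ((Real.cos s * I1 - Real.sin s * I2) / n) - κ * ∑ G ∈ regs n γ, P G := by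
    have : ∀ G ∈ regs n γ, ∫ J, dPhi n k B β S (XX γ S G) ς c0 κ s J ∂μ =
        ς * ((Real.cos s * ∫ J, kk (HH G J) * av B β (HH G J) (XX γ S G) ∂μ
          - Real.sin s * ∫ J, kk (HH G J) * av B β (HH G J) (YY S J) ∂μ) / n) - κ * P G := by
      intro G hG
      rw [hP]; beta_reduce
      have i6 : Integrable (fun J => ς * ((Real.cos s * (kk (HH G J) * av B β (HH G J) (XX γ S G))
          - Real.sin s * (kk (HH G J) * av B β (HH G J) (YY S J))) / n)) μ :=
        ((((iX G hG).const_mul _).sub ((iY G).const_mul _)).div_const _).const_mul _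
      rw [← integral_const_mul, ← integral_const_mul, ← integral_sub ((iX G hG).const_mul _) ((iY G).const_mul _),
        ← integral_div, ← integral_const_mul, ← integral_const_mul, ← integral_sub i6 ((ikk G).const_mul _)]
      congr 1
      funext J
      unfold dPhi
      rw [hkk, hHH]
      ring
    rw [Finset.sum_congr rfl this, Finset.sum_sub_distrib, ← Finset.mul_sum, ← Finset.mul_sum, ← Finset.sum_div,
      Finset.sum_sub_distrib, ← Finset.mul_sum, ← Finset.mul_sum]
  rw [eD]
  set C1 : ℝ := 4 * γ ^ 2 + 16 * β * γ + 2 * K2 with hC1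
  set Q := ∑ G ∈ regs n γ, P G * (2 * β * M G / γ + 48 * β ^ 2 * n / Real.sqrt γ) with hQ
  have f1 : |Real.cos s * I1 - Real.sin s * I2| ≤ (Q + (regs n γ).card * C1) + (regs n γ).card * (K2 / 2) := by
    rw [show Real.cos s * I1 - Real.sin s * I2 = Real.cos s * (I1 - Real.sin s * β * I3) - Real.sin s * (I2 - Real.cos s * β * I3) by ring]
    refine (abs_sub _ _).trans (add_le_add ?_ ?_)
    · rw [abs_mul, abs_of_nonneg cos0]
      refine le_trans ?_ B1
      exact mul_le_of_le_one_left (abs_nonneg _) cos1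
    · rw [abs_mul, abs_of_nonneg sin0]
      refine le_trans ?_ B2
      exact mul_le_of_le_one_left (abs_nonneg _) sin1
  have f2 : ς * ((Real.cos s * I1 - Real.sin s * I2) / n) ≤ ((Q + (regs n γ).card * C1) + (regs n γ).card * (K2 / 2)) / n := by
    refine (le_abs_self _).trans ?_
    rw [abs_mul, hς, one_mul, abs_div, abs_of_pos hn']
    exact div_le_div_of_nonneg_right f1 hn'.le
  have f3 : Q / n - κ * ∑ G ∈ regs n γ, P G ≤ 2 * β / (γ * n) * ∑ G ∈ regs n γ, max (M G - L * n * Real.sqrt γ) 0 := by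
    rw [hQ, Finset.sum_div, Finset.mul_sum, Finset.mul_sum, ← Finset.sum_sub_distrib]
    refine Finset.sum_le_sum fun G _ => ?_
    have e : P G * (2 * β * M G / γ + 48 * β ^ 2 * n / Real.sqrt γ) / n - κ * P G =
        2 * β / (γ * n) * (P G * (M G - L * n * Real.sqrt γ)) := by
      rw [hκ]
      have : 2 * β * L / Real.sqrt γ = 2 * β / (γ * n) * (L * n * Real.sqrt γ) := by
        rw [div_mul_eq_mul_div, div_eq_div_iff hsγ.ne' (by positivity)]
        rw [show 2 * β * (L * n * Real.sqrt γ) * Real.sqrt γ = 2 * β * L * n * (Real.sqrt γ * Real.sqrt γ) by ring, hsq]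
        ring
      rw [this]
      field_simp
      ring
    rw [e]
    refine mul_le_mul_of_nonneg_left ?_ (by positivity)
    have m0 : 0 ≤ max (M G - L * n * Real.sqrt γ) 0 := le_max_right _ _
    have m1 : M G - L * n * Real.sqrt γ ≤ max (M G - L * n * Real.sqrt γ) 0 := le_max_left _ _
    have := mul_le_mul_of_nonneg_left m1 (P0 G)
    have := mul_le_mul_of_nonneg_right (P1 G) m0
    linarith
  have f4 : ((regs n γ).card * C1 + (regs n γ).card * (K2 / 2)) / n ≤ (regs n γ).card * ((4 * γ ^ 2 + 16 * β * γ + 3 * K2) / n) := by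
    rw [← mul_add, mul_div_assoc]
    refine mul_le_mul_of_nonneg_left (div_le_div_of_nonneg_right ?_ hn'.le) (Nat.cast_nonneg _)
    rw [hC1]; linarith
  have e6 : ((Q + (regs n γ).card * C1) + (regs n γ).card * (K2 / 2)) / n = Q / n + ((regs n γ).card * C1 + (regs n γ).card * (K2 / 2)) / n := by ring
  linarith

lemma interp (hn : 0 < n) (hγ : 0 < γ) (hc : Cut h k k' K2) {B : Finset ι} (hB : B.Nonempty)
    {S : ι → Fin n → ℝ} (hS : Bal B S) {M : SimpleGraph (Fin n) → ℝ}
    (hM : ∀ G ∈ regs n γ, QB γ G (M G)) {β : ℝ} (hβ : 0 < β) {ς : ℝ} (hς : |ς| = 1) (c0 : ℝ) {L κ : ℝ}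
    (hκ : κ = 2 * β * L / Real.sqrt γ + 48 * β ^ 2 / Real.sqrt γ) :
    ∑ G ∈ regs n γ, h (ς * Fe n B β (XX γ S G) - c0 - κ * (Real.pi / 2)) ≤
      (regs n γ).card * ∫ J, h (ς * Fe n B β (YY S J) - c0) ∂(gv (Fin n × Fin n)) +
      (2 * β / (γ * n) * ∑ G ∈ regs n γ, max (M G - L * n * Real.sqrt γ) 0
        + (regs n γ).card * ((4 * γ ^ 2 + 16 * β * γ + 3 * K2) / n)) * (Real.pi / 2) := by
  set u : ℝ → ℝ := fun s => ∑ G ∈ regs n γ, ∫ J, h (ς * Fe n B β (Hs S (XX γ S G) s J) - c0 - κ * s) ∂(gv (Fin n × Fin n)) with hu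
  set D := 2 * β / (γ * n) * ∑ G ∈ regs n γ, max (M G - L * n * Real.sqrt γ) 0
        + (regs n γ).card * ((4 * γ ^ 2 + 16 * β * γ + 3 * K2) / n) with hD
  have hS1 : ∀ σ ∈ B, ∀ x, S σ x = 1 ∨ S σ x = -1 := fun σ hσ => (hS σ hσ).1
  have hd : ∀ s, HasDerivAt u (∑ G ∈ regs n γ, ∫ J, dPhi n k B β S (XX γ S G) ς c0 κ s J ∂(gv (Fin n × Fin n))) s := by
    intro s
    refine HasDerivAt.fun_sum fun G hG => ?_
    exact (hasDerivAt_Phi hn hc hB hS1 hβ (XX_abs hγ hS hG) hς c0 κ s).2.2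
  have hpi := Real.pi_pos
  have key := Convex.image_sub_le_mul_sub_of_deriv_le (D := Set.Icc (0:ℝ) (Real.pi / 2)) (convex_Icc _ _) (f := u)
    (fun s _ => (hd s).continuousAt.continuousWithinAt) (fun s _ => (hd s).differentiableAt.differentiableWithinAt) (C := D)
    (fun s hs => by
      rw [(hd s).deriv]
      rw [interior_Icc] at hs
      exact deriv_bound hn hγ hc hB hS hM hβ hς c0 hκ hs.1.le hs.2.le)
    0 (by constructor <;> linarith) (Real.pi / 2) (by constructor <;> linarith) (by linarith)
  have e0 : u 0 = (regs n γ).card * ∫ J, h (ς * Fe n B β (YY S J) - c0) ∂(gv (Fin n × Fin n)) := by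
    rw [hu]; beta_reduce
    have : ∀ X : ι → ℝ, ∀ J, Hs S X 0 J = YY S J := by intro X J; funext σ; simp [Hs]
    simp only [this, mul_zero, sub_zero]
    rw [Finset.sum_const, nsmul_eq_mul]
  have e1 : u (Real.pi / 2) = ∑ G ∈ regs n γ, h (ς * Fe n B β (XX γ S G) - c0 - κ * (Real.pi / 2)) := by
    rw [hu]; beta_reduce
    have : ∀ X : ι → ℝ, ∀ J, Hs S X (Real.pi / 2) J = X := by intro X J; funext σ; simp [Hs]
    simp only [this]
    simp
  rw [e0, e1] at key
  linarith

end Interp2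

set_option linter.all false
open MeasureTheory Filter Finset

section MG
variable {n γ : ℕ}

/-- Test vectors. -/
noncomputable def fs (n : ℕ) : Finset (Fin n → ℝ) := Fintype.piFinset fun _ => {-1, 0, 1}

lemma mem_fs {f : Fin n → ℝ} : f ∈ fs n ↔ ∀ x, f x = -1 ∨ f x = 0 ∨ f x = 1 := by
  simp [fs, Fintype.mem_piFinset]

lemma fs_ne (n : ℕ) : (fs n).Nonempty := ⟨fun _ => 0, by simp [mem_fs]⟩

lemma card_fs (n : ℕ) : ((fs n).card : ℝ) ≤ 3 ^ n := by
  unfold fs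
  rw [Fintype.card_piFinset, Finset.prod_const, Finset.card_univ, Fintype.card_fin]
  have : (({-1, 0, 1} : Finset ℝ)).card ≤ 3 := Finset.card_le_three
  push_cast
  gcongr
  exact_mod_cast this

/-- Maximal fluctuation. -/
noncomputable def MG (γ : ℕ) (G : SimpleGraph (Fin n)) : ℝ := (fs n).sup' (fs_ne n) fun f => |QQ γ G f|

lemma MG_QB (G : SimpleGraph (Fin n)) : QB γ G (MG γ G) := by
  intro f hf
  exact Finset.le_sup' (fun f => |QQ γ G f|) (mem_fs.2 hf)

lemma MG_exp (G : SimpleGraph (Fin n)) {θ : ℝ} (hθ : 0 ≤ θ) :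
    Real.exp (θ * MG γ G) ≤ ∑ f ∈ fs n, (Real.exp (θ * (1 * QQ γ G f)) + Real.exp (θ * (-1 * QQ γ G f))) := by
  obtain ⟨f, hf, he⟩ := Finset.exists_mem_eq_sup' (fs_ne n) (fun f => |QQ γ G f|)
  have he' : MG γ G = |QQ γ G f| := he
  rw [he']
  refine le_trans ?_ (Finset.single_le_sum (f := fun f => (Real.exp (θ * (1 * QQ γ G f)) + Real.exp (θ * (-1 * QQ γ G f))))
    (fun f _ => by positivity) hf)
  beta_reduce
  have p1 := Real.exp_pos (θ * (1 * QQ γ G f))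
  have p2 := Real.exp_pos (θ * (-1 * QQ γ G f))
  rcases abs_cases (QQ γ G f) with h | h
  · rw [h.1]; rw [one_mul] at *; linarith
  · rw [h.1]; rw [neg_one_mul] at *; linarith

lemma MG_sum (hn : 0 < n) (hγ : 0 < γ) :
    ∑ G ∈ regs n γ, max (MG γ G - 11 * n * Real.sqrt γ) 0 ≤
      (regs n γ).card * (2 * Real.sqrt γ * Real.exp (8 * γ ^ 2) * Real.exp (-n)) := by
  have hγ' : (0:ℝ) < γ := by exact_mod_cast hγ
  have hs : (0:ℝ) < Real.sqrt γ := Real.sqrt_pos.2 hγ'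
  have hs1 : (1:ℝ) ≤ Real.sqrt γ := by rw [Real.one_le_sqrt]; exact_mod_cast hγ
  have hsq : Real.sqrt γ ^ 2 = γ := Real.sq_sqrt hγ'.le
  set θ := 1 / Real.sqrt γ with hθ
  have θ0 : 0 < θ := by positivity
  have θ1 : θ ≤ 1 := by rw [hθ, div_le_one hs]; exact hs1
  have a1 : ∀ G : SimpleGraph (Fin n), max (MG γ G - 11 * n * Real.sqrt γ) 0 ≤
      Real.sqrt γ * Real.exp (-(11 * n)) * Real.exp (θ * MG γ G) := by
    intro G
    have e : Real.sqrt γ * Real.exp (-(11 * n)) * Real.exp (θ * MG γ G) =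
        Real.sqrt γ * Real.exp (θ * (MG γ G - 11 * n * Real.sqrt γ)) := by
      rw [mul_assoc, ← Real.exp_add]
      congr 2
      rw [hθ]; field_simp; ring
    rw [e]
    apply max_le
    · have := Real.add_one_le_exp (θ * (MG γ G - 11 * n * Real.sqrt γ))
      have h2 : MG γ G - 11 * n * Real.sqrt γ = Real.sqrt γ * (θ * (MG γ G - 11 * n * Real.sqrt γ)) := by
        rw [hθ]; field_simp
      calc _ = Real.sqrt γ * (θ * (MG γ G - 11 * n * Real.sqrt γ)) := h2
        _ ≤ _ := mul_le_mul_of_nonneg_left (by linarith) hs.le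
    · positivity
  have a2 : ∀ ς : ℝ, ς ^ 2 = 1 → ∀ f ∈ fs n, ∑ G ∈ regs n γ, Real.exp (θ * (ς * QQ γ G f)) ≤
      (regs n γ).card * (Real.exp (8 * n) * Real.exp (8 * γ ^ 2)) := by
    intro ς hς f hf
    refine (mgf_bound hn hγ (fun x => ?_) hς θ0.le).trans ?_
    · rcases mem_fs.1 hf x with h | h | h <;> rw [h] <;> norm_num
    · rw [← Real.exp_add]
      have t1 : (γ:ℝ) * θ ^ 2 = 1 := by rw [hθ, div_pow, hsq]; field_simp
      have t2 : 8 * (γ:ℝ) * n * θ ^ 2 = 8 * n := by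
        rw [show 8 * (γ:ℝ) * n * θ ^ 2 = 8 * n * (γ * θ ^ 2) by ring, t1, mul_one]
      have t3 : 8 * (γ:ℝ) ^ 2 * θ ≤ 8 * γ ^ 2 := mul_le_of_le_one_right (by positivity) θ1
      refine mul_le_mul_of_nonneg_left (Real.exp_le_exp.2 ?_) (Nat.cast_nonneg _)
      linarith
  calc _ ≤ ∑ G ∈ regs n γ, Real.sqrt γ * Real.exp (-(11 * n)) * ∑ f ∈ fs n, (Real.exp (θ * (1 * QQ γ G f)) + Real.exp (θ * (-1 * QQ γ G f))) := by
        refine Finset.sum_le_sum fun G _ => (a1 G).trans ?_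
        exact mul_le_mul_of_nonneg_left (MG_exp G θ0.le) (by positivity)
    _ = Real.sqrt γ * Real.exp (-(11 * n)) * ∑ f ∈ fs n, (∑ G ∈ regs n γ, Real.exp (θ * (1 * QQ γ G f)) + ∑ G ∈ regs n γ, Real.exp (θ * (-1 * QQ γ G f))) := by
        rw [← Finset.mul_sum, Finset.sum_comm]
        congr 1
        exact Finset.sum_congr rfl fun f _ => Finset.sum_add_distrib
    _ ≤ Real.sqrt γ * Real.exp (-(11 * n)) * ∑ f ∈ fs n, (2 * ((regs n γ).card * (Real.exp (8 * n) * Real.exp (8 * γ ^ 2)))) := by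
        refine mul_le_mul_of_nonneg_left (Finset.sum_le_sum fun f hf => ?_) (by positivity)
        linarith [a2 1 (by norm_num) f hf, a2 (-1) (by norm_num) f hf]
    _ = (fs n).card * (2 * Real.sqrt γ * Real.exp (8 * γ ^ 2) * (regs n γ).card) * Real.exp (-(3 * n)) := by
        rw [Finset.sum_const, nsmul_eq_mul, show -(3 * (n:ℝ)) = -(11 * n) + 8 * n by ring, Real.exp_add]; ring
    _ ≤ Real.exp (2 * n) * (2 * Real.sqrt γ * Real.exp (8 * γ ^ 2) * (regs n γ).card) * Real.exp (-(3 * n)) := by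
        gcongr
        refine (card_fs n).trans ?_
        rw [mul_comm 2, Real.exp_nat_mul]
        gcongr
        rw [show (2:ℝ) = 1 + 1 by norm_num, Real.exp_add]
        nlinarith [Real.exp_one_gt_d9]
    _ = _ := by
        rw [show -(n:ℝ) = 2 * n + -(3 * n) by ring, Real.exp_add]; ring

end MG

set_option linter.all false
open MeasureTheory Filter Finset

section Conc

lemma lip1_cont {κ : Type*} [Fintype κ] {F : (κ → ℝ) → ℝ} {c : ℝ}
    (hF : ∀ x y, |F x - F y| ≤ c * ∑ i, |x i - y i|) : Continuous F := by
  rw [continuous_iff_continuousAt]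
  intro y
  rw [ContinuousAt, tendsto_iff_dist_tendsto_zero]
  have h0 : Tendsto (fun x : κ → ℝ => c * ∑ i, |x i - y i|) (nhds y) (nhds 0) := by
    have : Continuous fun x : κ → ℝ => c * ∑ i, |x i - y i| := by fun_prop
    simpa using this.tendsto y
  exact squeeze_zero (fun _ => dist_nonneg) (fun x => hF x y) h0

lemma lip1_int {κ : Type*} [Fintype κ] {F : (κ → ℝ) → ℝ} {c : ℝ}
    (hF : ∀ x y, |F x - F y| ≤ c * ∑ i, |x i - y i|) : Integrable F (gv κ) := by
  classical
  have hI : Integrable (fun x : κ → ℝ => |F 0| + c * ∑ i, |x i|) (gv κ) :=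
    (integrable_const _).add ((integrable_finset_sum _ fun i _ => (integrable_coord i).abs).const_mul _)
  refine hI.mono' (lip1_cont hF).aestronglyMeasurable (Eventually.of_forall fun x => ?_)
  have := hF x 0
  simp only [Pi.zero_apply, sub_zero] at this
  rw [Real.norm_eq_abs]
  have h2 := abs_add_le (F x - F 0) (F 0)
  rw [sub_add_cancel] at h2
  linarith

lemma mgf_gs (t : ℝ) : ∫ a, Real.exp (t * a) ∂gs = Real.exp (t ^ 2 / 2) := by
  have := congrFun (ProbabilityTheory.mgf_id_gaussianReal (μ := 0) (v := 1)) t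
  simpa [ProbabilityTheory.mgf] using this

lemma one_conc {f : ℝ → ℝ} {c : ℝ} (hc : 0 ≤ c) (hf : ∀ a b, |f a - f b| ≤ c * |a - b|) :
    Integrable f gs ∧ ∫⁻ a, ENNReal.ofReal (Real.exp (f a - ∫ b, f b ∂gs)) ∂gs ≤ ENNReal.ofReal (Real.exp (c ^ 2)) := by
  have hcont : Continuous f := by
    rw [continuous_iff_continuousAt]
    intro y
    rw [ContinuousAt, tendsto_iff_dist_tendsto_zero]
    have h0 : Tendsto (fun x : ℝ => c * |x - y|) (nhds y) (nhds 0) := by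
      have : Continuous fun x : ℝ => c * |x - y| := by fun_prop
      simpa using this.tendsto y
    exact squeeze_zero (fun _ => dist_nonneg) (fun x => hf x y) h0
  have i0 : Integrable (fun x : ℝ => x) gs := (ProbabilityTheory.memLp_id_gaussianReal' 1 (by simp)).integrable le_rfl
  have hb : ∀ a, |f a| ≤ |f 0| + c * |a| := by
    intro a
    have := hf a 0
    rw [sub_zero] at this
    have h2 := abs_add_le (f a - f 0) (f 0)
    rw [sub_add_cancel] at h2
    linarith
  have ifI : Integrable f gs :=
    ((integrable_const _).add (i0.abs.const_mul c)).mono' hcont.aestronglyMeasurable (Eventually.of_forall hb)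
  have iE : ∀ t : ℝ, Integrable (fun a => Real.exp (t * a)) gs := fun t =>
    ProbabilityTheory.integrable_exp_mul_gaussianReal t
  have iexp : ∀ s : ℝ, |s| = 1 → Integrable (fun a => Real.exp (s * f a)) gs := by
    intro s hs
    have hI : Integrable (fun a : ℝ => Real.exp |f 0| * (Real.exp (c * a) + Real.exp (-c * a))) gs :=
      ((iE c).add (iE (-c))).const_mul _
    refine hI.mono' (by fun_prop) (Eventually.of_forall fun a => ?_)
    rw [Real.norm_eq_abs, abs_of_pos (Real.exp_pos _)]
    have h1 : s * f a ≤ |f 0| + c * |a| := by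
      refine (le_abs_self _).trans ?_
      rw [abs_mul, hs, one_mul]; exact hb a
    refine (Real.exp_le_exp.2 h1).trans ?_
    rw [Real.exp_add]
    refine mul_le_mul_of_nonneg_left ?_ (Real.exp_pos _).le
    have p1 := Real.exp_pos (c * a)
    have p2 := Real.exp_pos (-c * a)
    rcases abs_cases a with h | h
    · rw [h.1]; linarith
    · rw [h.1, show c * -a = -c * a by ring]; linarith
  have ip : Integrable (fun a => Real.exp (f a)) gs := by simpa using iexp 1 (by simp)
  have im : Integrable (fun a => Real.exp (-f a)) gs := by simpa using iexp (-1) (by simp)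
  refine ⟨ifI, ?_⟩
  set m := ∫ b, f b ∂gs with hm
  have jensen : Real.exp (-m) ≤ ∫ b, Real.exp (-f b) ∂gs := by
    have := convexOn_exp.map_integral_le (μ := gs) (f := fun b => -f b) Real.continuous_exp.continuousOn isClosed_univ
      (Eventually.of_forall fun _ => Set.mem_univ _) ifI.neg im
    rwa [integral_neg] at this
  have prod1 : (∫ a, Real.exp (f a) ∂gs) * (∫ b, Real.exp (-f b) ∂gs) ≤ Real.exp (c ^ 2) := by
    have g1 := integral_prod_mul (μ := gs) (ν := gs) (fun a => Real.exp (f a)) (fun b => Real.exp (-f b))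
    have g2 := integral_prod_mul (μ := gs) (ν := gs) (fun a => Real.exp (-f a)) (fun b => Real.exp (f b))
    have g3 := integral_prod_mul (μ := gs) (ν := gs) (fun a => Real.exp (c * a)) (fun b => Real.exp (-c * b))
    have g4 := integral_prod_mul (μ := gs) (ν := gs) (fun a => Real.exp (-c * a)) (fun b => Real.exp (c * b))
    have j1 := ip.mul_prod im
    have j2 := im.mul_prod ip
    have j3 := (iE c).mul_prod (iE (-c))
    have j4 := (iE (-c)).mul_prod (iE c)
    have mono := integral_mono (j1.add j2) (j3.add j4) (fun z => by
      simp only [Pi.add_apply]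
      rw [← Real.exp_add, ← Real.exp_add, ← Real.exp_add, ← Real.exp_add]
      have e1 : Real.exp (f z.1 + -f z.2) + Real.exp (-f z.1 + f z.2) = 2 * Real.cosh (f z.1 - f z.2) := by
        rw [Real.cosh_eq, show -(f z.1 - f z.2) = -f z.1 + f z.2 by ring, ← sub_eq_add_neg]; ring
      have e2 : Real.exp (c * z.1 + -c * z.2) + Real.exp (-c * z.1 + c * z.2) = 2 * Real.cosh (c * (z.1 - z.2)) := by
        rw [Real.cosh_eq, show -(c * (z.1 - z.2)) = -c * z.1 + c * z.2 by ring, show c * z.1 + -c * z.2 = c * (z.1 - z.2) by ring]; ring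
      rw [e1, e2]
      refine mul_le_mul_of_nonneg_left (Real.cosh_le_cosh.2 ?_) (by norm_num)
      rw [abs_mul, abs_of_nonneg hc]
      exact hf _ _)
    rw [integral_add' j1 j2, integral_add' j3 j4, g1, g2, g3, g4, mgf_gs, mgf_gs, ← Real.exp_add, ← Real.exp_add] at mono
    rw [show c ^ 2 / 2 + (-c) ^ 2 / 2 = c ^ 2 by ring, show (-c) ^ 2 / 2 + c ^ 2 / 2 = c ^ 2 by ring] at mono
    linarith
  have e : ∀ a, Real.exp (f a - m) = Real.exp (f a) * Real.exp (-m) := fun a => by rw [← Real.exp_add, sub_eq_add_neg]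
  rw [← ofReal_integral_eq_lintegral_ofReal]
  · apply ENNReal.ofReal_le_ofReal
    simp only [e]
    rw [integral_mul_const]
    exact (mul_le_mul_of_nonneg_left jensen (integral_nonneg fun a => (Real.exp_pos _).le)).trans prod1
  · simp only [e]; exact ip.mul_const _
  · exact Eventually.of_forall fun a => (Real.exp_pos _).le

lemma mp_cons (N : ℕ) : MeasurePreserving (fun z : ℝ × (Fin N → ℝ) => (Fin.cons z.1 z.2 : Fin (N + 1) → ℝ))
    (gs.prod (gv (Fin N))) (gv (Fin (N + 1))) := by
  have := (measurePreserving_piFinSuccAbove (fun _ : Fin (N + 1) => gs) 0).symm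
  have e : (fun z : ℝ × (Fin N → ℝ) => (Fin.cons z.1 z.2 : Fin (N + 1) → ℝ)) =
      ⇑(MeasurableEquiv.piFinSuccAbove (fun _ : Fin (N + 1) => ℝ) 0).symm := by
    funext z i
    refine Fin.cases ?_ (fun j => ?_) i <;> rfl
  rw [e]
  exact this

lemma conc_fin (N : ℕ) : ∀ (F : (Fin N → ℝ) → ℝ) (c : ℝ), 0 ≤ c → (∀ x y, |F x - F y| ≤ c * ∑ i, |x i - y i|) →
    ∫⁻ x, ENNReal.ofReal (Real.exp (F x - ∫ y, F y ∂(gv (Fin N)))) ∂(gv (Fin N)) ≤ ENNReal.ofReal (Real.exp (N * c ^ 2)) := by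
  induction N with
  | zero =>
    intro F c hc hF
    have : ∀ x, F x = F 0 := fun x => by rw [Subsingleton.elim x 0]
    simp only [this]
    simp
  | succ N ih =>
    intro F c hc hF
    have hcF := lip1_cont hF
    have hiF := lip1_int hF
    have hcp := (mp_cons N).integrable_comp_of_integrable hiF
    have hcc : Continuous fun z : ℝ × (Fin N → ℝ) => F (Fin.cons z.1 z.2) := by
      refine hcF.comp (continuous_pi fun i => ?_)
      refine Fin.cases ?_ (fun j => ?_) i
      · simpa using continuous_fst
      · simp only [Fin.cons_succ]; fun_prop
    have hone : ∀ u : Fin N → ℝ, ∀ a b : ℝ, |F (Fin.cons a u) - F (Fin.cons b u)| ≤ c * |a - b| := by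
      intro u a b
      refine (hF _ _).trans (le_of_eq ?_)
      rw [Fin.sum_univ_succ]; simp
    set g : (Fin N → ℝ) → ℝ := fun u => ∫ a, F (Fin.cons a u) ∂gs with hg
    have hgl : ∀ u v, |g u - g v| ≤ c * ∑ i, |u i - v i| := by
      intro u v
      rw [hg]; beta_reduce
      rw [← integral_sub (one_conc hc (hone u)).1 (one_conc hc (hone v)).1, ← Real.norm_eq_abs]
      refine (norm_integral_le_of_norm_le_const (C := c * ∑ i, |u i - v i|) (Eventually.of_forall fun a => ?_)).trans (by simp)
      refine (hF _ _).trans (le_of_eq ?_)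
      rw [Fin.sum_univ_succ]; simp
    have hEg : ∫ y, F y ∂(gv (Fin (N + 1))) = ∫ u, g u ∂(gv (Fin N)) := by
      rw [← (mp_cons N).map_eq, integral_map (mp_cons N).measurable.aemeasurable hcF.aestronglyMeasurable]
      exact integral_prod_symm _ hcp
    rw [hEg]
    set m := ∫ u, g u ∂(gv (Fin N)) with hm
    have hmeas : Measurable fun x : Fin (N + 1) → ℝ => ENNReal.ofReal (Real.exp (F x - m)) :=
      ((hcF.sub continuous_const).rexp).measurable.ennreal_ofReal
    rw [← (mp_cons N).lintegral_comp hmeas, lintegral_prod_symm' (fun z : ℝ × (Fin N → ℝ) => ENNReal.ofReal (Real.exp (F (Fin.cons z.1 z.2) - m))) (hmeas.comp (mp_cons N).measurable)]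
    have : ∀ u : Fin N → ℝ, ∫⁻ a, ENNReal.ofReal (Real.exp (F (Fin.cons a u) - m)) ∂gs ≤
        ENNReal.ofReal (Real.exp (c ^ 2)) * ENNReal.ofReal (Real.exp (g u - m)) := by
      intro u
      have e : ∀ a : ℝ, ENNReal.ofReal (Real.exp (F (Fin.cons a u) - m)) =
          ENNReal.ofReal (Real.exp (F (Fin.cons a u) - g u)) * ENNReal.ofReal (Real.exp (g u - m)) := by
        intro a
        rw [← ENNReal.ofReal_mul (Real.exp_pos _).le, ← Real.exp_add]
        congr 2; ring
      simp only [e]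
      rw [lintegral_mul_const']
      · exact mul_le_mul_left (one_conc hc (hone u)).2 _
      · exact ENNReal.ofReal_ne_top
    refine (lintegral_mono this).trans ?_
    rw [lintegral_const_mul' _ _ ENNReal.ofReal_ne_top]
    refine (mul_le_mul_right (ih g c hc hgl) _).trans (le_of_eq ?_)
    rw [← ENNReal.ofReal_mul (Real.exp_pos _).le, ← Real.exp_add]
    congr 2; push_cast; ring

lemma conc {κ : Type*} [Fintype κ] {F : (κ → ℝ) → ℝ} {c : ℝ} (hc : 0 ≤ c)
    (hF : ∀ x y, |F x - F y| ≤ c * ∑ i, |x i - y i|) :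
    Integrable (fun x => Real.exp (F x - ∫ y, F y ∂(gv κ))) (gv κ) ∧
    ∫ x, Real.exp (F x - ∫ y, F y ∂(gv κ)) ∂(gv κ) ≤ Real.exp (Fintype.card κ * c ^ 2) := by
  have hcF := lip1_cont hF
  set m := ∫ y, F y ∂(gv κ) with hm
  have key : ∫⁻ x, ENNReal.ofReal (Real.exp (F x - m)) ∂(gv κ) ≤ ENNReal.ofReal (Real.exp (Fintype.card κ * c ^ 2)) := by
    set e := (Fintype.equivFin κ).symm with he
    have mp : MeasurePreserving (MeasurableEquiv.piCongrLeft (fun _ : κ => ℝ) e) (gv (Fin (Fintype.card κ))) (gv κ) :=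
      measurePreserving_piCongrLeft (fun _ : κ => gs) e
    have hap : ∀ x : Fin (Fintype.card κ) → ℝ, ∀ i, MeasurableEquiv.piCongrLeft (fun _ : κ => ℝ) e x (e i) = x i := by
      intro x i
      rw [MeasurableEquiv.coe_piCongrLeft]
      exact Equiv.piCongrLeft_apply_apply (fun _ : κ => ℝ) e x i
    have h2 := conc_fin (Fintype.card κ) (fun x => F (MeasurableEquiv.piCongrLeft (fun _ : κ => ℝ) e x)) c hc (by
      intro x y
      refine (hF _ _).trans (le_of_eq ?_)
      rw [← e.sum_comp]
      simp only [hap])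
    have hm2 : ∫ y, F (MeasurableEquiv.piCongrLeft (fun _ : κ => ℝ) e y) ∂(gv (Fin (Fintype.card κ))) = m := by
      rw [hm, ← mp.integral_comp']
    rw [hm2] at h2
    have hmeas : Measurable fun x : κ → ℝ => ENNReal.ofReal (Real.exp (F x - m)) :=
      ((hcF.sub continuous_const).rexp).measurable.ennreal_ofReal
    rw [← mp.lintegral_comp hmeas]
    exact h2
  have hcont : Continuous fun x => Real.exp (F x - m) := (hcF.sub continuous_const).rexp
  have hI : Integrable (fun x => Real.exp (F x - m)) (gv κ) := by
    refine ⟨hcont.aestronglyMeasurable, ?_⟩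
    rw [hasFiniteIntegral_iff_ofReal (Eventually.of_forall fun a => (Real.exp_pos _).le)]
    exact key.trans_lt ENNReal.ofReal_lt_top
  refine ⟨hI, ?_⟩
  rw [← ENNReal.ofReal_le_ofReal_iff (Real.exp_pos _).le, ofReal_integral_eq_lintegral_ofReal hI (Eventually.of_forall fun a => (Real.exp_pos _).le)]
  exact key

end Conc

set_option linter.all false
open MeasureTheory Filter Finset

section SK
variable {n : ℕ}

/-- Spin vectors. -/
noncomputable def Sp (σ : Fin n → Bool) (x : Fin n) : ℝ := spin (σ x)

lemma Sp_pm (σ : Fin n → Bool) (x : Fin n) : Sp σ x = 1 ∨ Sp σ x = -1 := by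
  unfold Sp spin; cases σ x <;> simp

/-- Balanced configurations. -/
noncomputable def BB (n : ℕ) : Finset (Fin n → Bool) := Finset.univ.filter fun σ => ∑ x, Sp σ x = 0

lemma BB_bal : Bal (BB n) (Sp (n := n)) := fun σ hσ => ⟨Sp_pm σ, (Finset.mem_filter.1 hσ).2⟩

lemma YY_sub {ι : Type*} (S : ι → Fin n → ℝ) (J J' : Fin n × Fin n → ℝ) (σ : ι) :
    YY S (fun p => J p - J' p) σ = YY S J σ - YY S J' σ := by
  unfold YY
  rw [← mul_sub, ← Finset.sum_sub_distrib]
  congr 1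
  exact Finset.sum_congr rfl fun p _ => by ring

/-- Maximum over a set of configurations. -/
noncomputable def Mx (T : Finset (Fin n → Bool)) (hT : T.Nonempty) (J : Fin n × Fin n → ℝ) : ℝ :=
  T.sup' hT (YY Sp J)

lemma Mx_lip (T : Finset (Fin n → Bool)) (hT : T.Nonempty) (J J' : Fin n × Fin n → ℝ) :
    |Mx T hT J - Mx T hT J'| ≤ (Real.sqrt (2 * n))⁻¹ * ∑ p, |J p - J' p| := by
  have h : ∀ J J' : Fin n × Fin n → ℝ, Mx T hT J - Mx T hT J' ≤ (Real.sqrt (2 * n))⁻¹ * ∑ p, |J p - J' p| := by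
    intro J J'
    rw [sub_le_iff_le_add]
    unfold Mx
    refine Finset.sup'_le hT _ fun σ hσ => ?_
    have h1 := YY_abs (Sp_pm σ) (fun p => J p - J' p)
    rw [YY_sub] at h1
    have h2 := Finset.le_sup' (YY Sp J') hσ
    linarith [le_abs_self (YY Sp J σ - YY Sp J' σ)]
  rw [abs_le]
  refine ⟨?_, h J J'⟩
  have := h J' J
  have e : ∑ p, |J' p - J p| = ∑ p, |J p - J' p| := Finset.sum_congr rfl fun p _ => abs_sub_comm _ _
  rw [e] at this
  linarith

lemma Mx_int (T : Finset (Fin n → Bool)) (hT : T.Nonempty) : Integrable (Mx T hT) (gv (Fin n × Fin n)) :=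
  lip1_int (Mx_lip T hT)

/-- Mean of the maximum. -/
noncomputable def mu (T : Finset (Fin n → Bool)) (hT : T.Nonempty) : ℝ := ∫ J, Mx T hT J ∂(gv (Fin n × Fin n))

lemma Mx_exp (hn : 0 < n) (T : Finset (Fin n → Bool)) (hT : T.Nonempty) {s : ℝ} (hs : |s| = 1) :
    Integrable (fun J => Real.exp (s * ((Mx T hT J - mu T hT) / Real.sqrt n))) (gv (Fin n × Fin n)) ∧
    ∫ J, Real.exp (s * ((Mx T hT J - mu T hT) / Real.sqrt n)) ∂(gv (Fin n × Fin n)) ≤ 2 := by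
  have hn' : (0:ℝ) < n := by exact_mod_cast hn
  have hq : (0:ℝ) < Real.sqrt n := Real.sqrt_pos.2 hn'
  have hl : ∀ J J', |s * (Mx T hT J / Real.sqrt n) - s * (Mx T hT J' / Real.sqrt n)| ≤
      ((Real.sqrt (2 * n))⁻¹ / Real.sqrt n) * ∑ p, |J p - J' p| := by
    intro J J'
    rw [← mul_sub, ← sub_div, abs_mul, hs, one_mul, abs_div, abs_of_pos hq, div_mul_eq_mul_div]
    exact div_le_div_of_nonneg_right (Mx_lip T hT J J') hq.le
  have := conc (by positivity) hl
  have e : ∫ J, s * (Mx T hT J / Real.sqrt n) ∂(gv (Fin n × Fin n)) = s * (mu T hT / Real.sqrt n) := by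
    rw [integral_const_mul, integral_div]; rfl
  rw [e] at this
  have e2 : ∀ J, s * (Mx T hT J / Real.sqrt n) - s * (mu T hT / Real.sqrt n) = s * ((Mx T hT J - mu T hT) / Real.sqrt n) := by
    intro J; ring
  simp only [e2] at this
  refine ⟨this.1, this.2.trans ?_⟩
  have e3 : (Fintype.card (Fin n × Fin n) : ℝ) * ((Real.sqrt (2 * n))⁻¹ / Real.sqrt n) ^ 2 = 1 / 2 := by
    rw [div_pow, inv_pow, Real.sq_sqrt hn'.le, Real.sq_sqrt (by positivity), Fintype.card_prod, Fintype.card_fin]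
    push_cast
    field_simp
  rw [e3]
  have h4 : Real.exp (1 / 2) * Real.exp (1 / 2) = Real.exp 1 := by rw [← Real.exp_add]; norm_num
  nlinarith [Real.exp_one_lt_d9, Real.exp_pos (1 / 2)]

lemma Mx_dev (hn : 0 < n) (T : Finset (Fin n → Bool)) (hT : T.Nonempty) :
    ∫ J, |Mx T hT J - mu T hT| ∂(gv (Fin n × Fin n)) ≤ 4 * Real.sqrt n := by
  have hn' : (0:ℝ) < n := by exact_mod_cast hn
  have hq : (0:ℝ) < Real.sqrt n := Real.sqrt_pos.2 hn'
  obtain ⟨i1, b1⟩ := Mx_exp hn T hT (s := 1) (by simp)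
  obtain ⟨i2, b2⟩ := Mx_exp hn T hT (s := -1) (by simp)
  have hi : Integrable (fun J => |Mx T hT J - mu T hT|) (gv (Fin n × Fin n)) := ((Mx_int T hT).sub (integrable_const _)).abs
  have := integral_mono hi ((i1.add i2).const_mul (Real.sqrt n)) (fun J => by
    beta_reduce
    simp only [Pi.add_apply]
    set x := (Mx T hT J - mu T hT) / Real.sqrt n with hx
    have e : Mx T hT J - mu T hT = Real.sqrt n * x := by rw [hx]; field_simp
    rw [e, abs_mul, abs_of_pos hq]
    refine mul_le_mul_of_nonneg_left ?_ hq.le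
    have h1 := Real.add_one_le_exp (1 * x)
    have h2 := Real.add_one_le_exp (-1 * x)
    have p1 := Real.exp_pos (1 * x)
    have p2 := Real.exp_pos (-1 * x)
    rw [abs_le]; constructor <;> linarith)
  rw [integral_const_mul, integral_add' i1 i2] at this
  nlinarith

/-- Partial flip. -/
def eta (k : ℕ) (x : Fin n) : ℤ := if x.1 < k then -1 else 1

lemma ivt (g : ℕ → ℤ) (n : ℕ) (h0 : 0 ≤ g 0) (hn : g n = -g 0) (he : ∀ k, Even (g k))
    (hs : ∀ k, k < n → |g (k + 1) - g k| ≤ 2) : ∃ k ≤ n, g k = 0 := by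
  classical
  have ex : ∃ k, g k ≤ 0 := ⟨n, by omega⟩
  have hk := Nat.find_spec ex
  have hle : Nat.find ex ≤ n := Nat.find_min' ex (by omega)
  refine ⟨Nat.find ex, hle, ?_⟩
  rcases Nat.eq_zero_or_pos (Nat.find ex) with h | h
  · rw [h] at hk ⊢; omega
  · obtain ⟨m, hm⟩ := Nat.exists_eq_succ_of_ne_zero h.ne'
    have h2 := Nat.find_min ex (m := m) (by omega)
    have h3 := hs m (by omega)
    rw [hm] at hk ⊢
    rw [abs_le] at h3
    obtain ⟨a, ha⟩ := he m
    obtain ⟨b, hb⟩ := he (m + 1)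
    simp only [Nat.succ_eq_add_one] at *
    omega

lemma ivt' (g : ℕ → ℤ) (n : ℕ) (hn : g n = -g 0) (he : ∀ k, Even (g k))
    (hs : ∀ k, k < n → |g (k + 1) - g k| ≤ 2) : ∃ k ≤ n, g k = 0 := by
  rcases le_total 0 (g 0) with h | h
  · exact ivt g n h hn he hs
  · obtain ⟨k, hk, h2⟩ := ivt (fun k => -g k) n (by simpa using h) (by beta_reduce; omega) (fun k => (he k).neg) (fun k hk => by
      have := hs k hk
      rw [abs_le] at *
      constructor <;> linarith [this.1, this.2])
    exact ⟨k, hk, by simpa using h2⟩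

lemma balance (hn : Even n) (a : Fin n → ℤ) (ha : ∀ x, a x = 1 ∨ a x = -1) :
    ∃ k ≤ n, ∑ x, eta k x * a x = 0 := by
  refine ivt' (fun k => ∑ x, eta k x * a x) n ?_ ?_ ?_
  · beta_reduce
    rw [← Finset.sum_neg_distrib]
    refine Finset.sum_congr rfl fun x _ => ?_
    simp [eta]
  · intro k
    have h1 : Even (∑ x : Fin n, (eta k x * a x - 1)) := by
      refine Finset.even_sum _ fun x _ => ?_
      unfold eta
      split_ifs <;> rcases ha x with h | h <;> rw [h] <;> decide
    rw [Finset.sum_sub_distrib] at h1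
    simp only [Finset.sum_const, Finset.card_univ, Fintype.card_fin, nsmul_eq_mul, mul_one] at h1
    have h2 : Even ((n:ℤ)) := by exact_mod_cast hn
    have := h1.add h2
    simpa using this
  · intro k hk
    beta_reduce
    rw [← Finset.sum_sub_distrib, Finset.sum_eq_single (⟨k, hk⟩ : Fin n)]
    · rcases ha ⟨k, hk⟩ with h | h <;> simp [eta, h]
    · intro x _ hx
      have : x.1 ≠ k := fun h => hx (Fin.ext h)
      have e : (x.1 < k + 1) = (x.1 < k) := by
        apply propext; omega
      simp [eta, e]
    · simp

/-- Gauge transformation. -/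
noncomputable def ggauge (k : ℕ) (J : Fin n × Fin n → ℝ) (p : Fin n × Fin n) : ℝ := ((eta k p.1 * eta k p.2 : ℤ) : ℝ) * J p

lemma eta_pm (k : ℕ) (x : Fin n) : eta k x = 1 ∨ eta k x = -1 := by unfold eta; split_ifs <;> simp

lemma ggauge_mp (k : ℕ) : MeasurePreserving (ggauge (n := n) k) (gv (Fin n × Fin n)) (gv (Fin n × Fin n)) := by
  refine measurePreserving_pi (ι := Fin n × Fin n) (fun _ => gs) (fun _ => gs) (f := fun (p : Fin n × Fin n) y => ((eta k p.1 * eta k p.2 : ℤ) : ℝ) * y) fun p => ?_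
  have h1 : MeasurePreserving (fun y : ℝ => y) gs gs := MeasurePreserving.id _
  have h2 : MeasurePreserving (fun y : ℝ => -y) gs gs :=
    ⟨measurable_neg, by rw [ProbabilityTheory.gaussianReal_map_neg]; simp⟩
  rcases eta_pm k p.1 with h | h <;> rcases eta_pm k p.2 with h' | h' <;> rw [h, h'] <;> simpa

lemma knuth (hn : Even n) (σ : Fin n → Bool) : ∃ k ≤ n, ∃ τ ∈ BB n, ∀ J, YY Sp J σ = YY Sp (ggauge k J) τ := by
  obtain ⟨k, hk, h0⟩ := balance hn (fun x => if σ x then 1 else -1) (fun x => by beta_reduce; split_ifs <;> simp)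
  set τ : Fin n → Bool := fun x => if x.1 < k then !σ x else σ x with hτ
  have hs : ∀ x, Sp τ x = (eta k x : ℝ) * Sp σ x := by
    intro x
    rw [hτ]; unfold Sp eta spin
    beta_reduce
    by_cases h : x.1 < k <;> cases σ x <;> simp [h]
  refine ⟨k, hk, τ, ?_, ?_⟩
  · rw [BB, Finset.mem_filter]
    refine ⟨Finset.mem_univ _, ?_⟩
    have : ((∑ x, eta k x * (if σ x then 1 else -1 : ℤ) : ℤ) : ℝ) = 0 := by rw [h0]; simp
    rw [← this]
    push_cast
    refine Finset.sum_congr rfl fun x _ => ?_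
    rw [hs]; unfold Sp spin; rfl
  · intro J
    unfold YY
    congr 1
    refine Finset.sum_congr rfl fun p _ => ?_
    rw [hs, hs, ggauge]
    rcases eta_pm k p.1 with h | h <;> rcases eta_pm k p.2 with h' | h' <;> rw [h, h'] <;> push_cast <;> ring

lemma BB_ne (hn : Even n) : (BB n).Nonempty := by
  obtain ⟨k, _, τ, h, _⟩ := knuth hn (fun _ => true)
  exact ⟨τ, h⟩

lemma mu_le (hn : Even n) : mu (BB n) (BB_ne hn) ≤ mu (Finset.univ : Finset (Fin n → Bool)) Finset.univ_nonempty := by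
  unfold mu
  refine integral_mono (Mx_int _ _) (Mx_int _ _) fun J => ?_
  exact Finset.sup'_mono _ (Finset.subset_univ _) _

lemma le_mu (h0 : 0 < n) (hn : Even n) : mu (Finset.univ : Finset (Fin n → Bool)) Finset.univ_nonempty ≤
    mu (BB n) (BB_ne hn) + Real.sqrt n * (Real.log (n + 1) + 2) := by
  have hn' : (0:ℝ) < n := by exact_mod_cast h0
  have hq : (0:ℝ) < Real.sqrt n := Real.sqrt_pos.2 hn'
  set μB := mu (BB n) (BB_ne hn) with hμB
  set W : (Fin n × Fin n → ℝ) → ℝ := fun J => Real.exp (1 * ((Mx (BB n) (BB_ne hn) J - μB) / Real.sqrt n)) with hW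
  obtain ⟨iW, bW⟩ := Mx_exp h0 (BB n) (BB_ne hn) (s := 1) (by simp)
  have iWk : ∀ k, Integrable (fun J => W (ggauge k J)) (gv (Fin n × Fin n)) := fun k =>
    (ggauge_mp k).integrable_comp_of_integrable iW
  have bWk : ∀ k, ∫ J, W (ggauge k J) ∂(gv (Fin n × Fin n)) ≤ 2 := fun k => by
    have e : ∫ J, W (ggauge k J) ∂(gv (Fin n × Fin n)) = ∫ J, W J ∂(gv (Fin n × Fin n)) := by
      conv_rhs => rw [← (ggauge_mp k).map_eq]
      rw [integral_map (ggauge_mp k).measurable.aemeasurable]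
      rw [(ggauge_mp k).map_eq]
      exact iW.aestronglyMeasurable
    rw [e]; exact bW
  have pt : ∀ J, Mx (Finset.univ : Finset (Fin n → Bool)) Finset.univ_nonempty J ≤
      μB + Real.sqrt n * (Real.log (n + 1) + ((n:ℝ) + 1)⁻¹ * ∑ k ∈ Finset.range (n + 1), W (ggauge k J)) := by
    intro J
    refine Finset.sup'_le _ _ fun σ _ => ?_
    obtain ⟨k, hk, τ, hτ, he⟩ := knuth hn σ
    rw [he]
    have h1 : YY Sp (ggauge k J) τ ≤ Mx (BB n) (BB_ne hn) (ggauge k J) := Finset.le_sup' (YY Sp (ggauge k J)) hτ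
    have h2 : W (ggauge k J) ≤ ∑ k ∈ Finset.range (n + 1), W (ggauge k J) :=
      Finset.single_le_sum (f := fun k => W (ggauge k J)) (fun k _ => (Real.exp_pos _).le) (Finset.mem_range.2 (by omega))
    set x := (Mx (BB n) (BB_ne hn) (ggauge k J) - μB) / Real.sqrt n with hx
    have e : Mx (BB n) (BB_ne hn) (ggauge k J) = μB + Real.sqrt n * x := by rw [hx]; field_simp; ring
    rw [e] at h1
    refine h1.trans ?_
    gcongr
    have h3 := Real.add_one_le_exp (x - Real.log (n + 1))
    rw [Real.exp_sub, Real.exp_log (by positivity), div_eq_inv_mul] at h3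
    have h4 : W (ggauge k J) = Real.exp x := by rw [hW]; beta_reduce; rw [one_mul]
    rw [h4] at h2
    have h5 := mul_le_mul_of_nonneg_left h2 (show (0:ℝ) ≤ ((n:ℝ) + 1)⁻¹ by positivity)
    linarith
  have iS : Integrable (fun J => ∑ k ∈ Finset.range (n + 1), W (ggauge k J)) (gv (Fin n × Fin n)) :=
    integrable_finset_sum _ fun k _ => iWk k
  have iT : Integrable (fun J => Real.log (n + 1) + ((n:ℝ) + 1)⁻¹ * ∑ k ∈ Finset.range (n + 1), W (ggauge k J)) (gv (Fin n × Fin n)) :=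
    (integrable_const _).add (iS.const_mul _)
  have := integral_mono (Mx_int _ _) ((integrable_const μB).add (iT.const_mul (Real.sqrt n))) pt
  rw [integral_add' (integrable_const μB) (iT.const_mul (Real.sqrt n)), integral_const_mul,
    integral_add (integrable_const _) (iS.const_mul _), integral_const_mul, integral_finset_sum _ fun k _ => iWk k] at this
  simp only [integral_const, probReal_univ, one_smul] at this
  refine this.trans ?_
  gcongr
  have h6 : ∑ k ∈ Finset.range (n + 1), ∫ J, W (ggauge k J) ∂(gv (Fin n × Fin n)) ≤ ((n:ℝ) + 1) * 2 := by
    refine (Finset.sum_le_sum fun k _ => bWk k).trans ?_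
    simp
  have h7 := mul_le_mul_of_nonneg_left h6 (show (0:ℝ) ≤ ((n:ℝ) + 1)⁻¹ by positivity)
  rwa [← mul_assoc, inv_mul_cancel₀ (by positivity), one_mul] at h7

lemma mu_univ (n : ℕ) : ∫ J, (⨆ σ : Fin n → Bool, -HSK n J σ) ∂(skMeasure n) =
    mu (Finset.univ : Finset (Fin n → Bool)) Finset.univ_nonempty := by
  unfold mu skMeasure
  congr 1
  funext J
  unfold Mx
  rw [Finset.sup'_univ_eq_ciSup]
  congr 1
  funext σ
  unfold HSK YY Sp
  rw [neg_mul, neg_neg]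
  congr 1
  exact Finset.sum_congr rfl fun p _ => by ring

/-- The balanced maximum has the same limit. -/
lemma mu_lim {Pstar : ℝ} (hP : Tendsto (fun n : ℕ =>
        (n : ℝ)⁻¹ * ∫ J, (⨆ σ : Fin n → Bool, -HSK n J σ) ∂(skMeasure n)) atTop (nhds Pstar)) {ε : ℝ} (hε : 0 < ε) :
    ∀ᶠ n : ℕ in atTop, ∀ hn : Even n, |mu (BB n) (BB_ne hn) / n - Pstar| ≤ ε := by
  have l1 : Tendsto (fun n : ℕ => (Real.log (n + 1) + 2) / Real.sqrt n) atTop (nhds 0) := by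
    have a : (fun x : ℝ => Real.log (x + 1) + 2) =o[atTop] fun x : ℝ => x ^ (1 / 2 : ℝ) := by
      refine Asymptotics.IsLittleO.add ?_ ?_
      · have h1 := isLittleO_log_rpow_atTop (r := 1 / 2) (by norm_num)
        have h2 := h1.comp_tendsto (tendsto_atTop_add_const_right atTop (1:ℝ) tendsto_id)
        refine h2.trans_isBigO ?_
        refine Asymptotics.IsBigO.of_bound 2 ?_
        filter_upwards [eventually_ge_atTop 1] with x hx
        simp only [Function.comp, id]
        rw [Real.norm_of_nonneg (by positivity), Real.norm_of_nonneg (by positivity)]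
        rw [← Real.sqrt_eq_rpow, ← Real.sqrt_eq_rpow]
        rw [show (2:ℝ) = Real.sqrt 4 by rw [show (4:ℝ) = 2 ^ 2 by norm_num]; simp, ← Real.sqrt_mul (by norm_num)]
        exact Real.sqrt_le_sqrt (by linarith)
      · refine Asymptotics.isLittleO_const_left.2 (Or.inr ?_)
        exact tendsto_norm_atTop_atTop.comp (tendsto_rpow_atTop (by norm_num))
    have b := (a.comp_tendsto tendsto_natCast_atTop_atTop).tendsto_div_nhds_zero
    refine b.congr fun n => ?_
    simp only [Function.comp]
    rw [Real.sqrt_eq_rpow]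
  have e1 := l1.eventually (gt_mem_nhds (show (0:ℝ) < ε / 2 by positivity))
  have e2 := (Metric.tendsto_nhds.1 hP) (ε / 2) (by positivity)
  filter_upwards [e1, e2, eventually_gt_atTop 0] with n h1 h2 h0 hn
  have hn' : (0:ℝ) < n := by exact_mod_cast h0
  have hq : (0:ℝ) < Real.sqrt n := Real.sqrt_pos.2 hn'
  rw [mu_univ, Real.dist_eq, inv_mul_eq_div] at h2
  have u1 := div_le_div_of_nonneg_right (mu_le hn) hn'.le
  have u2 := div_le_div_of_nonneg_right (le_mu h0 hn) hn'.le
  have e3 : (mu (BB n) (BB_ne hn) + Real.sqrt n * (Real.log (n + 1) + 2)) / n =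
      mu (BB n) (BB_ne hn) / n + (Real.log (n + 1) + 2) / Real.sqrt n := by
    rw [add_div]
    congr 1
    rw [div_eq_div_iff hn'.ne' hq.ne']
    have : Real.sqrt n * Real.sqrt n = n := Real.mul_self_sqrt hn'.le
    calc _ = (Real.log (n + 1) + 2) * (Real.sqrt n * Real.sqrt n) := by ring
      _ = _ := by rw [this]
  rw [e3] at u2
  rw [abs_lt] at h2
  rw [abs_le]
  constructor <;> linarith [h2.1, h2.2]

end SK

set_option linter.all false
open MeasureTheory Filter Finset

section Fin1
variable {n γ : ℕ} {h k k' : ℝ → ℝ} {K2 : ℝ}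

lemma Fe_max (h0 : 0 < n) (hn : Even n) {β : ℝ} (hβ : 0 < β) (H : (Fin n → Bool) → ℝ) :
    (BB n).sup' (BB_ne hn) H / n ≤ Fe n (BB n) β H ∧
      Fe n (BB n) β H ≤ (BB n).sup' (BB_ne hn) H / n + Real.log 2 / β := by
  have hn' : (0:ℝ) < n := by exact_mod_cast h0
  have hc : (0:ℝ) < (BB n).card := by exact_mod_cast (BB_ne hn).card_pos
  set m := (BB n).sup' (BB_ne hn) H with hm
  unfold Fe
  constructor
  · obtain ⟨σ, hσ, he⟩ := Finset.exists_mem_eq_sup' (BB_ne hn) H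
    have := le_logZ (β := β) H hσ
    rw [div_le_div_iff₀ hn' (by positivity), hm, he]
    nlinarith
  · have h1 := logZ_le (BB_ne hn) hβ.le H (m := m) (fun σ hσ => Finset.le_sup' H hσ)
    have h2 : Real.log (BB n).card ≤ n * Real.log 2 := by
      rw [← Real.log_pow]
      refine Real.log_le_log hc ?_
      have := Finset.card_le_univ (BB n)
      rw [Fintype.card_fun, Fintype.card_bool, Fintype.card_fin] at this
      exact_mod_cast this
    have e : m / n + Real.log 2 / β = (n * Real.log 2 + β * m) / (β * n) := by field_simp; ring
    rw [e]
    exact div_le_div_of_nonneg_right (by linarith) (by positivity)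

lemma sk_test (h0 : 0 < n) (hn : Even n) (hc : Cut h k k' K2) {β ε P ς : ℝ} (hβ : 0 < β) (hε : 0 < ε)
    (hβ2 : Real.log 2 / β ≤ ε / 2) (hmu : |mu (BB n) (BB_ne hn) / n - P| ≤ ε / 2) (hς : ς = 1 ∨ ς = -1) :
    ∫ J, h (ς * Fe n (BB n) β (YY Sp J) - (ς * P + ε)) ∂(gv (Fin n × Fin n)) ≤ 4 / Real.sqrt n := by
  have hn' : (0:ℝ) < n := by exact_mod_cast h0
  have hq : (0:ℝ) < Real.sqrt n := Real.sqrt_pos.2 hn'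
  have hi : Integrable (fun J => |Mx (BB n) (BB_ne hn) J - mu (BB n) (BB_ne hn)| / n) (gv (Fin n × Fin n)) :=
    ((Mx_int _ _).sub (integrable_const _)).abs.div_const _
  have hpt : ∀ J, h (ς * Fe n (BB n) β (YY Sp J) - (ς * P + ε)) ≤ |Mx (BB n) (BB_ne hn) J - mu (BB n) (BB_ne hn)| / n := by
    intro J
    obtain ⟨f1, f2⟩ := Fe_max h0 hn hβ (YY Sp J)
    have f1' : Mx (BB n) (BB_ne hn) J / n ≤ Fe n (BB n) β (YY Sp J) := f1
    have f2' : Fe n (BB n) β (YY Sp J) ≤ Mx (BB n) (BB_ne hn) J / n + Real.log 2 / β := f2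
    have nn : 0 ≤ |Mx (BB n) (BB_ne hn) J - mu (BB n) (BB_ne hn)| / n := by positivity
    refine le_trans (hc.mono ?_) (hc.hle _ nn)
    have e : |Mx (BB n) (BB_ne hn) J - mu (BB n) (BB_ne hn)| / n = |Mx (BB n) (BB_ne hn) J / n - mu (BB n) (BB_ne hn) / n| := by
      rw [← sub_div, abs_div, abs_of_pos hn']
    rw [e]
    have a1 := le_abs_self (Mx (BB n) (BB_ne hn) J / n - mu (BB n) (BB_ne hn) / n)
    have a2 := neg_abs_le (Mx (BB n) (BB_ne hn) J / n - mu (BB n) (BB_ne hn) / n)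
    rw [abs_le] at hmu
    rcases hς with rfl | rfl <;> linarith [hmu.1, hmu.2]
  refine (integral_mono_of_nonneg (Eventually.of_forall fun J => hc.nonneg _) hi (Eventually.of_forall hpt)).trans ?_
  rw [integral_div, div_le_div_iff₀ hn' hq]
  have h2 := Mx_dev h0 (BB n) (BB_ne hn)
  have : Real.sqrt n * Real.sqrt n = n := Real.mul_self_sqrt hn'.le
  calc _ ≤ 4 * Real.sqrt n * Real.sqrt n := mul_le_mul_of_nonneg_right h2 hq.le
    _ = 4 * n := by rw [mul_assoc, this]

/-- Error term. -/
noncomputable def RR (γ : ℕ) (β K2 : ℝ) (n : ℕ) : ℝ :=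
  4 / Real.sqrt n + (4 * β * Real.sqrt γ * Real.exp (8 * γ ^ 2) / γ + (4 * γ ^ 2 + 16 * β * γ + 3 * K2)) / n * (Real.pi / 2)

lemma RR_lim (γ : ℕ) (β K2 : ℝ) : Tendsto (RR γ β K2) atTop (nhds 0) := by
  unfold RR
  have t1 : Tendsto (fun n : ℕ => 4 / Real.sqrt n) atTop (nhds 0) :=
    tendsto_const_nhds.div_atTop (Real.tendsto_sqrt_atTop.comp tendsto_natCast_atTop_atTop)
  have t2 : Tendsto (fun n : ℕ => (4 * β * Real.sqrt γ * Real.exp (8 * γ ^ 2) / γ + (4 * γ ^ 2 + 16 * β * γ + 3 * K2)) / (n:ℝ) * (Real.pi / 2))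
      atTop (nhds (0 * (Real.pi / 2))) :=
    (tendsto_const_nhds.div_atTop tendsto_natCast_atTop_atTop).mul_const _
  simpa using t1.add t2

lemma graph_test (h0 : 0 < n) (hn : Even n) (hγ : 0 < γ) (hc : Cut h k k' K2) {β ε P ς κ : ℝ} (hβ : 0 < β) (hε : 0 < ε)
    (hβ2 : Real.log 2 / β ≤ ε / 2) (hmu : |mu (BB n) (BB_ne hn) / n - P| ≤ ε / 2) (hς : ς = 1 ∨ ς = -1)
    (hκ : κ = 2 * β * 11 / Real.sqrt γ + 48 * β ^ 2 / Real.sqrt γ) :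
    ∑ G ∈ regs n γ, h (ς * Fe n (BB n) β (XX γ Sp G) - (ς * P + ε) - κ * (Real.pi / 2)) ≤
      (regs n γ).card * RR γ β K2 n := by
  have hn' : (0:ℝ) < n := by exact_mod_cast h0
  have hγ' : (0:ℝ) < γ := by exact_mod_cast hγ
  have hς' : |ς| = 1 := by rcases hς with rfl | rfl <;> simp
  refine (interp h0 hγ hc (BB_ne hn) BB_bal (M := MG γ) (fun G _ => MG_QB G) hβ hς' (ς * P + ε) hκ).trans ?_
  have s1 := sk_test h0 hn hc hβ hε hβ2 hmu hς
  have s2 := MG_sum (n := n) (γ := γ) h0 hγ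
  have cn : (0:ℝ) ≤ (regs n γ).card := Nat.cast_nonneg _
  have s3 : ∑ G ∈ regs n γ, max (MG γ G - 11 * n * Real.sqrt γ) 0 ≤ (regs n γ).card * (2 * Real.sqrt γ * Real.exp (8 * γ ^ 2)) := by
    refine s2.trans (mul_le_mul_of_nonneg_left ?_ cn)
    refine mul_le_of_le_one_right (by positivity) ?_
    rw [Real.exp_le_one_iff]; linarith
  have s4 := mul_le_mul_of_nonneg_left s3 (show 0 ≤ 2 * β / (γ * n) by positivity)
  have s5 := mul_le_mul_of_nonneg_left s1 cn
  have hpi : 0 ≤ Real.pi / 2 := by positivity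
  have s6 := mul_le_mul_of_nonneg_right (add_le_add_left s4 ((regs n γ).card * ((4 * γ ^ 2 + 16 * β * γ + 3 * K2) / n))) hpi
  refine (add_le_add s5 s6).trans (le_of_eq ?_)
  unfold RR
  field_simp
  ring

lemma cut_eq (hγ : 0 < γ) {G : SimpleGraph (Fin n)} (hG : G ∈ regs n γ) (σ : Fin n → Bool) :
    (cutSize G (Finset.univ.filter fun x => σ x = true) : ℝ) = γ * n / 4 + Real.sqrt γ / 2 * XX γ Sp G σ := by
  have hγ' : (0:ℝ) < γ := by exact_mod_cast hγ
  have hs : (0:ℝ) < Real.sqrt γ := Real.sqrt_pos.2 hγ'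
  have h1 : (cutSize G (Finset.univ.filter fun x => σ x = true) : ℝ) =
      ∑ x, ∑ y, adj G x y * ((1 + Sp σ x) / 2) * ((1 - Sp σ y) / 2) := by
    unfold cutSize
    push_cast
    rw [Finset.sum_filter]
    refine Finset.sum_congr rfl fun x _ => ?_
    have hcmp : (Finset.univ.filter fun x => σ x = true)ᶜ = Finset.univ.filter fun x => ¬ σ x = true := by
      ext; simp
    rw [hcmp, Finset.sum_filter]
    by_cases hx : σ x = true
    · rw [if_pos hx]
      refine Finset.sum_congr rfl fun y _ => ?_
      unfold adj Sp spin
      by_cases hy : σ y = true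
      · simp [hx, hy]
      · simp only [Bool.not_eq_true] at hy
        simp [hx, hy]
    · rw [if_neg hx]
      symm
      refine Finset.sum_eq_zero fun y _ => ?_
      simp only [Bool.not_eq_true] at hx
      unfold Sp spin
      simp [hx]
  have h2 : ∑ x, ∑ y, adj G x y * ((1 + Sp σ x) / 2) * ((1 - Sp σ y) / 2) =
      (EE G (fun _ => 1) (fun _ => 1) + EE G (Sp σ) (fun _ => 1) - EE G (fun _ => 1) (Sp σ) - EE G (Sp σ) (Sp σ)) / 4 := by
    unfold EE
    rw [← Finset.sum_add_distrib, ← Finset.sum_sub_distrib, ← Finset.sum_sub_distrib, Finset.sum_div]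
    refine Finset.sum_congr rfl fun x _ => ?_
    rw [← Finset.sum_add_distrib, ← Finset.sum_sub_distrib, ← Finset.sum_sub_distrib, Finset.sum_div]
    refine Finset.sum_congr rfl fun y _ => ?_
    ring
  rw [h1, h2, EE_one_right hG, EE_one_right hG, EE_one_left hG]
  unfold XX
  simp only [Finset.sum_const, Finset.card_univ, Fintype.card_fin, nsmul_eq_mul, mul_one]
  field_simp
  ring

lemma bis_iff (hn : Even n) (σ : Fin n → Bool) : IsBisection (Finset.univ.filter fun x => σ x = true) ↔ σ ∈ BB n := by
  have e : ∑ x, Sp σ x = 2 * ((Finset.univ.filter fun x => σ x = true).card : ℝ) - n := by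
    have : ∀ x, Sp σ x = 2 * (if σ x = true then (1:ℝ) else 0) - 1 := by
      intro x; unfold Sp spin; by_cases h : σ x = true
      · rw [if_pos h, if_pos h]; norm_num
      · rw [if_neg h, if_neg h]; norm_num
    simp only [this]
    rw [Finset.sum_sub_distrib, ← Finset.mul_sum, Finset.sum_boole]
    simp
  unfold IsBisection BB
  rw [Finset.mem_filter, e]
  set c := (Finset.univ.filter fun x => σ x = true).card with hc
  obtain ⟨m, hm⟩ := hn
  constructor
  · intro h
    refine ⟨Finset.mem_univ _, ?_⟩
    have : 2 * c = n := by omega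
    rw [← this]; push_cast; ring
  · rintro ⟨_, h⟩
    have : 2 * c = n := by
      have h' : 2 * (c:ℝ) = n := by linarith
      exact_mod_cast h'
    omega

lemma MCUT_eq (h0 : 0 < n) (hn : Even n) (hγ : 0 < γ) {G : SimpleGraph (Fin n)} (hG : G ∈ regs n γ) :
    (MCUT G : ℝ) / n = γ / 4 + Real.sqrt γ / 2 * ((BB n).sup' (BB_ne hn) (XX γ Sp G) / n) := by
  have hn' : (0:ℝ) < n := by exact_mod_cast h0
  have hs : (0:ℝ) ≤ Real.sqrt γ := Real.sqrt_nonneg _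
  set m := (BB n).sup' (BB_ne hn) (XX γ Sp G) with hm
  have key : (MCUT G : ℝ) = γ * n / 4 + Real.sqrt γ / 2 * m := by
    have hfin : {k : ℕ | ∃ S : Finset (Fin n), IsBisection S ∧ cutSize G S = k}.Finite := by
      refine (Set.finite_range (fun S : Finset (Fin n) => cutSize G S)).subset ?_
      rintro k ⟨S, _, rfl⟩
      exact ⟨S, rfl⟩
    obtain ⟨σ, hσ, he⟩ := Finset.exists_mem_eq_sup' (BB_ne hn) (XX γ Sp G)
    have hmem : cutSize G (Finset.univ.filter fun x => σ x = true) ∈ {k : ℕ | ∃ S : Finset (Fin n), IsBisection S ∧ cutSize G S = k} :=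
      ⟨_, (bis_iff hn σ).2 hσ, rfl⟩
    apply le_antisymm
    · obtain ⟨S, hS, hk⟩ := Nat.sSup_mem ⟨_, hmem⟩ hfin.bddAbove
      have hk' : cutSize G S = MCUT G := hk
      rw [← hk']
      have eS : S = Finset.univ.filter fun x => (decide (x ∈ S)) = true := by ext; simp
      rw [eS, cut_eq hγ hG]
      rw [eS] at hS
      have h2 := Finset.le_sup' (XX γ Sp G) ((bis_iff hn _).1 hS)
      have := mul_le_mul_of_nonneg_left h2 (show 0 ≤ Real.sqrt γ / 2 by positivity)
      linarith
    · have h3 : cutSize G (Finset.univ.filter fun x => σ x = true) ≤ MCUT G := le_csSup hfin.bddAbove hmem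
      have h4 : (cutSize G (Finset.univ.filter fun x => σ x = true) : ℝ) ≤ MCUT G := by exact_mod_cast h3
      rw [cut_eq hγ hG, ← he] at h4
      exact h4
  rw [key]; field_simp

lemma regs_ne (h0 : 0 < n) (hn : Even n) (hg : 2 * γ ≤ n) : (regs n γ).Nonempty := by
  classical
  obtain ⟨m, hm⟩ := hn
  have hm0 : 0 < m := by omega
  haveI : NeZero m := ⟨hm0.ne'⟩
  have hcard : Fintype.card (Fin n) = Fintype.card (ZMod m × Bool) := by
    rw [Fintype.card_prod, ZMod.card, Fintype.card_bool, Fintype.card_fin]; omega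
  set e := Fintype.equivOfCardEq hcard with he
  have inj : Function.Injective (fun k : Fin γ => ((k.1 : ℕ) : ZMod m)) := by
    intro a b hab
    have h1 := (ZMod.natCast_eq_natCast_iff' a.1 b.1 m).1 hab
    rw [Nat.mod_eq_of_lt (by omega), Nat.mod_eq_of_lt (by omega)] at h1
    exact Fin.ext h1
  set R : ZMod m × Bool → ZMod m × Bool → Prop := fun u v =>
    (u.2 = false ∧ v.2 = true ∧ ∃ k : Fin γ, v.1 = u.1 + ((k.1 : ℕ) : ZMod m)) ∨
    (u.2 = true ∧ v.2 = false ∧ ∃ k : Fin γ, u.1 = v.1 + ((k.1 : ℕ) : ZMod m)) with hR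
  set G : SimpleGraph (Fin n) :=
    { Adj := fun x y => R (e x) (e y)
      symm := ⟨fun x y h => by
        rcases h with ⟨a, b, c⟩ | ⟨a, b, c⟩
        · exact Or.inr ⟨b, a, c⟩
        · exact Or.inl ⟨b, a, c⟩⟩
      loopless := ⟨fun x h => by
        rcases h with ⟨a, b, c⟩ | ⟨a, b, c⟩
        · rw [a] at b; exact Bool.noConfusion b
        · rw [a] at b; exact Bool.noConfusion b⟩ } with hGd
  refine ⟨G, ?_⟩
  unfold regs
  rw [Finset.mem_filter]
  refine ⟨Finset.mem_univ _, fun v => ?_⟩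
  have hadj : ∀ x y, G.Adj x y ↔ R (e x) (e y) := fun x y => Iff.rfl
  rcases hb : (e v).2 with _ | _
  · have : G.neighborSet v = (fun k : Fin γ => e.symm ((e v).1 + ((k.1 : ℕ) : ZMod m), true)) '' Set.univ := by
      ext w
      rw [SimpleGraph.mem_neighborSet, hadj]
      constructor
      · rintro (⟨a, b, c, hc⟩ | ⟨a, b, c⟩)
        · refine ⟨c, Set.mem_univ _, ?_⟩
          beta_reduce
          rw [Equiv.symm_apply_eq, ← hc, ← b]
        · rw [hb] at a; exact Bool.noConfusion a
      · rintro ⟨c, _, rfl⟩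
        refine Or.inl ⟨hb, ?_, c, ?_⟩ <;> simp
    rw [this, Set.ncard_image_of_injective, Set.ncard_univ, Nat.card_eq_fintype_card, Fintype.card_fin]
    intro a b hab
    have h2 := e.symm.injective hab
    rw [Prod.mk.injEq] at h2
    exact inj (add_left_cancel h2.1)
  · have : G.neighborSet v = (fun k : Fin γ => e.symm ((e v).1 - ((k.1 : ℕ) : ZMod m), false)) '' Set.univ := by
      ext w
      rw [SimpleGraph.mem_neighborSet, hadj]
      constructor
      · rintro (⟨a, b, c⟩ | ⟨a, b, c, hc⟩)
        · rw [hb] at a; exact Bool.noConfusion a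
        · refine ⟨c, Set.mem_univ _, ?_⟩
          beta_reduce
          rw [Equiv.symm_apply_eq, hc, ← b, add_sub_cancel_right]
      · rintro ⟨c, _, rfl⟩
        refine Or.inr ⟨hb, ?_, c, ?_⟩ <;> simp
    rw [this, Set.ncard_image_of_injective, Set.ncard_univ, Nat.card_eq_fintype_card, Fintype.card_fin]
    intro a b hab
    have h2 := e.symm.injective hab
    rw [Prod.mk.injEq] at h2
    exact inj (sub_right_injective h2.1)

end Fin1

set_option linter.all false
open MeasureTheory Filter Finset

lemma bad_bound {n γ : ℕ} {h k k' : ℝ → ℝ} {K2 β ε P κ : ℝ} (h0 : 0 < n) (hn : Even n) (hγ : 0 < γ)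
    (hc : Cut h k k' K2) (hβ : 0 < β) (hε : 0 < ε) (hβ2 : Real.log 2 / β ≤ ε / 4 / 2)
    (hmu : |mu (BB n) (BB_ne hn) / n - P| ≤ ε / 4 / 2)
    (hκ : κ = 2 * β * 11 / Real.sqrt γ + 48 * β ^ 2 / Real.sqrt γ) (hκ2 : κ * (Real.pi / 2) ≤ ε / 4)
    (T : Finset (SimpleGraph (Fin n))) (hT : T ⊆ regs n γ)
    (hbad : ∀ G ∈ T, ¬ |(MCUT G : ℝ) / n - ((γ : ℝ) / 4 + P * Real.sqrt ((γ : ℝ) / 4))| ≤ ε * Real.sqrt (γ : ℝ)) :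
    (T.card : ℝ) * h ε ≤ 2 * ((regs n γ).card * RR γ β K2 n) := by
  have t1 := graph_test (γ := γ) (ς := 1) h0 hn hγ hc hβ (ε := ε / 4) (by positivity) hβ2 hmu (Or.inl rfl) hκ
  have t2 := graph_test (γ := γ) (ς := -1) h0 hn hγ hc hβ (ε := ε / 4) (by positivity) hβ2 hmu (Or.inr rfl) hκ
  have hs : 0 < Real.sqrt (γ : ℝ) := Real.sqrt_pos.2 (by exact_mod_cast hγ)
  have hs4 : Real.sqrt ((γ : ℝ) / 4) = Real.sqrt γ / 2 := by
    rw [Real.sqrt_div (Nat.cast_nonneg _), show (4:ℝ) = 2 ^ 2 by norm_num, Real.sqrt_sq (by norm_num)]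
  have main : (T.card : ℝ) * h ε ≤ ∑ G ∈ regs n γ,
      (h (1 * Fe n (BB n) β (XX γ Sp G) - (1 * P + ε / 4) - κ * (Real.pi / 2)) +
       h (-1 * Fe n (BB n) β (XX γ Sp G) - (-1 * P + ε / 4) - κ * (Real.pi / 2))) := by
    rw [← nsmul_eq_mul, ← Finset.sum_const]
    refine le_trans (Finset.sum_le_sum fun G hG => ?_)
      (Finset.sum_le_sum_of_subset_of_nonneg hT fun G _ _ => add_nonneg (hc.nonneg _) (hc.nonneg _))
    have hb := hbad G hG
    rw [MCUT_eq h0 hn hγ (hT hG), hs4] at hb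
    obtain ⟨f1, f2⟩ := Fe_max h0 hn hβ (XX γ Sp G)
    generalize (BB n).sup' (BB_ne hn) (XX γ Sp G) / n = M at *
    generalize Fe n (BB n) β (XX γ Sp G) = F at *
    have e1 : (γ:ℝ) / 4 + Real.sqrt γ / 2 * M - (γ / 4 + P * (Real.sqrt γ / 2)) = (M - P) / 2 * Real.sqrt γ := by ring
    rw [e1, abs_mul, abs_of_pos hs, mul_le_mul_iff_left₀ hs, not_le, lt_abs] at hb
    rcases hb with hb | hb
    · have := hc.mono (a := ε) (b := 1 * F - (1 * P + ε / 4) - κ * (Real.pi / 2)) (by linarith)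
      linarith [hc.nonneg (-1 * F - (-1 * P + ε / 4) - κ * (Real.pi / 2))]
    · have := hc.mono (a := ε) (b := -1 * F - (-1 * P + ε / 4) - κ * (Real.pi / 2)) (by linarith)
      linarith [hc.nonneg (1 * F - (1 * P + ε / 4) - κ * (Real.pi / 2))]
  rw [Finset.sum_add_distrib] at main
  linarith

theorem max_bisection_regular
    (Pstar : ℝ)
    (hP : Tendsto (fun n : ℕ =>
        (n : ℝ)⁻¹ * ∫ J, (⨆ σ : Fin n → Bool, -HSK n J σ) ∂(skMeasure n))
      atTop (nhds Pstar)) :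
    ∀ ε > (0 : ℝ), ∃ γ₀ : ℕ, ∀ γ : ℕ, γ ≥ γ₀ →
      Tendsto (fun n : ℕ =>
          probUniform {G : SimpleGraph (Fin n) | ∀ v, (G.neighborSet v).ncard = γ}
            {G : SimpleGraph (Fin n) |
              |(MCUT G : ℝ) / n - ((γ : ℝ) / 4 + Pstar * Real.sqrt ((γ : ℝ) / 4))|
                ≤ ε * Real.sqrt (γ : ℝ)})
        (atTop ⊓ Filter.principal {n : ℕ | Even n ∧ γ < n}) (nhds 1) := by
  intro ε hε
  obtain ⟨h, k, k', K2, hc⟩ := exists_cut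
  have hl2 : 0 < Real.log 2 := Real.log_pos (by norm_num)
  obtain ⟨β, hβ, hβ2⟩ : ∃ β : ℝ, 0 < β ∧ Real.log 2 / β ≤ ε / 4 / 2 := by
    refine ⟨Real.log 2 / (ε / 4 / 2), by positivity, ?_⟩
    rw [div_div_cancel₀ hl2.ne']
  set C := (2 * β * 11 + 48 * β ^ 2) * (Real.pi / 2) with hC
  have hC0 : 0 < C := by have := Real.pi_pos; positivity
  refine ⟨⌈(C / (ε / 4)) ^ 2⌉₊ + 1, fun γ hγ0 => ?_⟩
  have hγ : 0 < γ := by omega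
  have hs : 0 < Real.sqrt (γ : ℝ) := Real.sqrt_pos.2 (by exact_mod_cast hγ)
  have hκ2 : (2 * β * 11 / Real.sqrt γ + 48 * β ^ 2 / Real.sqrt γ) * (Real.pi / 2) ≤ ε / 4 := by
    have e : (2 * β * 11 / Real.sqrt γ + 48 * β ^ 2 / Real.sqrt γ) * (Real.pi / 2) = C / Real.sqrt γ := by
      rw [hC]; ring
    have q : C / (ε / 4) ≤ Real.sqrt γ := by
      apply Real.le_sqrt_of_sq_le
      refine (Nat.le_ceil _).trans ?_
      exact_mod_cast (by omega : ⌈(C / (ε / 4)) ^ 2⌉₊ ≤ γ)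
    rw [e, div_le_iff₀ hs]
    rw [div_le_iff₀ (by positivity)] at q
    linarith
  have hh : 0 < h ε := hc.hp ε hε
  have lim : Tendsto (fun n => 1 - 2 / h ε * RR γ β K2 n)
      (atTop ⊓ Filter.principal {n : ℕ | Even n ∧ γ < n}) (nhds 1) := by
    have := ((RR_lim γ β K2).const_mul (2 / h ε)).const_sub 1
    rw [mul_zero, sub_zero] at this
    exact this.mono_left inf_le_left
  have key : ∀ᶠ n : ℕ in atTop ⊓ Filter.principal {n : ℕ | Even n ∧ γ < n},
      1 - 2 / h ε * RR γ β K2 n ≤ probUniform {G : SimpleGraph (Fin n) | ∀ v, (G.neighborSet v).ncard = γ}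
            {G : SimpleGraph (Fin n) |
              |(MCUT G : ℝ) / n - ((γ : ℝ) / 4 + Pstar * Real.sqrt ((γ : ℝ) / 4))|
                ≤ ε * Real.sqrt (γ : ℝ)} ∧
      probUniform {G : SimpleGraph (Fin n) | ∀ v, (G.neighborSet v).ncard = γ}
            {G : SimpleGraph (Fin n) |
              |(MCUT G : ℝ) / n - ((γ : ℝ) / 4 + Pstar * Real.sqrt ((γ : ℝ) / 4))|
                ≤ ε * Real.sqrt (γ : ℝ)} ≤ 1 := by
    rw [eventually_inf_principal]
    filter_upwards [mu_lim hP (ε := ε / 4 / 2) (by positivity), eventually_ge_atTop (2 * γ), eventually_gt_atTop 0]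
      with n hmu hn2 h0 hn
    obtain ⟨hn, -⟩ := hn
    classical
    set good : SimpleGraph (Fin n) → Prop := fun G =>
      |(MCUT G : ℝ) / n - ((γ : ℝ) / 4 + Pstar * Real.sqrt ((γ : ℝ) / 4))| ≤ ε * Real.sqrt (γ : ℝ) with hgood
    have hA : {G : SimpleGraph (Fin n) | ∀ v, (G.neighborSet v).ncard = γ} = ↑(regs n γ) := by
      ext G; simp [regs]
    have hB : (↑(regs n γ) ∩ {G : SimpleGraph (Fin n) | good G} : Set (SimpleGraph (Fin n))) =
        ↑((regs n γ).filter good) := by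
      ext G; simp
    have hpr : probUniform {G : SimpleGraph (Fin n) | ∀ v, (G.neighborSet v).ncard = γ}
        {G : SimpleGraph (Fin n) | good G} = (((regs n γ).filter good).card : ℝ) / (regs n γ).card := by
      unfold probUniform
      rw [hA, hB, Set.ncard_coe_finset, Set.ncard_coe_finset]
    rw [hpr]
    have hcp : (0:ℝ) < (regs n γ).card := by exact_mod_cast (regs_ne h0 hn hn2).card_pos
    have hsum : (((regs n γ).filter good).card : ℝ) + ((regs n γ).filter fun G => ¬ good G).card = (regs n γ).card := by
      exact_mod_cast Finset.card_filter_add_card_filter_not (s := regs n γ) good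
    have hb := bad_bound h0 hn hγ hc hβ hε hβ2 (hmu hn) rfl hκ2 ((regs n γ).filter fun G => ¬ good G)
      (Finset.filter_subset _ _) (fun G hG => (Finset.mem_filter.1 hG).2)
    have hb2 : (((regs n γ).filter fun G => ¬ good G).card : ℝ) ≤ 2 / h ε * RR γ β K2 n * (regs n γ).card := by
      rw [← le_div_iff₀ hh] at hb
      refine hb.trans (le_of_eq ?_)
      ring
    constructor
    · rw [le_div_iff₀ hcp]; linarith
    · rw [div_le_one hcp]
      linarith [(Nat.cast_nonneg ((regs n γ).filter fun G => ¬ good G).card : (0:ℝ) ≤ _)]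
  exact tendsto_of_tendsto_of_tendsto_of_le_of_le' lim tendsto_const_nhds
    (key.mono fun _ h => h.1) (key.mono fun _ h => h.2)
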